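/- Fix ε > 0. Let n → ∞ through perfect squares n = s², and set p = p(n) = (2+ε)·(log n)/n. Then the G(n,p) probability of the set of graphs on n labelled vertices containing a spanning copy of the comb Comb_n tends to 1. -/

import Mathlib

/-- The comb of order `√n` for `n = s²`: the tree on `{0,…,s−1}×{0,…,s−1}` whose edges
are `{(i,0),(i+1,0)}` for `0 ≤ i < s−1` (the spine) together with `{(i,j),(i,j+1)}` for
all `0 ≤ i ≤ s−1`, `0 ≤ j < s−1` (the teeth). -/
def comb (s : ℕ) : SimpleGraph (Fin s × Fin s) :=
  SimpleGraph.fromRel fun a b =>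
    ((a.2 : ℕ) = 0 ∧ (b.2 : ℕ) = 0 ∧ (a.1 : ℕ) + 1 = (b.1 : ℕ)) ∨
    (a.1 = b.1 ∧ (a.2 : ℕ) + 1 = (b.2 : ℕ))

/-- `G` (a graph on `n = s·s` labelled vertices) contains a spanning copy of the comb:
there is a bijection from the vertices of the comb onto the vertices of `G` mapping
every edge of the comb to an edge of `G`. -/
def ContainsSpanningComb (s : ℕ) (G : SimpleGraph (Fin (s * s))) : Prop :=
  ∃ φ : (Fin s × Fin s) ≃ Fin (s * s),
    ∀ a b, (comb s).Adj a b → G.Adj (φ a) (φ b)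

/-- The `G(n,p)` probability of a set `A` of simple graphs on `{1,…,n}`:
`Σ_{H ∈ A} p^{e(H)}·(1−p)^{C(n,2)−e(H)}`. -/
noncomputable def gnpProb (n : ℕ) (p : ℝ) (A : SimpleGraph (Fin n) → Prop) : ℝ :=
  ∑' H : {G : SimpleGraph (Fin n) // A G},
    p ^ H.1.edgeSet.ncard * (1 - p) ^ (n.choose 2 - H.1.edgeSet.ncard)


namespace CombProof
open Finset
set_option linter.unusedSectionVars false

/-- Real indicator of a proposition. -/
noncomputable def ind (P : Prop) : ℝ := by
  classical exact if P then 1 else 0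

lemma ind_true {P : Prop} (h : P) : ind P = 1 := by simp [ind, h]
lemma ind_false {P : Prop} (h : ¬P) : ind P = 0 := by simp [ind, h]
lemma ind_nonneg (P : Prop) : 0 ≤ ind P := by
  by_cases h : P
  · rw [ind_true h]; norm_num
  · rw [ind_false h]
lemma ind_le_one (P : Prop) : ind P ≤ 1 := by
  by_cases h : P
  · rw [ind_true h]
  · rw [ind_false h]; norm_num
lemma ind_mono {P Q : Prop} (h : P → Q) : ind P ≤ ind Q := by
  by_cases hp : P
  · rw [ind_true hp, ind_true (h hp)]
  · rw [ind_false hp]; exact ind_nonneg _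
lemma ind_not (P : Prop) : ind (¬P) = 1 - ind P := by
  by_cases h : P
  · rw [ind_true h, ind_false (not_not.2 h)]; norm_num
  · rw [ind_false h, ind_true h]; norm_num
lemma ind_congr {P Q : Prop} (h : P ↔ Q) : ind P = ind Q := by
  rw [show P = Q from propext h]
lemma ind_and (P Q : Prop) : ind (P ∧ Q) = ind P * ind Q := by
  by_cases h : P
  · by_cases h' : Q
    · rw [ind_true h, ind_true h', ind_true ⟨h, h'⟩, one_mul]
    · rw [ind_false h', ind_false (fun q => h' q.2), mul_zero]
  · rw [ind_false h, ind_false (fun q => h q.1), zero_mul]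

section bv
variable {E : Type*} [DecidableEq E]

/-- Expectation of `f` of a random subset of `s`, elements `e` kept independently with
probability `v e`. -/
noncomputable def bv (s : Finset E) (v : E → ℝ) (f : Finset E → ℝ) : ℝ :=
  ∑ W ∈ s.powerset, ((∏ e ∈ W, v e) * ∏ e ∈ s \ W, (1 - v e)) * f W

lemma bv_empty (v : E → ℝ) (f : Finset E → ℝ) : bv ∅ v f = f ∅ := by
  simp [bv]

lemma bv_insert {s : Finset E} {a : E} (ha : a ∉ s) (v : E → ℝ) (f : Finset E → ℝ) :
    bv (insert a s) v f = (1 - v a) * bv s v f + v a * bv s v (fun W => f (insert a W)) := by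
  unfold bv
  rw [Finset.sum_powerset_insert ha, Finset.mul_sum, Finset.mul_sum]
  congr 1
  · refine Finset.sum_congr rfl fun W hW => ?_
    have hW' := Finset.mem_powerset.1 hW
    have haW : a ∉ W := fun h => ha (hW' h)
    rw [Finset.insert_sdiff_of_notMem _ haW, Finset.prod_insert (by simp [ha])]
    ring
  · refine Finset.sum_congr rfl fun W hW => ?_
    have hW' := Finset.mem_powerset.1 hW
    have haW : a ∉ W := fun h => ha (hW' h)
    rw [Finset.prod_insert haW, Finset.insert_sdiff_insert, Finset.sdiff_insert_of_notMem ha]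
    ring

lemma bv_congr_v {s : Finset E} {v u : E → ℝ} (h : ∀ e ∈ s, v e = u e) (f : Finset E → ℝ) :
    bv s v f = bv s u f := by
  unfold bv
  refine Finset.sum_congr rfl fun W hW => ?_
  have hW' := Finset.mem_powerset.1 hW
  congr 2
  · exact Finset.prod_congr rfl fun e he => h e (hW' he)
  · exact Finset.prod_congr rfl fun e he => by rw [h e (Finset.mem_sdiff.1 he).1]

lemma bv_congr {s : Finset E} {v : E → ℝ} {f g : Finset E → ℝ} (h : ∀ W ⊆ s, f W = g W) :
    bv s v f = bv s v g := by
  unfold bv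
  exact Finset.sum_congr rfl fun W hW => by rw [h W (Finset.mem_powerset.1 hW)]

lemma bv_const (s : Finset E) (v : E → ℝ) (c : ℝ) : bv s v (fun _ => c) = c := by
  induction s using Finset.induction_on with
  | empty => simp [bv_empty]
  | insert a s ha ih => rw [bv_insert ha, ih]; ring

lemma bv_add (s : Finset E) (v : E → ℝ) (f g : Finset E → ℝ) :
    bv s v (fun W => f W + g W) = bv s v f + bv s v g := by
  simp only [bv, mul_add, Finset.sum_add_distrib]

lemma bv_mul (s : Finset E) (v : E → ℝ) (c : ℝ) (f : Finset E → ℝ) :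
    bv s v (fun W => c * f W) = c * bv s v f := by
  simp only [bv, Finset.mul_sum]
  exact Finset.sum_congr rfl fun W _ => by ring

lemma bv_sub (s : Finset E) (v : E → ℝ) (f g : Finset E → ℝ) :
    bv s v (fun W => f W - g W) = bv s v f - bv s v g := by
  simp only [bv, mul_sub, Finset.sum_sub_distrib]

lemma bv_sum {ι : Type*} (t : Finset ι) (s : Finset E) (v : E → ℝ) (f : ι → Finset E → ℝ) :
    bv s v (fun W => ∑ i ∈ t, f i W) = ∑ i ∈ t, bv s v (f i) := by
  simp only [bv, Finset.mul_sum]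
  rw [Finset.sum_comm]

lemma bv_comm {E' : Type*} [DecidableEq E'] (s : Finset E) (v : E → ℝ) (s' : Finset E')
    (v' : E' → ℝ) (f : Finset E → Finset E' → ℝ) :
    bv s v (fun W => bv s' v' (fun W' => f W W')) =
      bv s' v' (fun W' => bv s v (fun W => f W W')) := by
  simp only [bv, Finset.mul_sum]
  rw [Finset.sum_comm]
  refine Finset.sum_congr rfl fun _ _ => Finset.sum_congr rfl fun _ _ => by ring

lemma bv_weight_nonneg {s : Finset E} {v : E → ℝ} (h0 : ∀ e, 0 ≤ v e) (h1 : ∀ e, v e ≤ 1)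
    (W : Finset E) : 0 ≤ (∏ e ∈ W, v e) * ∏ e ∈ s \ W, (1 - v e) :=
  mul_nonneg (Finset.prod_nonneg fun e _ => h0 e)
    (Finset.prod_nonneg fun e _ => sub_nonneg.2 (h1 e))

lemma bv_mono {s : Finset E} {v : E → ℝ} (h0 : ∀ e, 0 ≤ v e) (h1 : ∀ e, v e ≤ 1)
    {f g : Finset E → ℝ} (h : ∀ W, W ⊆ s → f W ≤ g W) : bv s v f ≤ bv s v g := by
  unfold bv
  refine Finset.sum_le_sum fun W hW => ?_
  exact mul_le_mul_of_nonneg_left (h W (Finset.mem_powerset.1 hW)) (bv_weight_nonneg h0 h1 W)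

lemma bv_nonneg {s : Finset E} {v : E → ℝ} (h0 : ∀ e, 0 ≤ v e) (h1 : ∀ e, v e ≤ 1)
    {f : Finset E → ℝ} (h : ∀ W, 0 ≤ f W) : 0 ≤ bv s v f := by
  have := bv_mono (s := s) h0 h1 (f := fun _ => 0) (g := f) (fun W _ => h W)
  rwa [bv_const] at this

lemma bv_le_const {s : Finset E} {v : E → ℝ} (h0 : ∀ e, 0 ≤ v e) (h1 : ∀ e, v e ≤ 1)
    {f : Finset E → ℝ} {c : ℝ} (h : ∀ W, f W ≤ c) : bv s v f ≤ c := by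
  have := bv_mono (s := s) h0 h1 (f := f) (g := fun _ => c) (fun W _ => h W)
  rwa [bv_const] at this

lemma bv_mono_v {s : Finset E} {v u : E → ℝ} (h0 : ∀ e, 0 ≤ v e) (h1 : ∀ e, u e ≤ 1)
    (hvu : ∀ e, v e ≤ u e) {f : Finset E → ℝ} (hf : Monotone f) : bv s v f ≤ bv s u f := by
  induction s using Finset.induction_on generalizing f with
  | empty => simp [bv_empty]
  | insert a s ha ih =>
    rw [bv_insert ha, bv_insert ha]
    have hf' : Monotone fun W => f (insert a W) :=
      fun W W' h => hf (Finset.insert_subset_insert a h)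
    have i1 := ih hf
    have i2 := ih hf'
    have i3 : bv s v f ≤ bv s v (fun W => f (insert a W)) :=
      bv_mono h0 (fun e => (hvu e).trans (h1 e)) fun W _ => hf (Finset.subset_insert a W)
    have i4 := h0 a
    have i5 := h1 a
    have i6 := hvu a
    nlinarith [mul_nonneg (sub_nonneg.2 i6) (sub_nonneg.2 i3), mul_nonneg (sub_nonneg.2 i5) (sub_nonneg.2 i1),
      mul_nonneg (i4.trans i6) (sub_nonneg.2 i2)]

lemma bv_update {s : Finset E} {e : E} (he : e ∈ s) (v : E → ℝ) (p : ℝ) (f : Finset E → ℝ) :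
    (1 - p) * bv s v f + p * bv s v (fun W => f (insert e W)) =
      bv s (Function.update v e (1 - (1 - v e) * (1 - p))) f := by
  have hs : s = insert e (s.erase e) := (Finset.insert_erase he).symm
  have hne : e ∉ s.erase e := Finset.notMem_erase e s
  rw [hs, bv_insert hne, bv_insert hne, bv_insert hne]
  have h1 : ∀ g, bv (s.erase e) (Function.update v e (1 - (1 - v e) * (1 - p))) g = bv (s.erase e) v g :=
    fun g => bv_congr_v (fun a ha => by
      rw [Function.update_of_ne (Finset.ne_of_mem_erase ha)]) g
  rw [h1, h1]
  simp only [Function.update_self, Finset.insert_idem]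
  ring

/-- Image lemma: sprinkling the image of a random subset of `s'` under a map `g`. -/
lemma bv_image {E' : Type*} [DecidableEq E'] [Fintype E] (s' : Finset E') (g : E' → E)
    (p : ℝ) (v : E → ℝ) (f : Finset E → ℝ) :
    bv s' (fun _ => p) (fun D => bv univ v (fun W => f (W ∪ D.image g))) =
      bv univ (fun e => 1 - (1 - v e) * (1 - p) ^ (s'.filter (fun a => g a = e)).card) f := by
  induction s' using Finset.induction_on generalizing v with
  | empty => simp [bv_empty]
  | insert a s' ha ih =>
    rw [bv_insert ha]
    have e2 : bv s' (fun _ => p) (fun D => bv univ v (fun W => f (W ∪ (insert a D).image g))) =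
        bv s' (fun _ => p) (fun D => bv univ v (fun W => f (insert (g a) W ∪ D.image g))) := by
      refine bv_congr fun D _ => bv_congr fun W _ => ?_
      rw [Finset.image_insert, Finset.union_insert, Finset.insert_union]
    rw [e2, ← bv_mul, ← bv_mul, ← bv_add]
    have e3 : ∀ D : Finset E', (1 - p) * bv univ v (fun W => f (W ∪ D.image g)) +
        p * bv univ v (fun W => f (insert (g a) W ∪ D.image g)) =
        bv univ (Function.update v (g a) (1 - (1 - v (g a)) * (1 - p)))
          (fun W => f (W ∪ D.image g)) := fun D =>
      bv_update (Finset.mem_univ (g a)) v p (fun W => f (W ∪ D.image g))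
    simp only [e3]
    rw [ih]
    refine bv_congr_v (fun e _ => ?_) f
    by_cases h : g a = e
    · subst h
      rw [Finset.filter_insert, if_pos rfl, Finset.card_insert_of_notMem (by simp [ha])]
      simp only [Function.update_self]
      ring
    · rw [Finset.filter_insert, if_neg h, Function.update_of_ne (Ne.symm h)]

lemma bv_zero (s : Finset E) (f : Finset E → ℝ) : bv s (fun _ => 0) f = f ∅ := by
  induction s using Finset.induction_on generalizing f with
  | empty => simp [bv_empty]
  | insert a s ha ih => rw [bv_insert ha, ih]; ring

lemma bv_subset_prob {s S : Finset E} (hS : S ⊆ s) (p : ℝ) :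
    bv s (fun _ => p) (fun W => ind (S ⊆ W)) = p ^ S.card := by
  induction s using Finset.induction_on generalizing S with
  | empty =>
    rw [Finset.subset_empty.1 hS, bv_empty]; simp [ind]
  | insert a s ha ih =>
    rw [bv_insert ha]
    by_cases haS : a ∈ S
    · have h1 : bv s (fun _ => p) (fun W => ind (S ⊆ W)) = 0 := by
        rw [bv_congr (g := fun _ => 0), bv_const]
        intro W hW
        exact ind_false fun h => ha (hW (h haS))
      have h2 : bv s (fun _ => p) (fun W => ind (S ⊆ insert a W)) = p ^ (S.erase a).card := by
        rw [← ih (S := S.erase a) (by rwa [← Finset.subset_insert_iff])]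
        exact bv_congr fun W _ => ind_congr Finset.subset_insert_iff
      rw [h1, h2, ← Finset.card_erase_add_one haS]
      ring
    · have hS' : S ⊆ s := (Finset.subset_insert_iff_of_notMem haS).1 hS
      have h2 : bv s (fun _ => p) (fun W => ind (S ⊆ insert a W)) = p ^ S.card := by
        rw [← ih hS']
        exact bv_congr fun W _ => ind_congr (Finset.subset_insert_iff_of_notMem haS)
      rw [ih hS', h2]; ring

/-- Containing `S` and avoiding `T`. -/
lemma bv_subset_disjoint_prob {s S T : Finset E} (hS : S ⊆ s) (hT : T ⊆ s) (hST : Disjoint S T)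
    (p : ℝ) :
    bv s (fun _ => p) (fun W => ind (S ⊆ W ∧ Disjoint W T)) = p ^ S.card * (1 - p) ^ T.card := by
  induction s using Finset.induction_on generalizing S T with
  | empty =>
    rw [Finset.subset_empty.1 hS, Finset.subset_empty.1 hT, bv_empty]; simp [ind]
  | insert a s ha ih =>
    rw [bv_insert ha]
    by_cases haS : a ∈ S
    · have haT : a ∉ T := fun h => (Finset.disjoint_left.1 hST haS) h
      have hT' : T ⊆ s := (Finset.subset_insert_iff_of_notMem haT).1 hT
      have h1 : bv s (fun _ => p) (fun W => ind (S ⊆ W ∧ Disjoint W T)) = 0 := by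
        rw [bv_congr (g := fun _ => 0), bv_const]
        intro W hW
        exact ind_false fun h => ha (hW (h.1 haS))
      have h2 : bv s (fun _ => p) (fun W => ind (S ⊆ insert a W ∧ Disjoint (insert a W) T)) =
          p ^ (S.erase a).card * (1 - p) ^ T.card := by
        rw [← ih (S := S.erase a) (by rwa [← Finset.subset_insert_iff]) hT'
          (Finset.disjoint_of_subset_left (Finset.erase_subset _ _) hST)]
        refine bv_congr fun W _ => ind_congr ?_
        rw [Finset.subset_insert_iff, Finset.disjoint_insert_left]
        tauto
      rw [h1, h2, ← Finset.card_erase_add_one haS]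
      ring
    · have hS' : S ⊆ s := (Finset.subset_insert_iff_of_notMem haS).1 hS
      by_cases haT : a ∈ T
      · have h1 : bv s (fun _ => p) (fun W => ind (S ⊆ W ∧ Disjoint W T)) =
            p ^ S.card * (1 - p) ^ (T.erase a).card := by
          rw [← ih hS' (T := T.erase a) (by rwa [← Finset.subset_insert_iff])
            (Finset.disjoint_of_subset_right (Finset.erase_subset _ _) hST)]
          refine bv_congr fun W hW => ind_congr ?_
          have haW : a ∉ W := fun h => ha (hW h)
          rw [← Finset.disjoint_erase_comm, Finset.erase_eq_of_notMem haW]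
        have h2 : bv s (fun _ => p) (fun W => ind (S ⊆ insert a W ∧ Disjoint (insert a W) T)) = 0 := by
          rw [bv_congr (g := fun _ => 0), bv_const]
          intro W _
          exact ind_false fun h => (Finset.disjoint_left.1 h.2 (Finset.mem_insert_self a W)) haT
        rw [h1, h2, ← Finset.card_erase_add_one haT]
        ring
      · have hT' : T ⊆ s := (Finset.subset_insert_iff_of_notMem haT).1 hT
        have h2 : bv s (fun _ => p) (fun W => ind (S ⊆ insert a W ∧ Disjoint (insert a W) T)) =
            p ^ S.card * (1 - p) ^ T.card := by
          rw [← ih hS' hT' hST]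
          refine bv_congr fun W _ => ind_congr ?_
          rw [Finset.subset_insert_iff_of_notMem haS, Finset.disjoint_insert_left]
          tauto
        rw [ih hS' hT' hST, h2]; ring

lemma bv_disjoint_prob {s T : Finset E} (hT : T ⊆ s) (p : ℝ) :
    bv s (fun _ => p) (fun W => ind (Disjoint W T)) = (1 - p) ^ T.card := by
  have := bv_subset_disjoint_prob (S := ∅) (T := T) (s := s) (by simp) hT (by simp) p
  simpa using this

/-- Union of two independent random sets. -/
lemma bv_union [Fintype E] (p q : ℝ) (f : Finset E → ℝ) :
    bv univ (fun _ => p) (fun D => bv univ (fun _ => q) (fun W => f (W ∪ D))) =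
      bv univ (fun _ => 1 - (1 - q) * (1 - p)) f := by
  have := bv_image (E := E) (E' := E) univ id p (fun _ => q) f
  simp only [Finset.image_id, id] at this
  rw [this]
  refine bv_congr_v (fun e _ => ?_) f
  rw [Finset.filter_eq' univ e]
  simp

/-- Planting: conditioning on containing `S`. -/
lemma bv_plant {s S : Finset E} (hS : S ⊆ s) (p : ℝ) (f : Finset E → ℝ) :
    p ^ S.card * bv s (fun _ => p) (fun W => f (S ∪ W)) =
      bv s (fun _ => p) (fun W => ind (S ⊆ W) * f W) := by
  induction s using Finset.induction_on generalizing S f with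
  | empty =>
    rw [Finset.subset_empty.1 hS, bv_empty, bv_empty]; simp [ind]
  | insert a s ha ih =>
    rw [bv_insert ha, bv_insert ha]
    by_cases haS : a ∈ S
    · have h1 : bv s (fun _ => p) (fun W => ind (S ⊆ W) * f W) = 0 := by
        rw [bv_congr (g := fun _ => 0), bv_const]
        intro W hW
        rw [ind_false fun h => ha (hW (h haS)), zero_mul]
      have h2 : bv s (fun _ => p) (fun W => ind (S ⊆ insert a W) * f (insert a W)) =
          p ^ (S.erase a).card * bv s (fun _ => p) (fun W => f (S ∪ W)) := by
        have := ih (S := S.erase a) (by rwa [← Finset.subset_insert_iff]) (fun W => f (insert a W))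
        have e1 : bv s (fun _ => p) (fun W => f (S ∪ W)) =
            bv s (fun _ => p) (fun W => f (insert a (S.erase a ∪ W))) := by
          refine bv_congr fun W _ => ?_
          rw [← Finset.insert_union, Finset.insert_erase haS]
        rw [e1, this]
        refine bv_congr fun W _ => ?_
        rw [ind_congr Finset.subset_insert_iff]
      have h3 : bv s (fun _ => p) (fun W => f (S ∪ insert a W)) =
          bv s (fun _ => p) (fun W => f (S ∪ W)) := by
        refine bv_congr fun W _ => ?_
        rw [Finset.union_insert, ← Finset.insert_union, Finset.insert_eq_of_mem haS]
      rw [h1, h2, h3, ← Finset.card_erase_add_one haS]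
      ring
    · have hS' : S ⊆ s := (Finset.subset_insert_iff_of_notMem haS).1 hS
      have i1 := ih hS' f
      have i2 := ih hS' (fun W => f (insert a W))
      have h2 : bv s (fun _ => p) (fun W => ind (S ⊆ insert a W) * f (insert a W)) =
          bv s (fun _ => p) (fun W => ind (S ⊆ W) * f (insert a W)) := by
        refine bv_congr fun W _ => ?_
        rw [ind_congr (Finset.subset_insert_iff_of_notMem haS)]
      have h3 : bv s (fun _ => p) (fun W => f (S ∪ insert a W)) =
          bv s (fun _ => p) (fun W => f (insert a (S ∪ W))) := by
        refine bv_congr fun W _ => ?_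
        rw [Finset.union_insert]
      rw [h2, h3, ← i1, ← i2]; ring

end bv
end CombProof


namespace CombProof
open Finset
set_option linter.unusedSectionVars false

section rounds
variable {E Ω : Type*} [DecidableEq E] [Fintype E] [DecidableEq Ω]

/-- Weight of a planted copy. -/
noncomputable def pw (F : Ω → Finset E) (p : ℝ) (ω : Ω) (Z : Finset E) : ℝ :=
  p⁻¹ ^ (F ω).card * ind (F ω ⊆ Z)

lemma pw_nonneg (F : Ω → Finset E) {p : ℝ} (hp : 0 < p) (ω : Ω) (Z : Finset E) :
    0 ≤ pw F p ω Z := mul_nonneg (by positivity) (ind_nonneg _)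

lemma bv_pw_mul (F : Ω → Finset E) {p : ℝ} (hp : 0 < p) (ω ω' : Ω) :
    bv univ (fun _ => p) (fun Z => pw F p ω Z * pw F p ω' Z) = p⁻¹ ^ (F ω ∩ F ω').card := by
  have h1 : bv univ (fun _ => p) (fun Z => pw F p ω Z * pw F p ω' Z) =
      bv univ (fun _ => p) (fun Z => (p⁻¹ ^ (F ω).card * p⁻¹ ^ (F ω').card) *
        ind (F ω ∪ F ω' ⊆ Z)) := by
    refine bv_congr fun Z _ => ?_
    rw [ind_congr Finset.union_subset_iff, ind_and]
    simp only [pw]; ring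
  rw [h1, bv_mul, bv_subset_prob (Finset.subset_univ _), ← pow_add,
    ← Finset.card_union_add_card_inter, pow_add]
  have : p⁻¹ ^ (F ω ∪ F ω').card * p ^ (F ω ∪ F ω').card = 1 := by
    rw [← mul_pow, inv_mul_cancel₀ hp.ne', one_pow]
  calc _ = (p⁻¹ ^ (F ω ∪ F ω').card * p ^ (F ω ∪ F ω').card) * p⁻¹ ^ (F ω ∩ F ω').card := by ring
    _ = _ := by rw [this, one_mul]

lemma plant_bound (O : Finset Ω) (hO : O.Nonempty) (F : Ω → Finset E) {p δ : ℝ} (hp : 0 < p)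
    (hp1 : p ≤ 1) (hδ : 0 < δ) (ℓ : ℕ) :
    ∑ ω ∈ O, bv univ (fun _ => p)
      (fun W => ind (¬ ∃ ω' ∈ O, F ω' ⊆ F ω ∪ W ∧ (F ω' \ W).card ≤ ℓ)) ≤
    O.card * δ + (δ * O.card)⁻¹ * ∑ ω ∈ O, ∑ ω' ∈ O,
      p⁻¹ ^ (F ω ∩ F ω').card * ind (ℓ < (F ω ∩ F ω').card) := by
  have hOc : (0 : ℝ) < O.card := by exact_mod_cast hO.card_pos
  set bad : Ω → Finset E → Prop := fun ω Z => ∀ ω' ∈ O, F ω' ⊆ Z → ℓ < (F ω ∩ F ω').card with hbad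
  have step1 : ∀ ω ∈ O, bv univ (fun _ => p)
      (fun W => ind (¬ ∃ ω' ∈ O, F ω' ⊆ F ω ∪ W ∧ (F ω' \ W).card ≤ ℓ)) ≤
      bv univ (fun _ => p) (fun Z => pw F p ω Z * ind (bad ω Z)) := by
    intro ω _
    have e := bv_plant (Finset.subset_univ (F ω)) p (fun Z => ind (bad ω Z))
    have e2 : bv univ (fun _ => p) (fun Z => pw F p ω Z * ind (bad ω Z)) =
        bv univ (fun _ => p) (fun W => ind (bad ω (F ω ∪ W))) := by
      have : bv univ (fun _ => p) (fun Z => pw F p ω Z * ind (bad ω Z)) =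
          p⁻¹ ^ (F ω).card * bv univ (fun _ => p) (fun Z => ind (F ω ⊆ Z) * ind (bad ω Z)) := by
        rw [← bv_mul]
        refine bv_congr fun Z _ => ?_
        simp only [pw]; ring
      rw [this, ← e, ← mul_assoc, ← mul_pow, inv_mul_cancel₀ hp.ne', one_pow, one_mul]
    rw [e2]
    refine bv_mono (fun _ => hp.le) (fun _ => hp1) fun W _ => ind_mono ?_
    intro h ω' hω' hsub
    by_contra hc
    push Not at hc
    refine h ⟨ω', hω', hsub, le_trans (Finset.card_le_card ?_) hc⟩
    intro e he
    rw [Finset.mem_sdiff] at he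
    have := hsub he.1
    rw [Finset.mem_union] at this
    exact Finset.mem_inter.2 ⟨this.resolve_right he.2, he.1⟩
  refine (Finset.sum_le_sum step1).trans ?_
  rw [← bv_sum]
  have step2 : ∀ Z : Finset E, ∑ ω ∈ O, pw F p ω Z * ind (bad ω Z) ≤
      O.card * δ + (δ * O.card)⁻¹ * ∑ ω ∈ O, ∑ ω' ∈ O,
        (pw F p ω Z * pw F p ω' Z) * ind (ℓ < (F ω ∩ F ω').card) := by
    intro Z
    have hT : ∑ ω ∈ O, pw F p ω Z * ind (bad ω Z) ≤ ∑ ω ∈ O, pw F p ω Z := by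
      refine Finset.sum_le_sum fun ω _ => ?_
      exact mul_le_of_le_one_right (pw_nonneg F hp ω Z) (ind_le_one _)
    have hS0 : 0 ≤ ∑ ω ∈ O, ∑ ω' ∈ O,
        (pw F p ω Z * pw F p ω' Z) * ind (ℓ < (F ω ∩ F ω').card) :=
      Finset.sum_nonneg fun ω _ => Finset.sum_nonneg fun ω' _ =>
        mul_nonneg (mul_nonneg (pw_nonneg F hp _ _) (pw_nonneg F hp _ _)) (ind_nonneg _)
    have hinv : 0 < (δ * O.card)⁻¹ := by positivity
    by_cases hc : ∑ ω ∈ O, pw F p ω Z ≤ O.card * δ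
    · nlinarith [mul_nonneg hinv.le hS0]
    · push Not at hc
      have hB0 : 0 ≤ ∑ ω ∈ O, pw F p ω Z * ind (bad ω Z) :=
        Finset.sum_nonneg fun ω _ => mul_nonneg (pw_nonneg F hp _ _) (ind_nonneg _)
      have h1 : ∑ ω ∈ O, pw F p ω Z * ind (bad ω Z) ≤
          (δ * O.card)⁻¹ * ((∑ ω ∈ O, pw F p ω Z * ind (bad ω Z)) * ∑ ω ∈ O, pw F p ω Z) := by
        rw [inv_mul_eq_div, le_div_iff₀ (by positivity)]
        exact mul_le_mul_of_nonneg_left (by linarith) hB0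
      have h2 : (∑ ω ∈ O, pw F p ω Z * ind (bad ω Z)) * ∑ ω ∈ O, pw F p ω Z ≤
          ∑ ω ∈ O, ∑ ω' ∈ O, (pw F p ω Z * pw F p ω' Z) * ind (ℓ < (F ω ∩ F ω').card) := by
        rw [Finset.sum_mul_sum]
        refine Finset.sum_le_sum fun ω _ => Finset.sum_le_sum fun ω' hω' => ?_
        by_cases hs : F ω' ⊆ Z
        · have : ind (bad ω Z) ≤ ind (ℓ < (F ω ∩ F ω').card) := ind_mono fun h => h ω' hω' hs
          have h0 := mul_nonneg (pw_nonneg F hp ω Z) (pw_nonneg F hp ω' Z)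
          nlinarith [mul_le_mul_of_nonneg_left this h0]
        · have : pw F p ω' Z = 0 := by simp only [pw]; rw [ind_false hs, mul_zero]
          rw [this]; simp
      have h3 := mul_le_mul_of_nonneg_left h2 hinv.le
      have : 0 ≤ O.card * δ := by positivity
      linarith
  refine (bv_mono (fun _ => hp.le) (fun _ => hp1) fun Z _ => step2 Z).trans ?_
  rw [bv_add, bv_const, bv_mul, bv_sum]
  refine le_of_eq ?_
  congr 2
  refine Finset.sum_congr rfl fun ω _ => ?_
  rw [bv_sum]
  refine Finset.sum_congr rfl fun ω' _ => ?_
  have : bv univ (fun _ => p) (fun Z => pw F p ω Z * pw F p ω' Z * ind (ℓ < (F ω ∩ F ω').card)) =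
      ind (ℓ < (F ω ∩ F ω').card) * bv univ (fun _ => p) (fun Z => pw F p ω Z * pw F p ω' Z) := by
    rw [← bv_mul]; exact bv_congr fun Z _ => by ring
  rw [this, bv_pw_mul F hp]; ring

/-- The spread hypothesis in summed form. -/
structure Spread (O0 : Finset Ω) (F : Ω → Finset E) (p θ α : ℝ) (A : Ω → ℝ) : Prop where
  ne : O0.Nonempty
  hA : ∀ ω ∈ O0, 1 ≤ A ω
  sumA : ∑ ω ∈ O0, A ω ≤ (1 + α) * O0.card
  hθ : 0 ≤ θ
  main : ∀ ω ∈ O0, ∀ F1 ⊆ F ω, ∑ ω' ∈ O0, (1 + 2 / p) ^ (F1 ∩ F ω').card ≤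
    O0.card * (A ω * Real.exp (θ * F1.card))

variable {O0 : Finset Ω} {F : Ω → Finset E} {p θ α : ℝ} {A : Ω → ℝ}

lemma Spread.final (H : Spread O0 F p θ α A) (hp : 0 < p) (hp1 : p ≤ 1) {δ : ℝ} (hδ : 0 < δ)
    (O : Finset Ω) (hO : O ⊆ O0) (hO2 : (O0.card : ℝ) ≤ 2 * O.card) (F' : Ω → Finset E)
    (hF' : ∀ ω ∈ O, F' ω ⊆ F ω) (ℓ : ℕ) (hℓ : ∀ ω ∈ O, (F' ω).card ≤ ℓ) :
    bv univ (fun _ => p) (fun W => ind (¬ ∃ ω ∈ O, F' ω ⊆ W)) ≤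
      δ + δ⁻¹ * (4 * ((1 + α) * Real.exp (θ * ℓ) - 1)) := by
  have h0 : (0 : ℝ) < O0.card := by exact_mod_cast H.ne.card_pos
  have hOc : (0 : ℝ) < O.card := by linarith
  have hOne : O.Nonempty := Finset.card_pos.1 (by exact_mod_cast hOc)
  have hb := plant_bound O hOne F' hp hp1 hδ 0
  have hl : O.card * bv univ (fun _ => p) (fun W => ind (¬ ∃ ω ∈ O, F' ω ⊆ W)) ≤
      ∑ ω ∈ O, bv univ (fun _ => p)
        (fun W => ind (¬ ∃ ω' ∈ O, F' ω' ⊆ F' ω ∪ W ∧ (F' ω' \ W).card ≤ 0)) := by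
    rw [← nsmul_eq_mul, ← Finset.sum_const]
    refine Finset.sum_le_sum fun ω _ => bv_mono (fun _ => hp.le) (fun _ => hp1) fun W _ =>
      ind_mono fun h => ?_
    rintro ⟨ω', hω', _, h2⟩
    refine h ⟨ω', hω', ?_⟩
    rw [Nat.le_zero, Finset.card_eq_zero] at h2
    exact Finset.sdiff_eq_empty_iff_subset.1 h2
  have hov : ∑ ω ∈ O, ∑ ω' ∈ O,
      p⁻¹ ^ (F' ω ∩ F' ω').card * ind (0 < (F' ω ∩ F' ω').card) ≤
      O0.card * (O0.card * ((1 + α) * Real.exp (θ * ℓ) - 1)) := by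
    have h1 : ∀ ω ∈ O, ∑ ω' ∈ O, p⁻¹ ^ (F' ω ∩ F' ω').card * ind (0 < (F' ω ∩ F' ω').card) ≤
        O0.card * (A ω * Real.exp (θ * ℓ) - 1) := by
      intro ω hω
      have hpt : ∀ k k' : ℕ, k ≤ k' → p⁻¹ ^ k * ind (0 < k) ≤ (1 + 2 / p) ^ k' - 1 := by
        intro k k' hk
        have hpi : 0 < p⁻¹ := by positivity
        have hb1 : (1 + 2 / p : ℝ) = 1 + 2 * p⁻¹ := by rw [div_eq_mul_inv]
        have hle : (1 + 2 / p) ^ k ≤ (1 + 2 / p) ^ k' :=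
          pow_le_pow_right₀ (by rw [hb1]; linarith) hk
        rcases Nat.eq_zero_or_pos k with rfl | hk0
        · rw [ind_false (by omega), mul_zero]
          have : (1 : ℝ) ≤ (1 + 2 / p) ^ k' := by simpa using hle
          linarith
        · rw [ind_true hk0, mul_one]
          obtain ⟨j, rfl⟩ : ∃ j, k = j + 1 := ⟨k - 1, by omega⟩
          have i1 : p⁻¹ ^ j ≤ (1 + 2 / p) ^ j := pow_le_pow_left₀ hpi.le (by rw [hb1]; linarith) j
          have i2 : 1 ≤ (1 + 2 / p) ^ j := one_le_pow₀ (by rw [hb1]; linarith)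
          have i3 : p⁻¹ ≥ 1 := (one_le_inv₀ hp).2 hp1
          have i4 : (1 + 2 / p) ^ (j + 1) = (1 + 2 / p) ^ j + 2 * p⁻¹ * (1 + 2 / p) ^ j := by
            rw [pow_succ, hb1]; ring
          have i5 : p⁻¹ ^ (j + 1) = p⁻¹ * p⁻¹ ^ j := by rw [pow_succ]; ring
          nlinarith [mul_le_mul_of_nonneg_left i1 hpi.le, mul_le_mul_of_nonneg_left i2 hpi.le]
      calc ∑ ω' ∈ O, p⁻¹ ^ (F' ω ∩ F' ω').card * ind (0 < (F' ω ∩ F' ω').card)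
          ≤ ∑ ω' ∈ O, ((1 + 2 / p) ^ (F' ω ∩ F ω').card - 1) := by
            refine Finset.sum_le_sum fun ω' hω' => hpt _ _ (Finset.card_le_card ?_)
            exact Finset.inter_subset_inter_left (hF' ω' hω')
        _ ≤ ∑ ω' ∈ O0, ((1 + 2 / p) ^ (F' ω ∩ F ω').card - 1) := by
            refine Finset.sum_le_sum_of_subset_of_nonneg hO fun ω' _ _ => ?_
            have := hpt 0 (F' ω ∩ F ω').card (Nat.zero_le _)
            rw [ind_false (by omega), mul_zero] at this
            exact this
        _ = ∑ ω' ∈ O0, (1 + 2 / p) ^ (F' ω ∩ F ω').card - O0.card := by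
            rw [Finset.sum_sub_distrib]; simp
        _ ≤ O0.card * (A ω * Real.exp (θ * (F' ω).card)) - O0.card := by
            have := H.main ω (hO hω) (F' ω) (hF' ω hω); linarith
        _ ≤ O0.card * (A ω * Real.exp (θ * ℓ)) - O0.card := by
            have hA := H.hA ω (hO hω)
            have : Real.exp (θ * (F' ω).card) ≤ Real.exp (θ * ℓ) :=
              Real.exp_le_exp.2 (mul_le_mul_of_nonneg_left (by exact_mod_cast hℓ ω hω) H.hθ)
            gcongr
        _ = _ := by ring
    have he1 : 1 ≤ Real.exp (θ * ℓ) := Real.one_le_exp (mul_nonneg H.hθ (Nat.cast_nonneg _))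
    calc _ ≤ ∑ ω ∈ O, O0.card * (A ω * Real.exp (θ * ℓ) - 1) := Finset.sum_le_sum h1
      _ ≤ ∑ ω ∈ O0, O0.card * (A ω * Real.exp (θ * ℓ) - 1) := by
          refine Finset.sum_le_sum_of_subset_of_nonneg hO fun ω hω _ => ?_
          have hA := H.hA ω hω
          have : 1 ≤ A ω * Real.exp (θ * ℓ) := by nlinarith
          exact mul_nonneg h0.le (by linarith)
      _ = O0.card * ((∑ ω ∈ O0, A ω) * Real.exp (θ * ℓ) - O0.card) := by
          rw [← Finset.mul_sum, Finset.sum_sub_distrib, Finset.sum_mul]; simp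
      _ ≤ O0.card * ((1 + α) * O0.card * Real.exp (θ * ℓ) - O0.card) := by
          have := H.sumA
          gcongr
      _ = _ := by ring
  set X := (1 + α) * Real.exp (θ * ℓ) - 1 with hX
  have hov0 : 0 ≤ O0.card * (O0.card * X) := by
    refine le_trans (Finset.sum_nonneg fun ω _ => Finset.sum_nonneg fun ω' _ => ?_) hov
    exact mul_nonneg (by positivity) (ind_nonneg _)
  have hX0 : 0 ≤ X := by
    by_contra hc
    push Not at hc
    have : (O0.card : ℝ) * (O0.card * X) < 0 := by
      have := mul_pos h0 h0
      nlinarith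
    linarith
  have hinv : 0 < (δ * O.card)⁻¹ := by positivity
  have key := (hl.trans hb).trans (add_le_add_right (mul_le_mul_of_nonneg_left hov hinv.le) _)
  have hsq : (O0.card : ℝ) * (O0.card * X) ≤ 4 * O.card * O.card * X := by
    have : (O0.card : ℝ) * O0.card ≤ (2 * O.card) * (2 * O.card) :=
      mul_le_mul hO2 hO2 h0.le (by linarith)
    nlinarith
  have h5 : (δ * O.card)⁻¹ * (O0.card * (O0.card * X)) ≤ O.card * (δ⁻¹ * (4 * X)) := by
    rw [inv_mul_eq_div, div_le_iff₀ (by positivity)]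
    calc _ ≤ _ := hsq
      _ = _ := by field_simp
  have h6 : O.card * bv univ (fun _ => p) (fun W => ind (¬ ∃ ω ∈ O, F' ω ⊆ W)) ≤
      O.card * (δ + δ⁻¹ * (4 * X)) := by linarith
  exact le_of_mul_le_mul_left h6 hOc

lemma Spread.step (H : Spread O0 F p θ α A) (hp : 0 < p) (hp1 : p ≤ 1) {δ : ℝ} (hδ : 0 < δ)
    (O : Finset Ω) (hO : O ⊆ O0) (hO2 : (O0.card : ℝ) ≤ 2 * O.card) (F' : Ω → Finset E)
    (hF' : ∀ ω ∈ O, F' ω ⊆ F ω) (ℓ ℓ' : ℕ) (hℓ : ∀ ω ∈ O, (F' ω).card ≤ ℓ) {ϑ : ℝ}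
    (hϑ : Real.exp (θ * ℓ) ≤ ϑ * 2 ^ ℓ') :
    ∑ ω ∈ O, bv univ (fun _ => p)
      (fun W => ind (¬ ∃ ω' ∈ O, F' ω' ⊆ F' ω ∪ W ∧ (F' ω' \ W).card ≤ ℓ')) ≤
      O.card * (δ + δ⁻¹ * (4 * ((1 + α) * ϑ))) := by
  have h0 : (0 : ℝ) < O0.card := by exact_mod_cast H.ne.card_pos
  have hOc : (0 : ℝ) < O.card := by linarith
  have hOne : O.Nonempty := Finset.card_pos.1 (by exact_mod_cast hOc)
  have hb := plant_bound O hOne F' hp hp1 hδ ℓ'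
  have hα : 0 ≤ (1 + α) := by
    have h1 : 0 ≤ ∑ ω ∈ O0, A ω :=
      Finset.sum_nonneg fun ω hω => le_trans zero_le_one (H.hA ω hω)
    have := h1.trans H.sumA
    by_contra hc
    push Not at hc
    nlinarith
  have hpow : (0 : ℝ) < 2 ^ ℓ' := by positivity
  have hϑ0 : 0 ≤ ϑ := by
    by_contra hc
    push Not at hc
    have := Real.exp_pos (θ * ℓ)
    nlinarith
  have hov : ∑ ω ∈ O, ∑ ω' ∈ O,
      p⁻¹ ^ (F' ω ∩ F' ω').card * ind (ℓ' < (F' ω ∩ F' ω').card) ≤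
      O0.card * (O0.card * ((1 + α) * ϑ)) := by
    have h1 : ∀ ω ∈ O, ∑ ω' ∈ O, p⁻¹ ^ (F' ω ∩ F' ω').card * ind (ℓ' < (F' ω ∩ F' ω').card) ≤
        O0.card * (A ω * ϑ) := by
      intro ω hω
      have hpt : ∀ k k' : ℕ, k ≤ k' → p⁻¹ ^ k * ind (ℓ' < k) ≤ (2 ^ ℓ')⁻¹ * (1 + 2 / p) ^ k' := by
        intro k k' hk
        have hpi : 0 < p⁻¹ := by positivity
        have hb1 : (1 + 2 / p : ℝ) = 1 + 2 * p⁻¹ := by rw [div_eq_mul_inv]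
        have hle : (1 + 2 / p) ^ k ≤ (1 + 2 / p) ^ k' :=
          pow_le_pow_right₀ (by rw [hb1]; linarith) hk
        by_cases hk0 : ℓ' < k
        · rw [ind_true hk0, mul_one, inv_mul_eq_div, le_div_iff₀ hpow]
          calc p⁻¹ ^ k * 2 ^ ℓ' ≤ p⁻¹ ^ k * 2 ^ k := by
                gcongr
                · norm_num
            _ = (p⁻¹ * 2) ^ k := by rw [mul_pow]
            _ ≤ (1 + 2 / p) ^ k := pow_le_pow_left₀ (by positivity) (by rw [hb1]; linarith) k
            _ ≤ _ := hle
        · rw [ind_false hk0, mul_zero]; positivity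
      calc ∑ ω' ∈ O, p⁻¹ ^ (F' ω ∩ F' ω').card * ind (ℓ' < (F' ω ∩ F' ω').card)
          ≤ ∑ ω' ∈ O, (2 ^ ℓ')⁻¹ * (1 + 2 / p) ^ (F' ω ∩ F ω').card := by
            refine Finset.sum_le_sum fun ω' hω' => hpt _ _ (Finset.card_le_card ?_)
            exact Finset.inter_subset_inter_left (hF' ω' hω')
        _ ≤ ∑ ω' ∈ O0, (2 ^ ℓ')⁻¹ * (1 + 2 / p) ^ (F' ω ∩ F ω').card := by
            refine Finset.sum_le_sum_of_subset_of_nonneg hO fun ω' _ _ => ?_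
            positivity
        _ = (2 ^ ℓ')⁻¹ * ∑ ω' ∈ O0, (1 + 2 / p) ^ (F' ω ∩ F ω').card := by
            rw [Finset.mul_sum]
        _ ≤ (2 ^ ℓ')⁻¹ * (O0.card * (A ω * Real.exp (θ * (F' ω).card))) := by
            have := H.main ω (hO hω) (F' ω) (hF' ω hω)
            gcongr
        _ ≤ (2 ^ ℓ')⁻¹ * (O0.card * (A ω * (ϑ * 2 ^ ℓ'))) := by
            have hA := H.hA ω (hO hω)
            have : Real.exp (θ * (F' ω).card) ≤ ϑ * 2 ^ ℓ' := le_trans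
              (Real.exp_le_exp.2 (mul_le_mul_of_nonneg_left (by exact_mod_cast hℓ ω hω) H.hθ)) hϑ
            gcongr
        _ = _ := by field_simp
    calc _ ≤ ∑ ω ∈ O, O0.card * (A ω * ϑ) := Finset.sum_le_sum h1
      _ ≤ ∑ ω ∈ O0, O0.card * (A ω * ϑ) := by
          refine Finset.sum_le_sum_of_subset_of_nonneg hO fun ω hω _ => ?_
          have hA := H.hA ω hω
          have : 0 ≤ A ω := by linarith
          positivity
      _ = O0.card * ((∑ ω ∈ O0, A ω) * ϑ) := by
          rw [← Finset.mul_sum, Finset.sum_mul]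
      _ ≤ O0.card * ((1 + α) * O0.card * ϑ) := by
          have := H.sumA
          gcongr
      _ = _ := by ring
  set X := (1 + α) * ϑ with hX
  have hX0 : 0 ≤ X := mul_nonneg hα hϑ0
  have hinv : 0 < (δ * O.card)⁻¹ := by positivity
  have key := hb.trans (add_le_add_right (mul_le_mul_of_nonneg_left hov hinv.le) _)
  have hsq : (O0.card : ℝ) * (O0.card * X) ≤ 4 * O.card * O.card * X := by
    have : (O0.card : ℝ) * O0.card ≤ (2 * O.card) * (2 * O.card) :=
      mul_le_mul hO2 hO2 h0.le (by linarith)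
    nlinarith
  have h5 : (δ * O.card)⁻¹ * (O0.card * (O0.card * X)) ≤ O.card * (δ⁻¹ * (4 * X)) := by
    rw [inv_mul_eq_div, div_le_iff₀ (by positivity)]
    calc _ ≤ _ := hsq
      _ = _ := by field_simp
  linarith

/-- The rounds theorem. -/
theorem Spread.rounds (H : Spread O0 F p θ α A) (hp : 0 < p) (hp1 : p ≤ 1) {δ δ' ϑ τ : ℝ}
    (hδ : 0 < δ) (hδ' : 0 < δ') (hτ : 0 < τ) (L : ℕ → ℕ)
    (hL : ∀ j, Real.exp (θ * L (j + 1)) ≤ ϑ * 2 ^ L j) (j : ℕ) :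
    ∀ (O : Finset Ω), O ⊆ O0 → (1 / 2 + j * τ) * O0.card ≤ O.card →
    ∀ (F' : Ω → Finset E), (∀ ω ∈ O, F' ω ⊆ F ω) → (∀ ω ∈ O, (F' ω).card ≤ L j) →
    bv univ (fun _ => 1 - (1 - p) ^ (j + 1)) (fun W => ind (¬ ∃ ω ∈ O, F' ω ⊆ W)) ≤
      (δ + δ⁻¹ * (4 * ((1 + α) * Real.exp (θ * L 0) - 1))) +
        j * ((δ' + δ'⁻¹ * (4 * ((1 + α) * ϑ))) / τ) := by
  have h0 : (0 : ℝ) < O0.card := by exact_mod_cast H.ne.card_pos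
  induction j with
  | zero =>
    intro O hO hO2 F' hF' hℓ
    have := H.final hp hp1 hδ O hO (by push_cast at hO2; linarith) F' hF' (L 0) hℓ
    simpa using this
  | succ j ih =>
    intro O hO hO2 F' hF' hℓ
    have hj0 : (0 : ℝ) ≤ j * τ := by positivity
    have hO2' : (O0.card : ℝ) ≤ 2 * O.card := by
      push_cast at hO2
      nlinarith
    have hOc : (0 : ℝ) < O.card := by linarith
    have hOle : (O.card : ℝ) ≤ O0.card := by exact_mod_cast Finset.card_le_card hO
    have hst := H.step hp hp1 hδ' O hO hO2' F' hF' (L (j + 1)) (L j) hℓ (hL j)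
    set η := δ' + δ'⁻¹ * (4 * ((1 + α) * ϑ)) with hη
    set Y := δ + δ⁻¹ * (4 * ((1 + α) * Real.exp (θ * L 0) - 1)) + j * (η / τ) with hY
    have hα : 1 ≤ 1 + α := by
      have h1 : (O0.card : ℝ) ≤ ∑ ω ∈ O0, A ω := by
        have := Finset.sum_le_sum (fun ω hω => H.hA ω hω)
        simpa using this
      have := h1.trans H.sumA
      by_contra hc
      push Not at hc
      nlinarith
    have hϑ0 : 0 ≤ ϑ := by
      by_contra hc
      push Not at hc
      have := Real.exp_pos (θ * L (j + 1))
      have h2 := hL j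
      have h3 : (0 : ℝ) < 2 ^ L j := by positivity
      nlinarith
    have hη0 : 0 ≤ η := by
      rw [hη]
      have : 0 ≤ 1 + α := by linarith
      positivity
    classical
    set bad : Finset E → Finset Ω := fun W =>
      O.filter fun ω => ¬ ∃ ω' ∈ O, F' ω' ⊆ F' ω ∪ W ∧ (F' ω' \ W).card ≤ L j with hbad
    have hsum : bv univ (fun _ => p) (fun W => ((bad W).card : ℝ)) ≤ O.card * η := by
      refine le_trans (le_of_eq ?_) hst
      rw [← bv_sum]
      refine bv_congr fun W _ => ?_
      rw [hbad]
      simp only [Finset.card_filter, Nat.cast_sum]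
      refine Finset.sum_congr rfl fun ω _ => ?_
      by_cases h : ¬ ∃ ω' ∈ O, F' ω' ⊆ F' ω ∪ W ∧ (F' ω' \ W).card ≤ L j
      · rw [ind_true h, if_pos h]; simp
      · rw [ind_false h, if_neg h]; simp
    have hq : 1 - (1 - p) ^ (j + 1 + 1) = 1 - (1 - (1 - (1 - p) ^ (j + 1))) * (1 - p) := by ring
    have h01 : 0 ≤ 1 - (1 - p) ^ (j + 1) := by
      have : (1 - p) ^ (j + 1) ≤ 1 := pow_le_one₀ (by linarith) (by linarith)
      linarith
    have h02 : 1 - (1 - p) ^ (j + 1) ≤ 1 := by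
      have : 0 ≤ (1 - p) ^ (j + 1) := pow_nonneg (by linarith) _
      linarith
    rw [hq, ← bv_union]
    have hpt : ∀ W : Finset E, bv univ (fun _ => 1 - (1 - p) ^ (j + 1))
        (fun W' => ind (¬ ∃ ω ∈ O, F' ω ⊆ W' ∪ W)) ≤ Y + (τ * O0.card)⁻¹ * (bad W).card := by
      intro W
      have hY0 : 0 ≤ Y := by
        have e1 : 1 ≤ Real.exp (θ * L 0) := Real.one_le_exp (mul_nonneg H.hθ (Nat.cast_nonneg _))
        have e2 : 0 ≤ (1 + α) * Real.exp (θ * L 0) - 1 := by nlinarith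
        have e3 : 0 ≤ η / τ := div_nonneg hη0 hτ.le
        rw [hY]
        positivity
      by_cases hc : ((bad W).card : ℝ) ≤ τ * O0.card
      · have hex : ∀ ω : Ω, ∃ G : Finset E, ω ∈ O \ bad W →
            ∃ ω' ∈ O, G = F' ω' \ W ∧ F' ω' ⊆ F' ω ∪ W ∧ (F' ω' \ W).card ≤ L j := by
          intro ω
          by_cases hω : ω ∈ O \ bad W
          · rw [Finset.mem_sdiff, hbad, Finset.mem_filter] at hω
            have : ∃ ω' ∈ O, F' ω' ⊆ F' ω ∪ W ∧ (F' ω' \ W).card ≤ L j := by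
              by_contra hcon
              exact hω.2 ⟨hω.1, hcon⟩
            obtain ⟨ω', h1, h2, h3⟩ := this
            exact ⟨F' ω' \ W, fun _ => ⟨ω', h1, rfl, h2, h3⟩⟩
          · exact ⟨∅, fun h => absurd h hω⟩
        choose G hG using hex
        have hbadO : bad W ⊆ O := Finset.filter_subset _ _
        have hcard : ((O \ bad W).card : ℝ) = O.card - (bad W).card := by
          rw [Finset.cast_card_sdiff hbadO]
        have := ih (O \ bad W) (Finset.sdiff_subset.trans hO)
          (by rw [hcard]; push_cast at hO2; linarith) G ?_ ?_
        · refine le_trans (bv_mono (fun _ => h01) (fun _ => h02) fun W' _ => ind_mono ?_)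
            (this.trans (le_add_of_nonneg_right (by positivity)))
          rintro hn ⟨ω, hω, hs⟩
          obtain ⟨ω', h1, h2, h3, h4⟩ := hG ω hω
          refine hn ⟨ω', h1, ?_⟩
          rw [h2] at hs
          intro e he
          by_cases heW : e ∈ W
          · exact Finset.mem_union_right _ heW
          · exact Finset.mem_union_left _ (hs (Finset.mem_sdiff.2 ⟨he, heW⟩))
        · intro ω hω
          obtain ⟨ω', h1, h2, h3, h4⟩ := hG ω hω
          rw [h2]
          refine Finset.Subset.trans ?_ (hF' ω (Finset.mem_sdiff.1 hω).1)
          intro e he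
          rw [Finset.mem_sdiff] at he
          exact (Finset.mem_union.1 (h3 he.1)).resolve_right he.2
        · intro ω hω
          obtain ⟨ω', h1, h2, h3, h4⟩ := hG ω hω
          rw [h2]; exact h4
      · push Not at hc
        have h1 : bv univ (fun _ => 1 - (1 - p) ^ (j + 1))
            (fun W' => ind (¬ ∃ ω ∈ O, F' ω ⊆ W' ∪ W)) ≤ 1 :=
          bv_le_const (fun _ => h01) (fun _ => h02) fun _ => ind_le_one _
        have h2 : 1 ≤ (τ * O0.card)⁻¹ * (bad W).card := by
          rw [inv_mul_eq_div, le_div_iff₀ (by positivity)]; linarith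
        linarith
    refine (bv_mono (fun _ => hp.le) (fun _ => hp1) fun W _ => hpt W).trans ?_
    rw [bv_add, bv_const, bv_mul]
    have h3 : (τ * O0.card)⁻¹ * bv univ (fun _ => p) (fun W => ((bad W).card : ℝ)) ≤ η / τ := by
      rw [inv_mul_eq_div, div_le_div_iff₀ (by positivity) hτ]
      have := hsum.trans (mul_le_mul_of_nonneg_right hOle hη0)
      nlinarith
    push_cast
    rw [hY]
    linarith

end rounds
end CombProof


namespace CombProof
open Finset
set_option linter.unusedSectionVars false

section chain
variable {V : Type} [DecidableEq V] [Fintype V]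

/-- Vertices of `J` whose image leaves `J`. -/
def ends (τ : Equiv.Perm V) (J : Finset V) : Finset V := J.filter fun v => τ v ∉ J

lemma ends_subset (τ : Equiv.Perm V) (J : Finset V) : ends τ J ⊆ J := Finset.filter_subset _ _

lemma mem_ends {τ : Equiv.Perm V} {J : Finset V} {v : V} : v ∈ ends τ J ↔ v ∈ J ∧ τ v ∉ J :=
  Finset.mem_filter

noncomputable def zsum (τ : Equiv.Perm V) (J1 : Finset V) (x : ℝ) (T : Finset V) : ℝ :=
  ∑ J ∈ J1.powerset with ends τ J = T, x ^ J.card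

lemma zsum_nonneg (τ : Equiv.Perm V) (J1 : Finset V) {x : ℝ} (hx : 0 ≤ x) (T : Finset V) :
    0 ≤ zsum τ J1 x T := Finset.sum_nonneg fun _ _ => by positivity

lemma zsum_step (τ : Equiv.Perm V) (J1 : Finset V) {x : ℝ} (hx : 0 ≤ x) (T : Finset V) {v : V}
    (hv : v ∈ T) : ∃ T', T'.card ≤ T.card ∧ (T'.card = T.card ∨ zsum τ J1 x T' = 0) ∧
      zsum τ J1 x T ≤ x * (zsum τ J1 x (T.erase v) + zsum τ J1 x T') := by
  classical
  by_cases hne : zsum τ J1 x T = 0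
  · exact ⟨T, le_rfl, Or.inl rfl, by
      rw [hne]; exact mul_nonneg hx (add_nonneg (zsum_nonneg _ _ hx _) le_rfl)⟩
  set T' := insert (τ.symm v) (T.erase v) with hT'
  obtain ⟨J0, hJ0, -⟩ := Finset.exists_ne_zero_of_sum_ne_zero hne
  rw [Finset.mem_filter] at hJ0
  have hv0 : v ∈ J0 := ends_subset τ J0 (hJ0.2 ▸ hv)
  have hnT : τ.symm v ∉ T := by
    intro h
    rw [← hJ0.2, mem_ends] at h
    apply h.2; simpa using hv0
  have hcard : T'.card = T.card := by
    rw [hT', Finset.card_insert_of_notMem (fun h => hnT (Finset.mem_of_mem_erase h)),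
      Finset.card_erase_add_one hv]
  refine ⟨T', hcard.le, Or.inl hcard, ?_⟩
  have hTne : T.erase v ≠ T' := by
    intro h
    have := congrArg Finset.card h
    rw [hcard] at this
    have := Finset.card_erase_lt_of_mem hv
    omega
  have hmaps : ∀ J ∈ J1.powerset.filter (fun J => ends τ J = T),
      J.erase v ∈ J1.powerset.filter (fun J => ends τ J = T.erase v ∨ ends τ J = T') := by
    intro J hJ
    rw [Finset.mem_filter, Finset.mem_powerset] at hJ ⊢
    refine ⟨(Finset.erase_subset _ _).trans hJ.1, ?_⟩
    have hvJ : v ∈ J ∧ τ v ∉ J := by rw [← mem_ends, hJ.2]; exact hv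
    have hvv : τ v ≠ v := fun h => hvJ.2 (by rw [h]; exact hvJ.1)
    by_cases hp : τ.symm v ∈ J
    · right
      ext u
      rw [mem_ends, hT', Finset.mem_insert, Finset.mem_erase, Finset.mem_erase, Finset.mem_erase,
        ← hJ.2, mem_ends]
      constructor
      · rintro ⟨⟨h1, h2⟩, h3⟩
        by_cases h4 : τ u = v
        · left; rw [← h4]; simp
        · right; exact ⟨h1, h2, fun h => h3 ⟨h4, h⟩⟩
      · rintro (h | ⟨h1, h2, h3⟩)
        · subst h
          refine ⟨⟨?_, hp⟩, ?_⟩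
          · intro h; apply hvv; nth_rewrite 1 [← h]; simp
          · simp
        · exact ⟨⟨h1, h2⟩, fun h => h3 h.2⟩
    · left
      ext u
      rw [mem_ends, Finset.mem_erase, Finset.mem_erase, Finset.mem_erase, ← hJ.2, mem_ends]
      constructor
      · rintro ⟨⟨h1, h2⟩, h3⟩
        refine ⟨h1, h2, fun h => h3 ⟨?_, h⟩⟩
        intro h4; apply hp; rw [← h4]; simpa using h2
      · rintro ⟨h1, h2, h3⟩
        exact ⟨⟨h1, h2⟩, fun h => h3 h.2⟩
  have hinj : Set.InjOn (fun J : Finset V => J.erase v)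
      (J1.powerset.filter (fun J => ends τ J = T) : Finset (Finset V)) := by
    intro J hJ J' hJ' h
    rw [Finset.mem_coe, Finset.mem_filter] at hJ hJ'
    have h1 : v ∈ J := ends_subset τ J (hJ.2 ▸ hv)
    have h2 : v ∈ J' := ends_subset τ J' (hJ'.2 ▸ hv)
    rw [← Finset.insert_erase h1, ← Finset.insert_erase h2]
    exact congrArg _ h
  calc zsum τ J1 x T = ∑ J ∈ J1.powerset with ends τ J = T, x * x ^ (J.erase v).card := by
        refine Finset.sum_congr rfl fun J hJ => ?_
        rw [Finset.mem_filter] at hJ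
        have h1 : v ∈ J := ends_subset τ J (hJ.2 ▸ hv)
        rw [← Finset.card_erase_add_one h1, pow_succ]; ring
    _ = x * ∑ J ∈ (J1.powerset.filter (fun J => ends τ J = T)).image (fun J => J.erase v),
          x ^ J.card := by
        rw [← Finset.mul_sum, Finset.sum_image hinj]
    _ ≤ x * ∑ J ∈ J1.powerset.filter (fun J => ends τ J = T.erase v ∨ ends τ J = T'),
          x ^ J.card := by
        refine mul_le_mul_of_nonneg_left ?_ hx
        refine Finset.sum_le_sum_of_subset_of_nonneg ?_ fun _ _ _ => by positivity
        rw [Finset.image_subset_iff]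
        exact hmaps
    _ = _ := by
        rw [Finset.filter_or, Finset.sum_union]
        · rfl
        · rw [Finset.disjoint_filter]
          intro J _ h1 h2
          exact hTne (h1.symm.trans h2)

lemma zsum_le (τ : Equiv.Perm V) (J1 : Finset V) {x : ℝ} (hx : 0 ≤ x) (hx1 : x < 1) (k : ℕ) :
    ∀ T : Finset V, T.card = k → zsum τ J1 x T ≤ zsum τ J1 x ∅ * (x / (1 - x)) ^ k := by
  classical
  induction k with
  | zero => intro T hT; rw [Finset.card_eq_zero.1 hT]; simp
  | succ k ih =>
    intro T0 hT0
    have hne : (univ.filter fun T : Finset V => T.card = k + 1).Nonempty := ⟨T0, by simp [hT0]⟩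
    obtain ⟨T, hT, hmax⟩ := Finset.exists_max_image _ (zsum τ J1 x) hne
    rw [Finset.mem_filter] at hT
    have hT0' := hmax T0 (by simp [hT0])
    refine hT0'.trans ?_
    obtain ⟨v, hv⟩ : T.Nonempty := Finset.card_pos.1 (by omega)
    obtain ⟨T', _, hT', hle⟩ := zsum_step τ J1 hx T hv
    have h1 : zsum τ J1 x T' ≤ zsum τ J1 x T := by
      rcases hT' with h | h
      · exact hmax T' (by simp [h, hT.2])
      · rw [h]; exact zsum_nonneg _ _ hx _
    have h2 := ih (T.erase v) (by rw [Finset.card_erase_of_mem hv, hT.2]; rfl)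
    have h3 : 0 < 1 - x := by linarith
    have h4 : zsum τ J1 x T * (1 - x) ≤ x * (zsum τ J1 x ∅ * (x / (1 - x)) ^ k) := by
      nlinarith [mul_le_mul_of_nonneg_left h1 hx, mul_le_mul_of_nonneg_left h2 hx]
    rw [← le_div_iff₀ h3] at h4
    refine h4.trans (le_of_eq ?_)
    rw [pow_succ]; field_simp

lemma sum_ends_le (τ : Equiv.Perm V) (J1 : Finset V) {x κ : ℝ} (hx : 0 ≤ x) (hx1 : x < 1)
    (hκ : 0 ≤ κ) : ∑ J ∈ J1.powerset, x ^ J.card * κ ^ (ends τ J).card ≤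
      zsum τ J1 x ∅ * Real.exp ((κ * (x / (1 - x))) * J1.card) := by
  classical
  have h1 : ∑ J ∈ J1.powerset, x ^ J.card * κ ^ (ends τ J).card =
      ∑ T ∈ J1.powerset, κ ^ T.card * zsum τ J1 x T := by
    rw [← Finset.sum_fiberwise_of_maps_to (s := J1.powerset) (t := J1.powerset) (g := ends τ)]
    · refine Finset.sum_congr rfl fun T _ => ?_
      rw [zsum, Finset.mul_sum]
      refine Finset.sum_congr rfl fun J hJ => ?_
      rw [(Finset.mem_filter.1 hJ).2]; ring
    · intro J hJ
      rw [Finset.mem_powerset] at hJ ⊢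
      exact (ends_subset τ J).trans hJ
  rw [h1]
  have hz := zsum_nonneg τ J1 hx ∅
  have hy : 0 ≤ κ * (x / (1 - x)) := mul_nonneg hκ (div_nonneg hx (by linarith))
  calc _ ≤ ∑ T ∈ J1.powerset, zsum τ J1 x ∅ * (κ * (x / (1 - x))) ^ T.card := by
        refine Finset.sum_le_sum fun T _ => ?_
        have := zsum_le τ J1 hx hx1 T.card T rfl
        rw [mul_pow]
        nlinarith [mul_le_mul_of_nonneg_left this (pow_nonneg hκ T.card)]
    _ = zsum τ J1 x ∅ * (κ * (x / (1 - x)) + 1) ^ J1.card := by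
        rw [← Finset.mul_sum]
        congr 1
        have := Finset.prod_add (fun _ : V => κ * (x / (1 - x))) (fun _ => 1) J1
        simp only [Finset.prod_const, one_pow, mul_one] at this
        exact this.symm
    _ ≤ zsum τ J1 x ∅ * Real.exp (κ * (x / (1 - x))) ^ J1.card := by
        have := Real.add_one_le_exp (κ * (x / (1 - x)))
        gcongr
    _ = _ := by rw [← Real.exp_nat_mul, mul_comm (J1.card : ℝ)]

/-- Graph of `τ` on `J`. -/
def gr (τ : Equiv.Perm V) (J : Finset V) : Finset (V × V) := J.image fun v => (v, τ v)

lemma mem_gr {τ : Equiv.Perm V} {J : Finset V} {e : V × V} : e ∈ gr τ J ↔ e.1 ∈ J ∧ τ e.1 = e.2 := by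
  unfold gr
  rw [Finset.mem_image]
  constructor
  · rintro ⟨v, hv, rfl⟩; exact ⟨hv, rfl⟩
  · rintro ⟨h1, h2⟩; exact ⟨e.1, h1, by rw [h2]⟩

lemma gr_inj (τ : Equiv.Perm V) : Function.Injective fun v => (v, τ v) :=
  fun _ _ h => (Prod.mk.inj h).1

lemma card_gr (τ : Equiv.Perm V) (J : Finset V) : (gr τ J).card = J.card :=
  Finset.card_image_of_injective _ (gr_inj τ)

lemma gr_subset_gr {τ τ' : Equiv.Perm V} {J J' : Finset V} :
    gr τ J ⊆ gr τ' J' ↔ ∀ v ∈ J, v ∈ J' ∧ τ' v = τ v := by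
  constructor
  · intro h v hv
    have := h (mem_gr.2 ⟨hv, rfl⟩ : (v, τ v) ∈ gr τ J)
    exact mem_gr.1 this
  · intro h e he
    rw [mem_gr] at he ⊢
    obtain ⟨h1, h2⟩ := h e.1 he.1
    exact ⟨h1, h2.trans he.2⟩

lemma subset_gr {τ : Equiv.Perm V} {J : Finset V} {F1 : Finset (V × V)} (h : F1 ⊆ gr τ J) :
    ∃ J1 ⊆ J, F1 = gr τ J1 := by
  refine ⟨F1.image Prod.fst, ?_, ?_⟩
  · intro v hv
    obtain ⟨e, he, rfl⟩ := Finset.mem_image.1 hv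
    exact (mem_gr.1 (h he)).1
  · ext e
    rw [mem_gr, Finset.mem_image]
    constructor
    · intro he; exact ⟨⟨e, he, rfl⟩, (mem_gr.1 (h he)).2⟩
    · rintro ⟨⟨e', he', h1⟩, h2⟩
      have h3 := (mem_gr.1 (h he')).2
      have : e = e' := Prod.ext h1.symm (by rw [← h2, ← h3, h1])
      rw [this]; exact he'

variable {Ω : Type} [DecidableEq Ω]

/-- The combinatorial spread hypothesis. -/
def ChainSpread (O0 : Finset Ω) (τ : Ω → Equiv.Perm V) (J : Ω → Finset V) (c κ : ℝ) : Prop :=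
  ∀ ω ∈ O0, ∀ J1 ⊆ J ω,
    ((O0.filter fun ω' => gr (τ ω) J1 ⊆ gr (τ ω') (J ω')).card : ℝ) ≤
      O0.card * (c ^ J1.card * κ ^ (ends (τ ω) J1).card)

lemma ChainSpread.sumA {O0 : Finset Ω} {τ : Ω → Equiv.Perm V} {J : Ω → Finset V} {c κ x : ℝ}
    (H : ChainSpread O0 τ J c κ) (hc : 0 ≤ c) (hx : 0 ≤ x)
    (hx1 : (Fintype.card V) * c * x < 1) :
    ∑ ω ∈ O0, zsum (τ ω) (J ω) x ∅ ≤ (1 - (Fintype.card V) * c * x)⁻¹ * O0.card := by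
  classical
  have h1 : ∑ ω ∈ O0, zsum (τ ω) (J ω) x ∅ =
      ∑ K : Finset V, x ^ K.card * ((O0.filter fun ω => K ⊆ J ω ∧ ends (τ ω) K = ∅).card : ℝ) := by
    have : ∀ ω, zsum (τ ω) (J ω) x ∅ =
        ∑ K : Finset V, if K ⊆ J ω ∧ ends (τ ω) K = ∅ then x ^ K.card else 0 := by
      intro ω
      rw [← Finset.sum_filter, zsum]
      refine Finset.sum_congr ?_ fun _ _ => rfl
      ext K; simp
    simp_rw [this]
    rw [Finset.sum_comm]
    refine Finset.sum_congr rfl fun K _ => ?_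
    rw [← Finset.sum_filter, Finset.sum_const, nsmul_eq_mul, mul_comm]
  have h2 : ∀ K : Finset V, ((O0.filter fun ω => K ⊆ J ω ∧ ends (τ ω) K = ∅).card : ℝ) ≤
      (K.card).factorial * (O0.card * c ^ K.card) := by
    intro K
    have hsub : (O0.filter fun ω => K ⊆ J ω ∧ ends (τ ω) K = ∅) ⊆
        (univ : Finset (Equiv.Perm K)).biUnion fun σ =>
          O0.filter fun ω => K ⊆ J ω ∧ ends (τ ω) K = ∅ ∧ ∀ v : K, τ ω v = σ v := by
      intro ω hω
      rw [Finset.mem_filter] at hω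
      rw [Finset.mem_biUnion]
      have hcl : ∀ v, v ∈ K ↔ τ ω v ∈ K := by
        have hmap : K.map (τ ω).toEmbedding = K := by
          apply Finset.eq_of_subset_of_card_le
          · intro u hu
            rw [Finset.mem_map] at hu
            obtain ⟨v, hv, rfl⟩ := hu
            by_contra hcon
            have : v ∈ ends (τ ω) K := mem_ends.2 ⟨hv, hcon⟩
            rw [hω.2.2] at this; simp at this
          · simp
        intro v
        nth_rewrite 2 [← hmap]
        simp
      refine ⟨(τ ω).subtypePerm fun v => (hcl v).symm, Finset.mem_univ _, ?_⟩
      rw [Finset.mem_filter]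
      exact ⟨hω.1, hω.2.1, hω.2.2, fun v => rfl⟩
    have hb : ∀ σ : Equiv.Perm K, ((O0.filter fun ω =>
        K ⊆ J ω ∧ ends (τ ω) K = ∅ ∧ ∀ v : K, τ ω v = σ v).card : ℝ) ≤ O0.card * c ^ K.card := by
      intro σ
      rcases Finset.eq_empty_or_nonempty (O0.filter fun ω =>
        K ⊆ J ω ∧ ends (τ ω) K = ∅ ∧ ∀ v : K, τ ω v = σ v) with he | ⟨ω, hω⟩
      · rw [he]; simp; positivity
      · rw [Finset.mem_filter] at hω
        have := H ω hω.1 K hω.2.1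
        rw [hω.2.2.1] at this
        simp only [Finset.card_empty, pow_zero, mul_one] at this
        refine le_trans ?_ this
        norm_cast
        refine Finset.card_le_card ?_
        intro ω' hω'
        rw [Finset.mem_filter] at hω' ⊢
        refine ⟨hω'.1, gr_subset_gr.2 fun v hv => ⟨hω'.2.1 hv, ?_⟩⟩
        rw [hω'.2.2.2 ⟨v, hv⟩, ← hω.2.2.2 ⟨v, hv⟩]
    calc _ ≤ (((univ : Finset (Equiv.Perm K)).biUnion fun σ =>
          O0.filter fun ω => K ⊆ J ω ∧ ends (τ ω) K = ∅ ∧ ∀ v : K, τ ω v = σ v).card : ℝ) := by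
            exact_mod_cast Finset.card_le_card hsub
      _ ≤ ∑ σ : Equiv.Perm K, ((O0.filter fun ω =>
          K ⊆ J ω ∧ ends (τ ω) K = ∅ ∧ ∀ v : K, τ ω v = σ v).card : ℝ) := by
            exact_mod_cast Finset.card_biUnion_le
      _ ≤ ∑ σ : Equiv.Perm K, O0.card * c ^ K.card := Finset.sum_le_sum fun σ _ => hb σ
      _ = _ := by
            rw [Finset.sum_const, nsmul_eq_mul, Finset.card_univ, Fintype.card_perm,
              Fintype.card_coe]
  rw [h1]
  have hn : 0 ≤ (Fintype.card V : ℝ) * c * x := by positivity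
  calc _ ≤ ∑ K : Finset V, (O0.card : ℝ) * ((K.card).factorial * (c * x) ^ K.card) := by
        refine Finset.sum_le_sum fun K _ => ?_
        have := mul_le_mul_of_nonneg_left (h2 K) (pow_nonneg hx K.card)
        rw [mul_pow]; linarith
    _ = ∑ k ∈ range (Fintype.card V + 1), (O0.card : ℝ) *
          ((Fintype.card V).choose k * (k.factorial * (c * x) ^ k)) := by
        rw [← Finset.powerset_univ, Finset.sum_powerset_apply_card
          (f := fun k => (O0.card : ℝ) * (k.factorial * (c * x) ^ k)), Finset.card_univ]
        refine Finset.sum_congr rfl fun k _ => ?_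
        rw [nsmul_eq_mul]; ring
    _ ≤ ∑ k ∈ range (Fintype.card V + 1), (O0.card : ℝ) * ((Fintype.card V) * c * x) ^ k := by
        refine Finset.sum_le_sum fun k _ => ?_
        refine mul_le_mul_of_nonneg_left ?_ (Nat.cast_nonneg _)
        have : ((Fintype.card V).choose k * k.factorial : ℝ) ≤ (Fintype.card V : ℝ) ^ k := by
          have h5 : (Fintype.card V).choose k * k.factorial ≤ (Fintype.card V) ^ k := by
            rw [mul_comm, ← Nat.descFactorial_eq_factorial_mul_choose]
            exact Nat.descFactorial_le_pow _ _
          exact_mod_cast h5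
        calc _ = ((Fintype.card V).choose k * k.factorial : ℝ) * (c * x) ^ k := by ring
          _ ≤ (Fintype.card V : ℝ) ^ k * (c * x) ^ k := by gcongr
          _ = _ := by rw [← mul_pow, mul_assoc]
    _ ≤ _ := by
        rw [← Finset.mul_sum, mul_comm]
        refine mul_le_mul_of_nonneg_right ?_ (Nat.cast_nonneg _)
        rw [← tsum_geometric_of_lt_one hn hx1]
        exact (summable_geometric_of_lt_one hn hx1).sum_le_tsum _ fun _ _ => by positivity

lemma ChainSpread.spread {O0 : Finset Ω} {τ : Ω → Equiv.Perm V} {J : Ω → Finset V} {c κ p : ℝ}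
    (H : ChainSpread O0 τ J c κ) (hne : O0.Nonempty) (hc : 0 ≤ c) (hκ : 0 ≤ κ) (hp : 0 < p)
    (hx : 2 * c / p < 1) (hx1 : (Fintype.card V) * c * (2 * c / p) < 1) :
    Spread O0 (fun ω => gr (τ ω) (J ω)) p (κ * (2 * c / p / (1 - 2 * c / p)))
      ((1 - (Fintype.card V) * c * (2 * c / p))⁻¹ - 1)
      (fun ω => zsum (τ ω) (J ω) (2 * c / p) ∅) := by
  classical
  set x := 2 * c / p with hxdef
  have hx0 : 0 ≤ x := by positivity
  refine ⟨hne, ?_, ?_, ?_, ?_⟩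
  · intro ω _
    have : x ^ (∅ : Finset V).card ≤ zsum (τ ω) (J ω) x ∅ := by
      unfold zsum
      refine Finset.single_le_sum (f := fun K : Finset V => x ^ K.card)
        (fun _ _ => by positivity) ?_
      rw [Finset.mem_filter]
      exact ⟨Finset.mem_powerset.2 (Finset.empty_subset _), by simp [ends]⟩
    simpa using this
  · have := H.sumA hc hx0 hx1
    linarith
  · exact mul_nonneg hκ (div_nonneg hx0 (by linarith))
  · intro ω hω F1 hF1
    obtain ⟨J1, hJ1, rfl⟩ := subset_gr hF1
    have hexp : ∀ ω', (1 + 2 / p) ^ (gr (τ ω) J1 ∩ gr (τ ω') (J ω')).card =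
        ∑ K ∈ J1.powerset, if gr (τ ω) K ⊆ gr (τ ω') (J ω') then (2 / p) ^ K.card else 0 := by
      intro ω'
      have e1 : (gr (τ ω) J1 ∩ gr (τ ω') (J ω')) =
          gr (τ ω) (J1.filter fun v => (v, τ ω v) ∈ gr (τ ω') (J ω')) := by
        ext e
        rw [Finset.mem_inter, mem_gr, mem_gr, mem_gr, Finset.mem_filter, mem_gr]
        constructor
        · rintro ⟨h1, h2⟩
          exact ⟨⟨h1.1, h2.1, h2.2.trans h1.2.symm⟩, h1.2⟩
        · rintro ⟨⟨h1, h2⟩, h3⟩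
          exact ⟨⟨h1, h3⟩, h2.1, h2.2.trans h3⟩
      rw [e1, card_gr]
      have := Finset.prod_add (fun _ : V => 2 / p) (fun _ => 1)
        (J1.filter fun v => (v, τ ω v) ∈ gr (τ ω') (J ω'))
      simp only [Finset.prod_const, one_pow, mul_one] at this
      rw [add_comm, this, ← Finset.sum_filter]
      refine Finset.sum_congr ?_ fun _ _ => rfl
      ext K
      rw [Finset.mem_powerset, Finset.mem_filter, Finset.mem_powerset, gr_subset_gr]
      constructor
      · intro h
        exact ⟨h.trans (Finset.filter_subset _ _),
          fun v hv => mem_gr.1 (Finset.mem_filter.1 (h hv)).2⟩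
      · rintro ⟨h1, h2⟩ v hv
        exact Finset.mem_filter.2 ⟨h1 hv, mem_gr.2 (h2 v hv)⟩
    rw [Finset.sum_congr rfl fun ω' _ => hexp ω', Finset.sum_comm]
    calc _ = ∑ K ∈ J1.powerset, (2 / p) ^ K.card *
          ((O0.filter fun ω' => gr (τ ω) K ⊆ gr (τ ω') (J ω')).card : ℝ) := by
          refine Finset.sum_congr rfl fun K _ => ?_
          rw [← Finset.sum_filter, Finset.sum_const, nsmul_eq_mul, mul_comm]
      _ ≤ ∑ K ∈ J1.powerset, (2 / p) ^ K.card *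
          (O0.card * (c ^ K.card * κ ^ (ends (τ ω) K).card)) := by
          refine Finset.sum_le_sum fun K hK => ?_
          refine mul_le_mul_of_nonneg_left ?_ (by positivity)
          exact H ω hω K ((Finset.mem_powerset.1 hK).trans hJ1)
      _ = O0.card * ∑ K ∈ J1.powerset, x ^ K.card * κ ^ (ends (τ ω) K).card := by
          rw [Finset.mul_sum]
          refine Finset.sum_congr rfl fun K _ => ?_
          have : x = (2 / p) * c := by rw [hxdef]; ring
          rw [this, mul_pow]; ring
      _ ≤ O0.card * (zsum (τ ω) J1 x ∅ * Real.exp ((κ * (x / (1 - x))) * J1.card)) := by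
          refine mul_le_mul_of_nonneg_left ?_ (Nat.cast_nonneg _)
          exact sum_ends_le (τ ω) J1 hx0 hx hκ
      _ ≤ _ := by
          rw [card_gr]
          gcongr
          unfold zsum
          refine Finset.sum_le_sum_of_subset_of_nonneg ?_ fun _ _ _ => by positivity
          exact Finset.filter_subset_filter _ (Finset.powerset_mono.2 hJ1)

set_option maxHeartbeats 1000000 in
theorem chain_main (R : ℕ) {η : ℝ} (hη : 0 < η) : ∃ ρ : ℝ, 0 < ρ ∧
    ∀ (V : Type) [DecidableEq V] [Fintype V] (Ω : Type) [DecidableEq Ω] (O0 : Finset Ω)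
      (τ : Ω → Equiv.Perm V) (J : Ω → Finset V) (c p : ℝ) (m : ℕ), O0.Nonempty →
      ChainSpread O0 τ J c (1 / m) → 0 ≤ c → 0 < p → p ≤ 1 → 1 ≤ m →
      2 * c / p ≤ ρ → (Fintype.card V) * c * (2 * c / p) ≤ ρ → Fintype.card V ≤ m ^ R →
      bv univ (fun _ => 1 - (1 - p) ^ (R + 1))
        (fun W => ind (¬ ∃ ω ∈ O0, gr (τ ω) (J ω) ⊆ W)) ≤ η := by
  set δ' : ℝ := η / (8 * (R + 1) ^ 2) with hδ'
  have hδ'0 : 0 < δ' := by positivity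
  obtain ⟨K, hK1, hK⟩ : ∃ K : ℕ, 1 ≤ K ∧ Real.exp (-(K / 4 : ℝ)) ≤ δ' ^ 2 / 8 := by
    obtain ⟨K, hK⟩ := exists_nat_ge (max 1 (-4 * Real.log (δ' ^ 2 / 8)))
    refine ⟨K, by exact_mod_cast (le_max_left _ _).trans hK, ?_⟩
    rw [← Real.le_log_iff_exp_le (by positivity)]
    have := (le_max_right _ _).trans hK
    linarith
  have hK1' : (1 : ℝ) ≤ K := by exact_mod_cast hK1
  set ρ : ℝ := min (1 / 8) (min (1 / (2 * K)) (η ^ 2 / (64 * (2 + 12 * K)))) with hρ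
  have hρ0 : 0 < ρ := by positivity
  have hρ1 : ρ ≤ 1 / 8 := min_le_left _ _
  have hρ2 : ρ * (2 * K) ≤ 1 := by
    rw [← le_div_iff₀ (by positivity)]; exact (min_le_right _ _).trans (min_le_left _ _)
  have hρ3 : ρ * (64 * (2 + 12 * K)) ≤ η ^ 2 := by
    rw [← le_div_iff₀ (by positivity)]; exact (min_le_right _ _).trans (min_le_right _ _)
  refine ⟨ρ, hρ0, ?_⟩
  intro V _ _ Ω _ O0 τ J c p m hne H hc hp hp1 hm hx hy hn
  have hm1 : (1 : ℝ) ≤ m := by exact_mod_cast hm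
  have hsp := H.spread hne hc (by positivity) hp (by linarith) (by linarith)
  set x := 2 * c / p with hxdef
  have hx0 : 0 ≤ x := by positivity
  set y := (Fintype.card V) * c * x with hydef
  have hy0 : 0 ≤ y := by positivity
  set θ : ℝ := 1 / m * (x / (1 - x)) with hθ
  have hxx : x / (1 - x) ≤ 2 * x := by
    rw [div_le_iff₀ (by linarith)]; nlinarith
  have hxx0 : 0 ≤ x / (1 - x) := div_nonneg hx0 (by linarith)
  have hθ0 : 0 ≤ θ := by positivity
  have hθm : θ * m ≤ 1 / 4 := by
    have e : θ * m = x / (1 - x) := by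
      rw [hθ, mul_right_comm, one_div_mul_cancel (by positivity), one_mul]
    rw [e]; linarith
  have hθ2 : θ ≤ 2 * ρ := by
    have : θ ≤ x / (1 - x) := by
      rw [hθ]; refine mul_le_of_le_one_left hxx0 ?_
      rw [div_le_one (by positivity)]; exact hm1
    linarith
  have hα : 1 + ((1 - y)⁻¹ - 1) ≤ 1 + 2 * ρ := by
    have : (1 - y)⁻¹ ≤ 1 + 2 * ρ := by
      rw [inv_le_iff_one_le_mul₀ (by linarith)]; nlinarith
    linarith
  have hα0 : 0 ≤ 1 + ((1 - y)⁻¹ - 1) := by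
    have : 0 < (1 - y)⁻¹ := inv_pos.2 (by linarith)
    linarith
  set α := (1 - y)⁻¹ - 1 with hαdef
  have hlog : (1 : ℝ) / 2 < Real.log 2 := by have := Real.log_two_gt_d9; linarith
  have hL : ∀ j, Real.exp (θ * ((K * m ^ (j + 1) : ℕ) : ℝ)) ≤
      Real.exp (-(K / 4 : ℝ)) * 2 ^ (K * m ^ j) := by
    intro j
    have e : (2 : ℝ) ^ (K * m ^ j) = Real.exp ((K * m ^ j : ℕ) * Real.log 2) := by
      rw [Real.exp_nat_mul, Real.exp_log (by norm_num)]
    rw [e, ← Real.exp_add, Real.exp_le_exp]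
    push_cast
    have hmj : (1 : ℝ) ≤ (m : ℝ) ^ j := one_le_pow₀ hm1
    have e2 : θ * (K * (m : ℝ) ^ (j + 1)) = (θ * m) * (K * (m : ℝ) ^ j) := by rw [pow_succ]; ring
    rw [e2]
    have h1 : (K : ℝ) ≤ K * (m : ℝ) ^ j := le_mul_of_one_le_right (by positivity) hmj
    nlinarith
  have hmain := hsp.rounds hp hp1 (δ := η / 4) (δ' := δ') (τ := 1 / (2 * (R + 1)))
    (by positivity) hδ'0 (by positivity) (fun j => K * m ^ j) hL R O0 (le_refl _)
    (by
      have : (R : ℝ) * (1 / (2 * (R + 1))) ≤ 1 / 2 := by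
        rw [mul_one_div, div_le_div_iff₀ (by positivity) (by norm_num)]; linarith
      have h0 : (0 : ℝ) ≤ O0.card := Nat.cast_nonneg _
      nlinarith) (fun ω => gr (τ ω) (J ω)) (fun _ _ => le_refl _)
    (by
      intro ω _
      rw [card_gr]
      refine (Finset.card_le_univ _).trans (hn.trans ?_)
      exact Nat.le_mul_of_pos_left _ hK1)
  refine hmain.trans ?_
  have t1 : (η / 4)⁻¹ * (4 * ((1 + α) * Real.exp (θ * ((K * m ^ 0 : ℕ) : ℝ)) - 1)) ≤ η / 4 := by
    have e1 : Real.exp (θ * ((K * m ^ 0 : ℕ) : ℝ)) ≤ 1 + 4 * ρ * K := by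
      have h1 : θ * ((K * m ^ 0 : ℕ) : ℝ) ≤ 2 * ρ * K := by
        push_cast; rw [pow_zero, mul_one]; gcongr
      have h2 : Real.exp (2 * ρ * K) ≤ 1 + 4 * ρ * K := by
        have h3 : 0 ≤ 2 * ρ * K := by positivity
        have := Real.abs_exp_sub_one_le (x := 2 * ρ * K) (by rw [abs_of_nonneg h3]; linarith)
        rw [abs_of_nonneg h3] at this
        have := (abs_le.1 this).2
        linarith
      exact (Real.exp_le_exp.2 h1).trans h2
    have e2 : (1 + α) * Real.exp (θ * ((K * m ^ 0 : ℕ) : ℝ)) - 1 ≤ ρ * (2 + 12 * K) := by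
      have : (1 + α) * Real.exp (θ * ((K * m ^ 0 : ℕ) : ℝ)) ≤ (1 + 2 * ρ) * (1 + 4 * ρ * K) :=
        mul_le_mul hα e1 (Real.exp_pos _).le (by positivity)
      have h3 : 0 ≤ ρ * K := by positivity
      nlinarith
    rw [inv_mul_le_iff₀ (by positivity)]
    nlinarith
  have t2 : δ'⁻¹ * (4 * ((1 + α) * Real.exp (-(K / 4 : ℝ)))) ≤ δ' := by
    rw [inv_mul_le_iff₀ hδ'0]
    have h1 : (1 + α) * Real.exp (-(K / 4 : ℝ)) ≤ 2 * (δ' ^ 2 / 8) :=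
      mul_le_mul (by linarith) hK (Real.exp_pos _).le (by norm_num)
    nlinarith
  have t3 : (R : ℝ) * ((δ' + δ'⁻¹ * (4 * ((1 + α) * Real.exp (-(K / 4 : ℝ))))) /
      (1 / (2 * (R + 1)))) ≤ η / 2 := by
    have h1 : (δ' + δ'⁻¹ * (4 * ((1 + α) * Real.exp (-(K / 4 : ℝ))))) /
      (1 / (2 * (R + 1))) ≤ 2 * δ' * (2 * (R + 1)) := by
      rw [div_div_eq_mul_div, div_one]
      refine mul_le_mul_of_nonneg_right (by linarith) (by positivity)
    have h2 : (R : ℝ) * (2 * δ' * (2 * (R + 1))) ≤ (R + 1) * (2 * δ' * (2 * (R + 1))) := by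
      refine mul_le_mul_of_nonneg_right (by linarith) (by positivity)
    have h3 : ((R : ℝ) + 1) * (2 * δ' * (2 * (R + 1))) = η / 2 := by
      have e : δ' * (8 * ((R : ℝ) + 1) ^ 2) = η := div_mul_cancel₀ _ (by positivity)
      rw [← e]; ring
    have h4 : (0 : ℝ) ≤ R := Nat.cast_nonneg _
    nlinarith [mul_le_mul_of_nonneg_left h1 h4]
  linarith

end chain
end CombProof


namespace CombProof
open Finset
set_option linter.unusedSectionVars false

section posa
variable {V : Type} [DecidableEq V] [Fintype V]

def Sm (r : V → V → Prop) : Prop := ∀ ⦃a b⦄, r a b → r b a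

def IsPath (r : V → V → Prop) (l : List V) : Prop := l.Nodup ∧ l.IsChain r

def Longest (r : V → V → Prop) (l : List V) : Prop :=
  IsPath r l ∧ ∀ l', IsPath r l' → l'.length ≤ l.length

def Ham (r : V → V → Prop) : Prop :=
  ∃ l : List V, l.Nodup ∧ (∀ v, v ∈ l) ∧ l.IsChain r ∧ ∀ a ∈ l.getLast?, ∀ b ∈ l.head?, r a b

def nxt : List V → V → V → Prop
  | a :: b :: l, u, v => (u = a ∧ v = b) ∨ nxt (b :: l) u v
  | _, _, _ => False

lemma nxt_mem : ∀ {l : List V} {u v : V}, nxt l u v → u ∈ l ∧ v ∈ l.tail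
  | [], _, _, h => by simp [nxt] at h
  | [a], _, _, h => by simp [nxt] at h
  | a :: b :: l, u, v, h => by
    rcases h with ⟨rfl, rfl⟩ | h
    · simp
    · have := nxt_mem h
      refine ⟨List.mem_cons_of_mem _ this.1, ?_⟩
      simp only [List.tail_cons] at this ⊢
      exact List.mem_cons_of_mem _ this.2

lemma nxt_unique_right : ∀ {l : List V}, l.Nodup → ∀ {u v v' : V}, nxt l u v → nxt l u v' → v = v'
  | [], _, _, _, _, h, _ => by simp [nxt] at h
  | [a], _, _, _, _, h, _ => by simp [nxt] at h
  | a :: b :: l, hn, u, v, v', h, h' => by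
    have hn2 := List.nodup_cons.1 hn
    rcases h with ⟨rfl, rfl⟩ | h
    · rcases h' with ⟨_, rfl⟩ | h'
      · rfl
      · exact absurd (nxt_mem h').1 hn2.1
    · rcases h' with ⟨rfl, rfl⟩ | h'
      · exact absurd (nxt_mem h).1 hn2.1
      · exact nxt_unique_right hn2.2 h h'

lemma nxt_unique_left : ∀ {l : List V}, l.Nodup → ∀ {u v v' : V}, nxt l v u → nxt l v' u → v = v'
  | [], _, _, _, _, h, _ => by simp [nxt] at h
  | [a], _, _, _, _, h, _ => by simp [nxt] at h
  | a :: b :: l, hn, u, v, v', h, h' => by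
    have hn2 := List.nodup_cons.1 hn
    have hn3 := List.nodup_cons.1 hn2.2
    rcases h with ⟨rfl, rfl⟩ | h
    · rcases h' with ⟨rfl, _⟩ | h'
      · rfl
      · exact absurd (nxt_mem h').2 hn3.1
    · rcases h' with ⟨rfl, rfl⟩ | h'
      · exact absurd (nxt_mem h).2 hn3.1
      · exact nxt_unique_left hn2.2 h h'

lemma nxt_append : ∀ (A : List V) (y : V) (C : List V) (u v : V),
    nxt (A ++ y :: C) u v ↔ nxt A u v ∨ (A.getLast? = some u ∧ v = y) ∨ nxt (y :: C) u v
  | [], y, C, u, v => by simp [nxt]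
  | [a], y, C, u, v => by simp [nxt, eq_comm]
  | a :: b :: A, y, C, u, v => by
    have := nxt_append (b :: A) y C u v
    simp only [List.cons_append] at this ⊢
    simp only [nxt]
    rw [this]
    have e : (a :: b :: A).getLast? = (b :: A).getLast? := by simp
    rw [e]; tauto

lemma nxt_reverse : ∀ (A : List V) (u v : V), nxt A.reverse u v ↔ nxt A v u
  | [], u, v => by simp [nxt]
  | [a], u, v => by simp [nxt]
  | a :: b :: A, u, v => by
    rw [List.reverse_cons, nxt_append, nxt_reverse (b :: A)]
    simp only [nxt]
    simp only [List.getLast?_reverse, List.head?_cons, Option.some.injEq, or_false]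
    constructor
    · rintro (h | ⟨h1, h2⟩)
      · right; exact h
      · left; exact ⟨h2, h1.symm⟩
    · rintro (⟨h1, h2⟩ | h)
      · right; exact ⟨h2.symm, h1⟩
      · left; exact h

def nb (l : List V) (u v : V) : Prop := nxt l u v ∨ nxt l v u

lemma nb_reverse (A : List V) (u v : V) : nb A.reverse u v ↔ nb A u v := by
  unfold nb; rw [nxt_reverse, nxt_reverse]; tauto

lemma nb_append (A : List V) (y : V) (C : List V) (u v : V) : nb (A ++ y :: C) u v ↔
    nb A u v ∨ (A.getLast? = some u ∧ v = y) ∨ (A.getLast? = some v ∧ u = y) ∨ nb (y :: C) u v := by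
  unfold nb; rw [nxt_append, nxt_append]; tauto

inductive Rot (r : V → V → Prop) (l0 : List V) : List V → Prop
  | refl : Rot r l0 l0
  | step (e : V) (B : List V) (v : V) (C : List V) : Rot r l0 (e :: B ++ v :: C) → r e v →
      Rot r l0 ((e :: B).reverse ++ v :: C)

variable {r : V → V → Prop}

lemma Rot.perm {l0 l : List V} (h : Rot r l0 l) : l.Perm l0 := by
  induction h with
  | refl => exact List.Perm.refl _
  | step e B v C _ _ ih =>
    exact (List.Perm.append_right _ (List.reverse_perm _)).trans ih

lemma Rot.getLast {l0 l : List V} (h : Rot r l0 l) : l.getLast? = l0.getLast? := by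
  induction h with
  | refl => rfl
  | step e B v C _ _ ih =>
    rw [← ih, List.getLast?_append_cons, List.getLast?_append_cons]

lemma Rot.isPath (hr : Sm r) {l0 l : List V} (h0 : IsPath r l0) (h : Rot r l0 l) :
    IsPath r l := by
  refine ⟨(h.perm.nodup_iff).2 h0.1, ?_⟩
  induction h with
  | refl => exact h0.2
  | step e B v C _ hev ih =>
    rw [List.isChain_append] at ih ⊢
    refine ⟨?_, ih.2.1, ?_⟩
    · rw [List.isChain_reverse]
      exact ih.1.imp fun a b hab => hr hab
    · intro x hx y hy
      simp at hx hy
      subst hx hy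
      exact hev

lemma Rot.longest (hr : Sm r) {l0 l : List V} (h0 : Longest r l0) (h : Rot r l0 l) :
    Longest r l :=
  ⟨h.isPath hr h0.1, fun l' hl' => by rw [h.perm.length_eq]; exact h0.2 l' hl'⟩

def rotHeads (r : V → V → Prop) (l0 : List V) : Set V := {e | ∃ l, Rot r l0 (e :: l)}

lemma Rot.head_last {l0 : List V} {e : V} {B : List V} {v : V} {C : List V}
    (h : Rot r l0 (e :: B ++ v :: C)) (hev : r e v) :
    ∃ w ∈ rotHeads r l0, (e :: B).getLast? = some w := by
  have h2 := Rot.step e B v C h hev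
  obtain ⟨w, t, hwt⟩ : ∃ w t, (e :: B).reverse = w :: t := by
    cases hh : (e :: B).reverse with
    | nil => simp at hh
    | cons w t => exact ⟨w, t, rfl⟩
  refine ⟨w, ⟨t ++ v :: C, ?_⟩, ?_⟩
  · rw [hwt] at h2; exact h2
  · rw [← List.head?_reverse, hwt]; rfl

lemma Rot.nb_iff {l0 l : List V} (h : Rot r l0 l) {v : V} (hv : v ∉ rotHeads r l0)
    (hn : ∀ u, nb l0 u v → u ∉ rotHeads r l0) : ∀ u, nb l u v ↔ nb l0 u v := by
  induction h with
  | refl => intro u; rfl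
  | step e B y C h hey ih =>
    intro u
    obtain ⟨w, hw, hlast⟩ := h.head_last hey
    have he : e ∈ rotHeads r l0 := ⟨B ++ y :: C, h⟩
    have hve : v ≠ e := fun h => hv (h ▸ he)
    have hvw : v ≠ w := fun h => hv (h ▸ hw)
    have hvy : v ≠ y := by
      intro hvy
      refine hn w ?_ hw
      rw [← ih, nb_append]
      right; left; exact ⟨hlast, hvy⟩
    rw [← ih u, nb_append, nb_append, nb_reverse, hlast]
    have e2 : (e :: B).reverse.getLast? = some e := by simp
    rw [e2]
    simp only [Option.some.injEq]
    constructor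
    · rintro (h | ⟨_, h⟩ | ⟨h, _⟩ | h)
      · exact Or.inl h
      · exact absurd h hvy
      · exact absurd h.symm hve
      · exact Or.inr (Or.inr (Or.inr h))
    · rintro (h | ⟨_, h⟩ | ⟨h, _⟩ | h)
      · exact Or.inl h
      · exact absurd h hvy
      · exact absurd h.symm hvw
      · exact Or.inr (Or.inr (Or.inr h))

lemma Longest.mem_of_head (hr : Sm r) {e v : V} {l : List V} (h : Longest r (e :: l))
    (hev : r e v) : v ∈ e :: l := by
  by_contra hc
  have : IsPath r (v :: e :: l) := by
    refine ⟨List.nodup_cons.2 ⟨hc, h.1.1⟩, ?_⟩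
    rw [List.isChain_cons]
    refine ⟨?_, h.1.2⟩
    intro y hy
    simp at hy; subst hy
    exact hr hev
  have := h.2 _ this
  simp at this

lemma posa_nb (hr : Sm r) {l0 : List V} (h0 : Longest r l0) {v : V}
    (hv : v ∉ rotHeads r l0) {e : V} (he : e ∈ rotHeads r l0) (hev : r e v) :
    ∃ u ∈ rotHeads r l0, nb l0 u v := by
  by_contra hc
  push Not at hc
  have hn : ∀ u, nb l0 u v → u ∉ rotHeads r l0 := fun u h1 h2 => hc u h2 h1
  obtain ⟨l, hl⟩ := he
  have hmem := (hl.longest hr h0).mem_of_head hr hev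
  have hve : v ≠ e := fun h => hv (h ▸ ⟨l, hl⟩)
  rw [List.mem_cons] at hmem
  obtain ⟨B, C, rfl⟩ := List.append_of_mem (hmem.resolve_left hve)
  have hl' : Rot r l0 (e :: B ++ v :: C) := hl
  obtain ⟨w, hw, hlast⟩ := hl'.head_last hev
  refine hc w hw ?_
  rw [← hl'.nb_iff hv hn, nb_append]
  right; left; exact ⟨hlast, rfl⟩

def Expands (r : V → V → Prop) (k : ℕ) : Prop :=
  ∀ U N : Finset V, 1 ≤ U.card → U.card ≤ k → (∀ v, v ∉ U → (∃ u ∈ U, r u v) → v ∈ N) →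
    2 * U.card < N.card

lemma posa_heads (hr : Sm r) {k : ℕ} (hE : Expands r k) {l0 : List V} (h0 : Longest r l0)
    (hne : l0 ≠ []) (S : Finset V)
    (hS : ∀ l, Longest r l → l.getLast? = l0.getLast? → ∀ e ∈ l.head?, e ∈ S) : k ≤ S.card := by
  classical
  set T : Finset V := univ.filter fun v => v ∈ rotHeads r l0 with hT
  have hTm : ∀ v, v ∈ T ↔ v ∈ rotHeads r l0 := fun v => by simp [hT]
  have hTS : T ⊆ S := by
    intro e he
    obtain ⟨l, hl⟩ := (hTm e).1 he
    exact hS _ (hl.longest hr h0) hl.getLast e rfl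
  refine le_trans ?_ (Finset.card_le_card hTS)
  by_contra hc
  push Not at hc
  have hT1 : 1 ≤ T.card := by
    cases hl : l0 with
    | nil => exact absurd hl hne
    | cons a l =>
      exact Finset.card_pos.2 ⟨a, (hTm a).2 ⟨l, by rw [← hl]; exact Rot.refl⟩⟩
  have := hE T (T.biUnion fun u => univ.filter fun v => nb l0 u v) hT1 hc.le (by
    intro v hv ⟨u, hu, huv⟩
    obtain ⟨w, hw, hwv⟩ := posa_nb hr h0 (fun h => hv ((hTm v).2 h)) ((hTm u).1 hu) huv
    rw [Finset.mem_biUnion]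
    exact ⟨w, (hTm w).2 hw, by simp [hwv]⟩)
  have hle : (T.biUnion fun u => univ.filter fun v => nb l0 u v).card ≤ T.card * 2 := by
    refine Finset.card_biUnion_le_card_mul _ _ _ fun u _ => ?_
    have : (univ.filter fun v => nb l0 u v) =
        (univ.filter fun v => nxt l0 u v) ∪ (univ.filter fun v => nxt l0 v u) := by
      ext v; rw [Finset.mem_union, Finset.mem_filter, Finset.mem_filter, Finset.mem_filter]; unfold nb; tauto
    rw [this]
    refine (Finset.card_union_le _ _).trans ?_
    have h1 : (univ.filter fun v => nxt l0 u v).card ≤ 1 := by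
      rw [Finset.card_le_one]
      intro a ha b hb
      simp at ha hb
      exact nxt_unique_right h0.1.1 ha hb
    have h2 : (univ.filter fun v => nxt l0 v u).card ≤ 1 := by
      rw [Finset.card_le_one]
      intro a ha b hb
      simp at ha hb
      exact nxt_unique_left h0.1.1 ha hb
    omega
  omega

lemma exists_longest (r : V → V → Prop) : ∃ l, Longest r l := by
  classical
  have hb : ∀ l : List V, IsPath r l → l.length ≤ Fintype.card V := fun l h => h.1.length_le_card
  have hne : ∃ m, ∃ l, IsPath r l ∧ l.length = m := ⟨0, [], ⟨by simp, by simp⟩, rfl⟩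
  set P : ℕ → Prop := fun m => ∃ l, IsPath r l ∧ l.length = m with hP
  obtain ⟨l, hl, hlen⟩ : P (Nat.findGreatest P (Fintype.card V)) :=
    Nat.findGreatest_spec (P := P) (Nat.zero_le _) ⟨[], ⟨by simp, by simp⟩, rfl⟩
  refine ⟨l, hl, fun l' hl' => ?_⟩
  rw [hlen]
  exact Nat.le_findGreatest (hb l' hl') ⟨l', hl', rfl⟩

lemma Longest.reverse (hr : Sm r) {l : List V} (h : Longest r l) : Longest r l.reverse := by
  refine ⟨⟨List.nodup_reverse.2 h.1.1, ?_⟩, fun l' hl' => by rw [List.length_reverse]; exact h.2 l' hl'⟩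
  rw [List.isChain_reverse]
  exact h.1.2.imp fun a b hab => hr hab

/-- There are many booster pairs. -/
lemma posa_boosters [Nonempty V] (hr : Sm r) {k : ℕ} (hE : Expands r k) :
    ∃ Bst : Finset (V × V), k * k ≤ Bst.card ∧
      ∀ e ∈ Bst, ∃ l, Longest r l ∧ l.head? = some e.1 ∧ l.getLast? = some e.2 := by
  classical
  obtain ⟨l0, h0⟩ := exists_longest r
  have hne : ∀ {l}, Longest r l → l ≠ [] := by
    rintro l hl rfl
    have v : V := Classical.arbitrary V
    have := hl.2 [v] ⟨by simp, by simp⟩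
    simp at this
  refine ⟨univ.filter fun e => ∃ l, Longest r l ∧ l.head? = some e.1 ∧ l.getLast? = some e.2, ?_,
    fun e he => (Finset.mem_filter.1 he).2⟩
  set S : Finset V := univ.filter fun f => ∃ l, Longest r l ∧ l.getLast? = some f with hS
  set T : V → Finset V := fun f =>
    univ.filter fun e => ∃ l, Longest r l ∧ l.head? = some e ∧ l.getLast? = some f with hT
  have hTc : ∀ f ∈ S, k ≤ (T f).card := by
    intro f hf
    obtain ⟨l, hl, hlf⟩ := (Finset.mem_filter.1 hf).2
    refine posa_heads hr hE hl (hne hl) _ ?_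
    intro l' hl' hlast e he
    exact Finset.mem_filter.2 ⟨Finset.mem_univ _, l', hl', he, by rw [hlast, hlf]⟩
  have hSc : k ≤ S.card := by
    refine posa_heads hr hE h0 (hne h0) _ ?_
    intro l' hl' hlast e he
    refine Finset.mem_filter.2 ⟨Finset.mem_univ _, l'.reverse, hl'.reverse hr, ?_⟩
    rw [List.getLast?_reverse]; exact he
  calc k * k ≤ S.card * k := Nat.mul_le_mul_right _ hSc
    _ = ∑ f ∈ S, k := by simp
    _ ≤ ∑ f ∈ S, (T f).card := Finset.sum_le_sum hTc
    _ = (S.sigma T).card := (Finset.card_sigma _ _).symm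
    _ ≤ _ := by
        refine Finset.card_le_card_of_injOn (fun x => (x.2, x.1)) ?_ ?_
        · intro x hx
          rw [Finset.mem_coe, Finset.mem_sigma] at hx
          have := (Finset.mem_filter.1 hx.2).2
          simp only [Finset.coe_filter, Set.mem_ofPred_eq, Finset.mem_univ, true_and]
          exact this
        · intro x _ y _ h
          obtain ⟨a, b⟩ := x
          obtain ⟨a', b'⟩ := y
          simp at h
          obtain ⟨rfl, rfl⟩ := h
          rfl

def Conn (r : V → V → Prop) : Prop :=
  ∀ U : Finset V, U.Nonempty → U ≠ univ → ∃ u ∈ U, ∃ v, v ∉ U ∧ r u v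

lemma posa_close (hr : Sm r) (hC : Conn r) {l : List V} (hne : l ≠ []) (hl : IsPath r l)
    (hclose : ∀ a ∈ l.getLast?, ∀ b ∈ l.head?, r a b) :
    Ham r ∨ ∃ l', IsPath r l' ∧ l'.length = l.length + 1 := by
  classical
  by_cases hall : ∀ v, v ∈ l
  · left; exact ⟨l, hl.1, hall, hl.2, hclose⟩
  · right
    push Not at hall
    obtain ⟨v0, hv0⟩ := hall
    obtain ⟨u, hu, v, hv, huv⟩ := hC l.toFinset
      (by obtain ⟨a, ha⟩ := List.exists_mem_of_ne_nil l hne; exact ⟨a, by simpa using ha⟩)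
      (fun h => hv0 (by have := Finset.mem_univ v0; rw [← h] at this; simpa using this))
    rw [List.mem_toFinset] at hu hv
    obtain ⟨A, B, rfl⟩ := List.append_of_mem hu
    have hperm : (u :: B ++ A).Perm (A ++ u :: B) := List.perm_append_comm
    refine ⟨v :: (u :: B ++ A), ⟨?_, ?_⟩, ?_⟩
    · rw [List.nodup_cons]
      refine ⟨fun h => hv (hperm.mem_iff.1 h), hperm.nodup_iff.2 hl.1⟩
    · rw [List.isChain_cons]
      have h2 := hl.2
      rw [List.isChain_append] at h2
      refine ⟨?_, ?_⟩
      · intro y hy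
        simp at hy; subst hy; exact hr huv
      · rw [List.isChain_append]
        refine ⟨h2.2.1, h2.1, ?_⟩
        intro x hx y hy
        refine hclose x ?_ y ?_
        · rw [List.getLast?_append]
          cases hh : (u :: B).getLast? with
          | none => rw [hh] at hx; simp at hx
          | some z => rw [hh] at hx; simp at hx; simp [hx]
        · rw [List.head?_append]
          cases hh : A.head? with
          | none => rw [hh] at hy; simp at hy
          | some z => rw [hh] at hy; simp at hy; simp [hy]
    · simp; omega

end posa
end CombProof


namespace CombProof
open Finset
set_option linter.unusedSectionVars false

section sprinkle
variable {V : Type} [DecidableEq V] [Fintype V]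

/-- Undirected adjacency coming from a set of ordered pairs. -/
def adj (D : Finset (V × V)) (u v : V) : Prop := (u, v) ∈ D ∨ (v, u) ∈ D

lemma adj_symm (D : Finset (V × V)) : Sm (adj D) := fun _ _ h => h.symm

lemma adj_mono {D D' : Finset (V × V)} (h : D ⊆ D') {u v : V} (huv : adj D u v) : adj D' u v :=
  huv.imp (fun x => h x) (fun x => h x)

lemma IsPath.mono {D D' : Finset (V × V)} (h : D ⊆ D') {l : List V} (hl : IsPath (adj D) l) :
    IsPath (adj D') l := ⟨hl.1, hl.2.imp fun _ _ => adj_mono h⟩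

lemma Ham.mono {D D' : Finset (V × V)} (h : D ⊆ D') (hl : Ham (adj D)) : Ham (adj D') := by
  obtain ⟨l, h1, h2, h3, h4⟩ := hl
  exact ⟨l, h1, h2, h3.imp fun _ _ => adj_mono h, fun a ha b hb => adj_mono h (h4 a ha b hb)⟩

lemma Expands.mono {D D' : Finset (V × V)} (h : D ⊆ D') {k : ℕ} (hl : Expands (adj D) k) :
    Expands (adj D') k := by
  intro U N h1 h2 h3
  exact hl U N h1 h2 fun v hv ⟨u, hu, huv⟩ => h3 v hv ⟨u, hu, adj_mono h huv⟩

lemma Conn.mono {D D' : Finset (V × V)} (h : D ⊆ D') (hl : Conn (adj D)) :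
    Conn (adj D') := by
  intro U h1 h2
  obtain ⟨u, hu, v, hv, huv⟩ := hl U h1 h2
  exact ⟨u, hu, v, hv, adj_mono h huv⟩

theorem posa_sprinkle [Nonempty V] {k : ℕ} {q : ℝ} (hq0 : 0 ≤ q) (hq1 : q ≤ 1)
    (hq : (1 - q) ^ (k * k) ≤ 1 / 4) (j : ℕ) : ∀ (d : ℕ) (D : Finset (V × V)),
    Expands (adj D) k → Conn (adj D) →
    (Ham (adj D) ∨ ∃ l, IsPath (adj D) l ∧ Fintype.card V ≤ l.length + d) →
    bv univ (fun _ => 1 - (1 - q) ^ j) (fun W => ind (¬ Ham (adj (W ∪ D)))) ≤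
      2 ^ d * (3 / 4) ^ j := by
  have p0 : ∀ j, 0 ≤ 1 - (1 - q) ^ j := fun j => by
    have : (1 - q) ^ j ≤ 1 := pow_le_one₀ (by linarith) (by linarith)
    linarith
  have p1 : ∀ j, 1 - (1 - q) ^ j ≤ 1 := fun j => by
    have : 0 ≤ (1 - q) ^ j := pow_nonneg (by linarith) _
    linarith
  induction j with
  | zero =>
    intro d D _ _ _
    refine (bv_le_const (fun _ => p0 0) (fun _ => p1 0) fun _ => ind_le_one _).trans ?_
    rw [pow_zero, mul_one]
    exact one_le_pow₀ (by norm_num)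
  | succ j ih =>
    intro d D hE hC hP
    have hXpos : (0 : ℝ) < 2 ^ d * (3 / 4) ^ j := by positivity
    set X : ℝ := 2 ^ d * (3 / 4) ^ j with hX
    have hham0 : ∀ D' : Finset (V × V), Ham (adj D') →
        bv univ (fun _ => 1 - (1 - q) ^ j) (fun W => ind (¬ Ham (adj (W ∪ D')))) ≤ 0 := by
      intro D' h
      refine bv_le_const (fun _ => p0 j) (fun _ => p1 j) fun W => ?_
      rw [ind_false (not_not.2 (h.mono Finset.subset_union_right))]
    have hqq : 1 - (1 - q) ^ (j + 1) = 1 - (1 - (1 - (1 - q) ^ j)) * (1 - q) := by ring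
    rw [hqq, ← bv_union]
    obtain ⟨Bst, hBc, hB⟩ := posa_boosters (adj_symm D) hE
    have hpt : ∀ D' : Finset (V × V), bv univ (fun _ => 1 - (1 - q) ^ j)
        (fun W => ind (¬ Ham (adj (W ∪ D' ∪ D)))) ≤ X * (1 / 2 + ind (Disjoint D' Bst)) := by
      intro D'
      simp only [Finset.union_assoc]
      have hsub : D ⊆ D' ∪ D := Finset.subset_union_right
      by_cases hd : Disjoint D' Bst
      · rw [ind_true hd]
        have := ih d (D' ∪ D) (hE.mono hsub) (hC.mono hsub) (by
          rcases hP with h | ⟨l, h1, h2⟩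
          · exact Or.inl (h.mono hsub)
          · exact Or.inr ⟨l, h1.mono hsub, h2⟩)
        refine this.trans ?_
        nlinarith
      · rw [ind_false hd, add_zero]
        by_cases hH : Ham (adj (D' ∪ D))
        · refine (hham0 _ hH).trans ?_
          linarith
        · obtain ⟨e, he1, he2⟩ := Finset.not_disjoint_iff.1 hd
          obtain ⟨l, hl, hl1, hl2⟩ := hB e he2
          rcases posa_close (adj_symm (D' ∪ D)) (hC.mono hsub) (l := l)
            (by rintro rfl; simp at hl1) (hl.1.mono hsub) (by
              intro a ha b hb
              rw [hl2] at ha; rw [hl1] at hb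
              simp at ha hb
              subst ha hb
              exact Or.inr (Finset.mem_union_left _ he1)) with h | ⟨l', hl', hlen⟩
          · exact absurd h hH
          · rcases hP with h | ⟨l2, h1, h2⟩
            · exact absurd (h.mono hsub) hH
            · have hlong := hl.2 l2 h1
              have hmax := hl'.1.length_le_card
              obtain ⟨d', rfl⟩ : ∃ d', d = d' + 1 := ⟨d - 1, by omega⟩
              have := ih d' (D' ∪ D) (hE.mono hsub) (hC.mono hsub)
                (Or.inr ⟨l', hl', by omega⟩)
              refine this.trans (le_of_eq ?_)
              rw [hX, pow_succ]; ring
    refine (bv_mono (fun _ => hq0) (fun _ => hq1) fun D' _ => hpt D').trans ?_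
    rw [bv_mul, bv_add, bv_const, bv_disjoint_prob (Finset.subset_univ _)]
    have h1 : (1 - q) ^ Bst.card ≤ 1 / 4 :=
      (pow_le_pow_of_le_one (by linarith) (by linarith) hBc).trans hq
    rw [pow_succ, ← mul_assoc]
    nlinarith

end sprinkle
end CombProof


namespace CombProof
open Finset
set_option linter.unusedSectionVars false

section hit
variable {E : Type*} [DecidableEq E] [Fintype E]

lemma bv_hit_disjoint {ι : Type*} [DecidableEq ι] {q : ℝ} (hq0 : 0 ≤ q) (hq1 : q ≤ 1)
    (A : ι → Finset E) (B : Finset E) (N : Finset ι) :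
    ∀ (S : Finset E), (∀ w ∈ N, ∀ w' ∈ N, w ≠ w' → Disjoint (A w) (A w')) →
    (∀ w ∈ N, Disjoint (A w) B) → (∀ w ∈ N, Disjoint (A w) S) → Disjoint S B →
    bv univ (fun _ => q)
      (fun W => ind (S ⊆ W ∧ (∀ w ∈ N, ∃ e ∈ A w, e ∈ W) ∧ Disjoint W B)) ≤
      q ^ S.card * (∏ w ∈ N, ((A w).card * q)) * (1 - q) ^ B.card := by
  induction N using Finset.induction_on with
  | empty =>
    intro S _ _ _ hSB
    simp only [Finset.notMem_empty, false_imp_iff, implies_true, true_and, prod_empty, mul_one]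
    exact (bv_subset_disjoint_prob (subset_univ S) (subset_univ B) hSB q).le
  | insert a N ha ih =>
    intro S hA hB hS hSB
    have h1 : bv univ (fun _ => q)
        (fun W => ind (S ⊆ W ∧ (∀ w ∈ insert a N, ∃ e ∈ A w, e ∈ W) ∧ Disjoint W B)) ≤
        bv univ (fun _ => q) (fun W => ∑ e ∈ A a,
          ind (insert e S ⊆ W ∧ (∀ w ∈ N, ∃ e ∈ A w, e ∈ W) ∧ Disjoint W B)) := by
      apply bv_mono (fun _ => hq0) (fun _ => hq1)
      intro W _
      by_cases h : S ⊆ W ∧ (∀ w ∈ insert a N, ∃ e ∈ A w, e ∈ W) ∧ Disjoint W B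
      · obtain ⟨e, he, heW⟩ := h.2.1 a (mem_insert_self _ _)
        rw [ind_true h]
        calc (1:ℝ) = ind (insert e S ⊆ W ∧ (∀ w ∈ N, ∃ e ∈ A w, e ∈ W) ∧ Disjoint W B) := by
              rw [ind_true]
              exact ⟨insert_subset heW h.1, fun w hw => h.2.1 w (mem_insert_of_mem hw), h.2.2⟩
          _ ≤ _ := Finset.single_le_sum (f := fun e =>
              ind (insert e S ⊆ W ∧ (∀ w ∈ N, ∃ e ∈ A w, e ∈ W) ∧ Disjoint W B))
              (fun _ _ => ind_nonneg _) he
      · rw [ind_false h]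
        exact sum_nonneg fun _ _ => ind_nonneg _
    refine h1.trans ?_
    rw [bv_sum, prod_insert ha]
    calc _ ≤ ∑ e ∈ A a, q ^ (S.card + 1) * (∏ w ∈ N, ((A w).card * q)) * (1 - q) ^ B.card := by
          apply sum_le_sum
          intro e he
          have heS : e ∉ S := fun h =>
            Finset.disjoint_left.1 (hS a (mem_insert_self _ _)) he h
          have := ih (insert e S)
            (fun w hw w' hw' => hA w (mem_insert_of_mem hw) w' (mem_insert_of_mem hw'))
            (fun w hw => hB w (mem_insert_of_mem hw))
            (fun w hw => by
              rw [disjoint_insert_right]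
              refine ⟨fun h => ?_, hS w (mem_insert_of_mem hw)⟩
              have hne : a ≠ w := by rintro rfl; exact ha hw
              exact Finset.disjoint_left.1 (hA a (mem_insert_self _ _) w (mem_insert_of_mem hw) hne)
                he h)
            (by
              rw [disjoint_insert_left]
              exact ⟨fun h => Finset.disjoint_left.1 (hB a (mem_insert_self _ _)) he h, hSB⟩)
          rwa [card_insert_of_notMem heS] at this
      _ = _ := by
          rw [sum_const, nsmul_eq_mul]; ring

lemma sum_pow_card {V : Type*} [DecidableEq V] [Fintype V] (x : ℝ) :
    ∑ N : Finset V, x ^ N.card = (1 + x) ^ Fintype.card V := by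
  have := Finset.sum_pow_mul_eq_add_pow x 1 (univ : Finset V)
  simp only [one_pow, mul_one, powerset_univ] at this
  rw [this, add_comm, Finset.card_univ]

end hit

section expconn
variable {V : Type} [DecidableEq V] [Fintype V]

/-- pairs between `U` and `T`, in both directions -/
def cut (U T : Finset V) : Finset (V × V) := U ×ˢ T ∪ T ×ˢ U

lemma mem_cut {U T : Finset V} {e : V × V} :
    e ∈ cut U T ↔ (e.1 ∈ U ∧ e.2 ∈ T) ∨ (e.1 ∈ T ∧ e.2 ∈ U) := by
  simp [cut, mem_product]

lemma card_cut {U T : Finset V} (h : Disjoint U T) : (cut U T).card = 2 * (U.card * T.card) := by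
  rw [cut, card_union_of_disjoint, card_product, card_product]
  · ring
  · rw [Finset.disjoint_left]
    rintro ⟨a, b⟩ h1 h2
    rw [mem_product] at h1 h2
    exact Finset.disjoint_left.1 h h1.1 h2.1

lemma not_expands_sub {D : Finset (V × V)} {k : ℕ} (h : ¬ Expands (adj D) k) :
    ∃ U N : Finset V, 1 ≤ U.card ∧ U.card ≤ k ∧ Disjoint U N ∧ N.card ≤ 2 * U.card ∧
      ((∅ : Finset (V × V)) ⊆ D ∧ (∀ w ∈ N, ∃ e ∈ cut U {w}, e ∈ D) ∧ Disjoint D (cut U (U ∪ N)ᶜ)) := by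
  classical
  unfold Expands at h
  push Not at h
  obtain ⟨U, N, h1, h2, h3, h4⟩ := h
  refine ⟨U, univ.filter (fun v => v ∉ U ∧ ∃ u ∈ U, adj D u v), h1, h2, ?_, ?_, by simp, ?_, ?_⟩
  · rw [Finset.disjoint_left]
    intro a ha hb
    simp only [mem_filter] at hb
    exact hb.2.1 ha
  · refine le_trans (card_le_card ?_) h4
    intro v hv
    simp only [mem_filter] at hv
    exact h3 v hv.2.1 hv.2.2
  · intro w hw
    simp only [mem_filter] at hw
    obtain ⟨-, -, u, hu, h | h⟩ := hw
    · exact ⟨(u, w), by simp [mem_cut, hu], h⟩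
    · exact ⟨(w, u), by simp [mem_cut, hu], h⟩
  · rw [Finset.disjoint_left]
    rintro ⟨a, b⟩ hab hc
    rw [mem_cut] at hc
    simp only [mem_compl, mem_union, mem_filter, mem_univ, true_and] at hc
    rcases hc with ⟨ha, hb⟩ | ⟨hb, ha⟩
    · push Not at hb
      exact hb.2 hb.1 a ha (Or.inl hab)
    · push Not at hb
      exact hb.2 hb.1 b ha (Or.inr hab)

lemma expands_prob {q : ℝ} (hq0 : 0 ≤ q) (hq1 : q ≤ 1) {k : ℕ} {L : ℝ} (hL : 1 ≤ L)
    (hk : 12 * k ≤ Fintype.card V) (hn : 0 < Fintype.card V) (hq : q = L / Fintype.card V) :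
    bv univ (fun _ => q) (fun W : Finset (V × V) => ind (¬ Expands (adj W) k)) ≤
      (1 + (L * Real.exp 1) ^ 2 * Real.exp (-(3 / 2) * L)) ^ Fintype.card V - 1 := by
  classical
  set n := Fintype.card V with hnn
  have hn' : (0:ℝ) < n := by exact_mod_cast hn
  set P : Finset V → Finset V → Finset (V × V) → Prop := fun U N D =>
    ((∅ : Finset (V × V)) ⊆ D ∧ (∀ w ∈ N, ∃ e ∈ cut U {w}, e ∈ D) ∧ Disjoint D (cut U (U ∪ N)ᶜ))
    with hP
  set x := (L * Real.exp 1) ^ 2 * Real.exp (-(3 / 2) * L) with hx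
  have hx0 : 0 ≤ x := by positivity
  set US := (univ : Finset (Finset V)).filter (fun U => 1 ≤ U.card ∧ U.card ≤ k) with hUS
  set NS : Finset V → Finset (Finset V) := fun U =>
    (univ : Finset (Finset V)).filter (fun N => Disjoint U N ∧ N.card ≤ 2 * U.card) with hNS
  have h1 : bv univ (fun _ => q) (fun W : Finset (V × V) => ind (¬ Expands (adj W) k)) ≤
      bv univ (fun _ => q) (fun W : Finset (V × V) => ∑ U ∈ US, ∑ N ∈ NS U, ind (P U N W)) := by
    apply bv_mono (fun _ => hq0) (fun _ => hq1)
    intro W _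
    by_cases h : ¬ Expands (adj W) k
    · rw [ind_true h]
      obtain ⟨U, N, a1, a2, a3, a4, a5⟩ := not_expands_sub h
      have hU : U ∈ US := by simp [hUS, a1, a2]; simpa using a1
      have hN : N ∈ NS U := by simp [hNS, a3, a4]
      calc (1:ℝ) = ind (P U N W) := (ind_true a5).symm
        _ ≤ ∑ N ∈ NS U, ind (P U N W) :=
          Finset.single_le_sum (f := fun N => ind (P U N W)) (fun _ _ => ind_nonneg _) hN
        _ ≤ _ := Finset.single_le_sum (f := fun U => ∑ N ∈ NS U, ind (P U N W))
          (fun _ _ => sum_nonneg fun _ _ => ind_nonneg _) hU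
    · rw [ind_false h]
      exact sum_nonneg fun _ _ => sum_nonneg fun _ _ => ind_nonneg _
  refine h1.trans ?_
  rw [bv_sum]
  have key : ∀ U ∈ US, bv univ (fun _ => q) (fun W => ∑ N ∈ NS U, ind (P U N W)) ≤ x ^ U.card := by
    intro U hU
    simp only [hUS, mem_filter, mem_univ, true_and] at hU
    set u := U.card with hu
    have hu0 : (0:ℝ) ≤ u := by positivity
    rw [bv_sum]
    have hun : 12 * (u:ℝ) ≤ n := by exact_mod_cast (by omega : 12 * u ≤ n)
    have key2 : ∀ N ∈ NS U, bv univ (fun _ => q) (fun W => ind (P U N W)) ≤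
        (L ^ 2 * Real.exp (-(3 / 2) * L)) ^ u * (2 * u / n) ^ N.card := by
      intro N hN
      simp only [hNS, mem_filter, mem_univ, true_and] at hN
      have hb := bv_hit_disjoint hq0 hq1 (fun w => cut U {w}) (cut U (U ∪ N)ᶜ) N ∅
        (by
          intro w hw w' hw' hne
          rw [Finset.disjoint_left]
          rintro ⟨a, b⟩ h1 h2
          simp only [mem_cut, mem_singleton] at h1 h2
          have hUw : w ∉ U := fun h => Finset.disjoint_left.1 hN.1 h hw
          have hUw' : w' ∉ U := fun h => Finset.disjoint_left.1 hN.1 h hw'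
          grind)
        (by
          intro w hw
          rw [Finset.disjoint_left]
          rintro ⟨a, b⟩ h1 h2
          simp only [mem_cut, mem_singleton, mem_compl, mem_union] at h1 h2
          grind)
        (by simp) (by simp)
      refine hb.trans ?_
      rw [card_empty, pow_zero, one_mul]
      have hc1 : ∀ w ∈ N, (((cut U {w}).card : ℝ) * q) = 2 * u * q := by
        intro w hw
        rw [card_cut]
        · rw [card_singleton]; push_cast; ring
        · rw [disjoint_singleton_right]
          exact fun h => Finset.disjoint_left.1 hN.1 h hw
      rw [prod_congr rfl hc1, prod_const]
      have hc2 : (3 / 2 : ℝ) * u * n ≤ (cut U (U ∪ N)ᶜ).card := by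
        rw [card_cut, card_compl, card_union_of_disjoint hN.1]
        · have : (u:ℝ) * (3 / 4 * n) ≤ u * ((n - (u + N.card) : ℕ) : ℝ) := by
            apply mul_le_mul_of_nonneg_left _ hu0
            rw [Nat.cast_sub (by omega)]
            have : (N.card : ℝ) ≤ 2 * u := by exact_mod_cast hN.2
            push_cast
            linarith
          push_cast
          rw [← hnn]
          linarith
        · rw [Finset.disjoint_left]
          intro a ha hb
          simp [ha] at hb
      have hc3 : (1 - q) ^ (cut U (U ∪ N)ᶜ).card ≤ Real.exp (-(3/2) * L) ^ u := by
        calc (1 - q) ^ (cut U (U ∪ N)ᶜ).card ≤ (Real.exp (-q)) ^ (cut U (U ∪ N)ᶜ).card := by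
              apply pow_le_pow_left₀ (by linarith)
              have := Real.add_one_le_exp (-q)
              linarith
          _ = Real.exp (-(q * (cut U (U ∪ N)ᶜ).card)) := by
              rw [← Real.exp_nat_mul]; congr 1; ring
          _ ≤ Real.exp (-(q * ((3 / 2 : ℝ) * u * n))) := by
              apply Real.exp_le_exp.2
              have := mul_le_mul_of_nonneg_left hc2 hq0
              linarith
          _ = Real.exp (-(3/2) * L) ^ u := by
              rw [← Real.exp_nat_mul]; congr 1; rw [hq]; field_simp
      have hc4 : (2 * u * q) ^ N.card ≤ (L ^ 2) ^ u * (2 * u / n) ^ N.card := by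
        have : 2 * u * q = L * (2 * u / n) := by rw [hq]; field_simp
        rw [this, mul_pow, ← pow_mul]
        apply mul_le_mul_of_nonneg_right _ (by positivity)
        exact pow_le_pow_right₀ hL hN.2
      calc _ ≤ ((L ^ 2) ^ u * (2 * u / n) ^ N.card) * Real.exp (-(3/2) * L) ^ u :=
            mul_le_mul hc4 hc3 (by apply pow_nonneg; linarith) (by positivity)
        _ = _ := by rw [mul_pow]; ring
    calc _ ≤ ∑ N ∈ NS U, (L ^ 2 * Real.exp (-(3 / 2) * L)) ^ u * (2 * u / n) ^ N.card :=
          sum_le_sum key2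
      _ ≤ ∑ N : Finset V, (L ^ 2 * Real.exp (-(3 / 2) * L)) ^ u * (2 * (u:ℝ) / n) ^ N.card :=
          sum_le_sum_of_subset_of_nonneg (subset_univ _) (fun _ _ _ => by positivity)
      _ = (L ^ 2 * Real.exp (-(3 / 2) * L)) ^ u * (1 + 2 * (u:ℝ) / n) ^ n := by
          rw [← mul_sum, sum_pow_card]
      _ ≤ (L ^ 2 * Real.exp (-(3 / 2) * L)) ^ u * (Real.exp 1 ^ 2) ^ u := by
          apply mul_le_mul_of_nonneg_left _ (by positivity)
          calc (1 + 2 * (u:ℝ) / n) ^ n ≤ Real.exp (2 * u / n) ^ n := by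
                apply pow_le_pow_left₀ (by positivity)
                have := Real.add_one_le_exp (2 * (u:ℝ) / n)
                linarith
            _ = _ := by
                rw [← Real.exp_nat_mul, ← pow_mul, ← Real.exp_nat_mul]
                congr 1
                push_cast; field_simp
      _ = x ^ u := by rw [hx, ← mul_pow]; congr 1; ring
  calc _ ≤ ∑ U ∈ US, x ^ U.card := sum_le_sum key
    _ ≤ ∑ U ∈ (univ : Finset (Finset V)).erase ∅, x ^ U.card := by
        apply sum_le_sum_of_subset_of_nonneg _ (fun _ _ _ => by positivity)
        intro U hU
        simp only [hUS, mem_filter, mem_univ, true_and] at hU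
        simp only [mem_erase, mem_univ, and_true]
        rintro rfl
        simp at hU
    _ = _ := by
        rw [← sum_pow_card (V := V) x, ← Finset.add_sum_erase univ _ (mem_univ ∅)]
        simp

lemma conn_prob {q : ℝ} (hq0 : 0 ≤ q) (hq1 : q ≤ 1) {k : ℕ} {L : ℝ} 
    (hk : Fintype.card V ≤ 12 * (k + 1)) (hn : 0 < Fintype.card V) (hq : q = L / Fintype.card V) :
    bv univ (fun _ => q) (fun W : Finset (V × V) => ind (Expands (adj W) k ∧ ¬ Conn (adj W))) ≤
      (2 * Real.exp (- L / 12)) ^ Fintype.card V := by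
  classical
  set n := Fintype.card V with hnn
  have hn' : (0:ℝ) < n := by exact_mod_cast hn
  set US := (univ : Finset (Finset V)).filter (fun U => n ≤ 12 * U.card ∧ n ≤ 12 * Uᶜ.card) with hUS
  have h1 : bv univ (fun _ => q) (fun W : Finset (V × V) => ind (Expands (adj W) k ∧ ¬ Conn (adj W))) ≤
      bv univ (fun _ => q) (fun W : Finset (V × V) => ∑ U ∈ US, ind (Disjoint W (cut U Uᶜ))) := by
    apply bv_mono (fun _ => hq0) (fun _ => hq1)
    intro W _
    by_cases h : Expands (adj W) k ∧ ¬ Conn (adj W)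
    · rw [ind_true h]
      obtain ⟨hE, hC⟩ := h
      unfold Conn at hC
      push Not at hC
      obtain ⟨U, hU1, hU2, hU3⟩ := hC
      have hd : Disjoint W (cut U Uᶜ) := by
        rw [Finset.disjoint_left]
        rintro ⟨a, b⟩ hab hc
        rw [mem_cut] at hc
        simp only [mem_compl] at hc
        rcases hc with hc | hc
        · exact hU3 a hc.1 b hc.2 (Or.inl hab)
        · exact hU3 b hc.2 a hc.1 (Or.inr hab)
      have hU : U ∈ US := by
        simp only [hUS, mem_filter, mem_univ, true_and]
        constructor
        · by_contra hlt
          have := hE U ∅ hU1.card_pos (by omega) (by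
            rintro v hv ⟨u, hu, huv⟩
            exact absurd huv (hU3 u hu v hv))
          simp at this
        · by_contra hlt
          have hne : Uᶜ.Nonempty := by
            rw [Finset.nonempty_iff_ne_empty]
            intro h0
            apply hU2
            rwa [compl_eq_empty_iff] at h0
          have := hE Uᶜ ∅ hne.card_pos (by omega) (by
            rintro v hv ⟨u, hu, huv⟩
            simp only [mem_compl, not_not] at hu hv
            exact absurd huv.symm (hU3 v hv u hu))
          simp at this
      calc (1:ℝ) = ind (Disjoint W (cut U Uᶜ)) := (ind_true hd).symm
        _ ≤ _ := Finset.single_le_sum (f := fun U => ind (Disjoint W (cut U Uᶜ)))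
          (fun _ _ => ind_nonneg _) hU
    · rw [ind_false h]
      exact sum_nonneg fun _ _ => ind_nonneg _
  refine h1.trans ?_
  rw [bv_sum]
  calc _ ≤ ∑ U ∈ US, Real.exp (-L/12) ^ n := by
        apply sum_le_sum
        intro U hU
        simp only [hUS, mem_filter, mem_univ, true_and] at hU
        rw [bv_disjoint_prob (subset_univ _), card_cut disjoint_compl_right]
        have hc : (n:ℝ) * n / 12 ≤ ((2 * (U.card * Uᶜ.card) : ℕ) : ℝ) := by
          have h3 : (U.card : ℝ) + Uᶜ.card = n := by
            exact_mod_cast (card_add_card_compl U)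
          have h4 : (n:ℝ) ≤ 12 * U.card := by exact_mod_cast hU.1
          have h5 : (n:ℝ) ≤ 12 * Uᶜ.card := by exact_mod_cast hU.2
          push_cast
          nlinarith [mul_nonneg (sub_nonneg.2 h4) (sub_nonneg.2 h5)]
        calc (1 - q) ^ (2 * (U.card * Uᶜ.card)) ≤ (Real.exp (-q)) ^ (2 * (U.card * Uᶜ.card)) := by
              apply pow_le_pow_left₀ (by linarith)
              have := Real.add_one_le_exp (-q)
              linarith
          _ = Real.exp (-(q * (2 * (U.card * Uᶜ.card) : ℕ))) := by
              rw [← Real.exp_nat_mul]; congr 1; ring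
          _ ≤ Real.exp (-(q * ((n:ℝ) * n / 12))) := by
              apply Real.exp_le_exp.2
              have := mul_le_mul_of_nonneg_left hc hq0
              linarith
          _ = _ := by
              rw [← Real.exp_nat_mul]; congr 1; rw [hq]; field_simp
    _ ≤ ∑ U : Finset V, Real.exp (-L/12) ^ n :=
        sum_le_sum_of_subset_of_nonneg (subset_univ _) (fun _ _ _ => by positivity)
    _ = _ := by
        rw [sum_const, card_univ, Fintype.card_finset, nsmul_eq_mul, mul_pow]
        push_cast; rfl

end expconn
end CombProof


namespace CombProof
open Finset Filter Topology
set_option linter.unusedSectionVars false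

lemma expands_limit : Tendsto (fun n : ℕ =>
    (1 + (Real.log n * Real.exp 1) ^ 2 * Real.exp (-(3 / 2) * Real.log n)) ^ n - 1) atTop (𝓝 0) := by
  have h1 : Tendsto (fun n : ℕ => Real.exp 1 ^ 2 * (Real.log n / (n:ℝ) ^ (1/4:ℝ)) ^ 2) atTop (𝓝 0) := by
    have h0 : Tendsto (fun n : ℕ => Real.log n / (n:ℝ) ^ (1/4:ℝ)) atTop (𝓝 0) :=
      ((isLittleO_log_rpow_atTop (by norm_num : (0:ℝ) < 1/4)).tendsto_div_nhds_zero).comp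
        tendsto_natCast_atTop_atTop
    have := (h0.pow 2).const_mul (Real.exp 1 ^ 2)
    simpa using this
  have h2 : Tendsto (fun n : ℕ => Real.exp (Real.exp 1 ^ 2 * (Real.log n / (n:ℝ) ^ (1/4:ℝ)) ^ 2) - 1)
      atTop (𝓝 0) := by
    have := ((Real.continuous_exp.tendsto 0).comp h1).sub_const 1
    simpa using this
  refine squeeze_zero' ?_ ?_ h2
  · filter_upwards with n
    have : (1:ℝ) ≤ (1 + (Real.log n * Real.exp 1) ^ 2 * Real.exp (-(3 / 2) * Real.log n)) ^ n := by
      apply one_le_pow₀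
      have : 0 ≤ (Real.log n * Real.exp 1) ^ 2 * Real.exp (-(3 / 2) * Real.log n) := by positivity
      linarith
    linarith
  · filter_upwards [eventually_ge_atTop 1] with n hn
    have hn' : (0:ℝ) < n := by exact_mod_cast hn
    have h3 : (n:ℝ) * ((Real.log n * Real.exp 1) ^ 2 * Real.exp (-(3 / 2) * Real.log n)) =
        Real.exp 1 ^ 2 * (Real.log n / (n:ℝ) ^ (1/4:ℝ)) ^ 2 := by
      have e1 : Real.exp (-(3 / 2) * Real.log n) = (n:ℝ) ^ (-(3/2):ℝ) := by
        rw [Real.rpow_def_of_pos hn', mul_comm]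
      have e2 : ((n:ℝ) ^ (1/4:ℝ)) ^ 2 = (n:ℝ) ^ (1/2:ℝ) := by
        rw [← Real.rpow_natCast, ← Real.rpow_mul hn'.le]; norm_num
      have e3 : (n:ℝ) * (n:ℝ) ^ (-(3/2):ℝ) * (n:ℝ) ^ (1/2:ℝ) = 1 := by
        nth_rewrite 1 [← Real.rpow_one (n:ℝ)]
        rw [← Real.rpow_add hn', ← Real.rpow_add hn']; norm_num
      have e4 : (0:ℝ) < (n:ℝ) ^ (1/2:ℝ) := by positivity
      rw [e1, div_pow, e2]
      field_simp
      linear_combination (Real.log n ^ 2) * e3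
    have h4 := Real.add_one_le_exp
      ((Real.log n * Real.exp 1) ^ 2 * Real.exp (-(3 / 2) * Real.log n))
    have h5 : (1 + (Real.log n * Real.exp 1) ^ 2 * Real.exp (-(3 / 2) * Real.log n)) ^ n ≤
        Real.exp ((n:ℝ) * ((Real.log n * Real.exp 1) ^ 2 * Real.exp (-(3 / 2) * Real.log n))) := by
      rw [Real.exp_nat_mul]
      apply pow_le_pow_left₀ (by positivity)
      linarith
    rw [h3] at h5
    linarith

lemma conn_limit : Tendsto (fun n : ℕ => (2 * Real.exp (- Real.log n / 12)) ^ n) atTop (𝓝 0) := by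
  have h : Tendsto (fun n : ℕ => ((1/2:ℝ)) ^ n) atTop (𝓝 0) :=
    tendsto_pow_atTop_nhds_zero_of_lt_one (by norm_num) (by norm_num)
  refine squeeze_zero' ?_ ?_ h
  · filter_upwards with n
    positivity
  · have hl : Tendsto (fun n : ℕ => Real.log n) atTop atTop :=
      Real.tendsto_log_atTop.comp tendsto_natCast_atTop_atTop
    filter_upwards [hl.eventually_ge_atTop 36] with n hn
    apply pow_le_pow_left₀ (by positivity)
    have h1 : Real.exp (-Real.log n / 12) ≤ Real.exp (-3) := Real.exp_le_exp.2 (by linarith)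
    have h2 : Real.exp (-3) ≤ 1/4 := by
      rw [Real.exp_neg]
      have := Real.add_one_le_exp (3:ℝ)
      rw [inv_le_comm₀ (by positivity) (by norm_num)]
      norm_num; linarith
    linarith

lemma one_sub_pow_ge {q : ℝ} (h0 : 0 ≤ q) (h1 : q ≤ 1) (j : ℕ) : 1 - j * q ≤ (1 - q) ^ j := by
  have := one_add_mul_le_pow (a := -q) (by linarith) j
  have e : 1 + -q = 1 - q := by ring
  rw [e] at this
  linarith

/-- Hamiltonicity with high probability in the directed model. -/
theorem ham_whp {δ : ℝ} (hδ : 0 < δ) : ∃ n0 : ℕ, ∀ (V : Type) [DecidableEq V] [Fintype V],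
    n0 ≤ Fintype.card V → ∀ q : ℝ, (Real.log (Fintype.card V) + 3456) / Fintype.card V ≤ q → q ≤ 1 →
    bv univ (fun _ => q) (fun W : Finset (V × V) => ind (¬ Ham (adj W))) ≤ δ := by
  have h1 := (tendsto_order.1 expands_limit).2 (δ/3) (by linarith)
  have h2 := (tendsto_order.1 conn_limit).2 (δ/3) (by linarith)
  have h3 : Tendsto (fun n : ℕ => ((27/32:ℝ)) ^ n) atTop (𝓝 0) :=
    tendsto_pow_atTop_nhds_zero_of_lt_one (by norm_num) (by norm_num)
  have h3 := (tendsto_order.1 h3).2 (δ/3) (by linarith)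
  have hl : Tendsto (fun n : ℕ => Real.log n) atTop atTop :=
      Real.tendsto_log_atTop.comp tendsto_natCast_atTop_atTop
  have h4 := hl.eventually_ge_atTop 1
  obtain ⟨n0, hn0⟩ := eventually_atTop.1 (h1.and (h2.and (h3.and (h4.and (eventually_ge_atTop 2000)))))
  refine ⟨n0, ?_⟩
  intro V _ _ hV q hq hq1
  obtain ⟨a1, a2, a3, a4, a5⟩ := hn0 _ hV
  set n := Fintype.card V with hn
  have hne : Nonempty V := by
    rw [← Fintype.card_pos_iff]; omega
  have hnpos : (0:ℝ) < n := by exact_mod_cast (by omega : 0 < n)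
  have hn1 : (2000:ℝ) ≤ n := by exact_mod_cast a5
  set L := Real.log n with hL
  set q1 := L / n with hq1d
  set q2 : ℝ := 1152 / (n:ℝ)^2 with hq2d
  set k := n / 12 with hk
  have hq1_0 : 0 ≤ q1 := by apply div_nonneg <;> linarith
  have hq1_1 : q1 ≤ 1 := by
    rw [hq1d, div_le_one hnpos]
    have := Real.log_le_sub_one_of_pos hnpos
    linarith
  have hq2_0 : 0 ≤ q2 := by positivity
  have hq2_1 : q2 ≤ 1 := by
    rw [hq2d, div_le_one (by positivity)]
    nlinarith
  have hk24 : (n:ℝ) / 24 ≤ k := by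
    have : n ≤ 24 * k := by omega
    have : (n:ℝ) ≤ 24 * k := by exact_mod_cast this
    linarith
  have hθ : (1 - q2) ^ (k * k) ≤ 1/4 := by
    calc (1 - q2) ^ (k*k) ≤ (Real.exp (-q2)) ^ (k*k) := by
          apply pow_le_pow_left₀ (by linarith)
          have := Real.add_one_le_exp (-q2)
          linarith
      _ = Real.exp (-(q2 * (k * k))) := by
          rw [← Real.exp_nat_mul]; congr 1; push_cast; ring
      _ ≤ Real.exp (-2) := by
          apply Real.exp_le_exp.2
          have : (n:ℝ)/24 * (n/24) ≤ k * k := by gcongr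
          have h2 : q2 * ((n:ℝ)/24 * (n/24)) = 2 := by rw [hq2d]; field_simp; norm_num
          have := mul_le_mul_of_nonneg_left this hq2_0
          linarith
      _ ≤ 1/4 := by
          have e : Real.exp (-2) = (Real.exp 1 ^ 2)⁻¹ := by
            rw [← Real.exp_nat_mul, ← Real.exp_neg]; norm_num
          rw [e, inv_le_comm₀ (by positivity) (by norm_num)]
          have := Real.add_one_le_exp (1:ℝ)
          have h4 : (4:ℝ) ≤ Real.exp 1 ^ 2 := by nlinarith
          linarith
  set j := 3 * n with hj
  set qs := 1 - (1 - q2) ^ j with hqs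
  have hqs0 : 0 ≤ qs := by
    have : (1 - q2) ^ j ≤ 1 := pow_le_one₀ (by linarith) (by linarith)
    linarith
  have hqs1 : qs ≤ 1 := by
    have : 0 ≤ (1 - q2) ^ j := pow_nonneg (by linarith) _
    linarith
  have hqsb : qs ≤ 3456 / n := by
    have := one_sub_pow_ge hq2_0 hq2_1 j
    have e : (j:ℝ) * q2 = 3456 / n := by rw [hj, hq2d]; push_cast; field_simp; norm_num
    rw [e] at this
    linarith
  have hmono : Antitone (fun W : Finset (V × V) => ind (¬ Ham (adj W))) := by
    intro W W' h
    apply ind_mono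
    intro h1 h2
    exact h1 (h2.mono h)
  have hcomb : bv univ (fun _ => q) (fun W : Finset (V × V) => ind (¬ Ham (adj W))) ≤
      bv univ (fun _ => 1 - (1 - qs) * (1 - q1)) (fun W : Finset (V × V) => ind (¬ Ham (adj W))) := by
    have hle : 1 - (1 - qs) * (1 - q1) ≤ q := by
      have : (L + 3456) / n = q1 + 3456 / n := by rw [hq1d]; ring
      have : 0 ≤ qs * q1 := by positivity
      nlinarith
    have hge : 0 ≤ 1 - (1 - qs) * (1 - q1) := by
      have := mul_le_one₀ (by linarith : 1 - qs ≤ 1) (by linarith : 0 ≤ 1 - q1) (by linarith)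
      linarith
    have := bv_mono_v (s := (univ : Finset (V × V))) (v := fun _ => 1 - (1 - qs) * (1 - q1))
      (u := fun _ => q) (fun _ => hge) (fun _ => hq1) (fun _ => hle)
      (f := fun W => - ind (¬ Ham (adj W))) (fun W W' h => neg_le_neg (hmono h))
    have e : ∀ v : V × V → ℝ, bv univ v (fun W => - ind (¬ Ham (adj W))) =
        - bv univ v (fun W => ind (¬ Ham (adj W))) := by
      intro v
      have := bv_mul univ v (-1) (fun W => ind (¬ Ham (adj W)))
      simpa using this
    rw [e, e] at this
    linarith
  refine hcomb.trans ?_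
  rw [← bv_union]
  calc _ ≤ bv univ (fun _ => q1) (fun D : Finset (V × V) =>
        ind (¬ Expands (adj D) k) + ind (Expands (adj D) k ∧ ¬ Conn (adj D)) + (27/32)^n) := by
        apply bv_mono (fun _ => hq1_0) (fun _ => hq1_1)
        intro D _
        have hle1 : bv univ (fun _ => qs) (fun W => ind (¬ Ham (adj (W ∪ D)))) ≤ 1 :=
          bv_le_const (fun _ => hqs0) (fun _ => hqs1) (fun W => ind_le_one _)
        have hpos : (0:ℝ) ≤ (27/32)^n := by positivity
        by_cases hE : Expands (adj D) k
        · by_cases hC : Conn (adj D)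
          · have := posa_sprinkle hq2_0 hq2_1 hθ j n D hE hC
              (Or.inr ⟨[], ⟨List.nodup_nil, List.isChain_nil⟩, by simp [hn]⟩)
            have e : (2:ℝ)^n * (3/4)^j = (27/32)^n := by
              rw [hj, pow_mul, ← mul_pow]; norm_num
            rw [e] at this
            have i1 := ind_nonneg (¬ Expands (adj D) k)
            have i2 := ind_nonneg (Expands (adj D) k ∧ ¬ Conn (adj D))
            linarith
          · rw [ind_true (⟨hE, hC⟩ : Expands (adj D) k ∧ ¬ Conn (adj D))]
            have i1 := ind_nonneg (¬ Expands (adj D) k)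
            linarith
        · rw [ind_true hE]
          have i2 := ind_nonneg (Expands (adj D) k ∧ ¬ Conn (adj D))
          linarith
    _ ≤ δ/3 + δ/3 + δ/3 := by
        rw [bv_add, bv_add, bv_const]
        have b1 := expands_prob (V := V) hq1_0 hq1_1 (k := k) a4 (by omega) (by omega) rfl
        have b2 := conn_prob (V := V) hq1_0 hq1_1 (k := k) (L := L) (by omega) (by omega) rfl
        rw [← hn] at b1 b2
        linarith
    _ = δ := by ring

end CombProof


namespace CombProof
open Finset
set_option linter.unusedSectionVars false

lemma exists_perm_ext {V Λ : Type*} [Fintype V] [DecidableEq V] (T H : Λ → V)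
    (hT : Function.Injective T) (hH : Function.Injective H) :
    ∃ τ : Equiv.Perm V, ∀ l, τ (T l) = H l := by
  classical
  let e : {x // x ∈ Set.range T} ≃ {x // x ∈ Set.range H} :=
    (Equiv.ofInjective T hT).symm.trans (Equiv.ofInjective H hH)
  refine ⟨e.extendSubtype, fun l => ?_⟩
  rw [Equiv.extendSubtype_apply_of_mem e (T l) ⟨l, rfl⟩]
  have : (⟨T l, ⟨l, rfl⟩⟩ : {x // x ∈ Set.range T}) = Equiv.ofInjective T hT l := rfl
  simp only [e, Equiv.trans_apply, this, Equiv.symm_apply_apply]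
  rfl

theorem links_main (R : ℕ) {η : ℝ} (hη : 0 < η) : ∃ ρ : ℝ, 0 < ρ ∧
    ∀ (V : Type) [DecidableEq V] [Fintype V] (Ω : Type) [DecidableEq Ω]
      (Λ : Type) [DecidableEq Λ] [Fintype Λ]
      (O0 : Finset Ω) (T H : Ω → Λ → V) (c p : ℝ) (m : ℕ), O0.Nonempty →
      (∀ ω ∈ O0, Function.Injective (T ω)) → (∀ ω ∈ O0, Function.Injective (H ω)) →
      (∀ ω ∈ O0, ∀ L : Finset Λ,
        ((O0.filter (fun ω' => ∀ l ∈ L, ∃ l', T ω' l' = T ω l ∧ H ω' l' = H ω l)).card : ℝ) ≤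
          O0.card * (c ^ L.card * (1 / (m:ℝ)) ^ ((L.image (T ω) ∪ L.image (H ω)).card - L.card))) →
      0 ≤ c → 0 < p → p ≤ 1 → 1 ≤ m → 2 * c / p ≤ ρ → (Fintype.card V) * c * (2 * c / p) ≤ ρ →
      Fintype.card V ≤ m ^ R →
      bv univ (fun _ => 1 - (1 - p) ^ (R + 1))
        (fun W => ind (¬ ∃ ω ∈ O0, ∀ l, (T ω l, H ω l) ∈ W)) ≤ η := by
  classical
  obtain ⟨ρ, hρ, hmain⟩ := chain_main R hη
  refine ⟨ρ, hρ, ?_⟩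
  intro V _ _ Ω _ Λ _ _ O0 T H c p m hne hT hH hcount hc hp hp1 hm h1 h2 h3
  have hex : ∀ ω, ∃ τ : Equiv.Perm V, ω ∈ O0 → ∀ l, τ (T ω l) = H ω l := by
    intro ω
    by_cases h : ω ∈ O0
    · obtain ⟨τ, hτ⟩ := exists_perm_ext (T ω) (H ω) (hT ω h) (hH ω h)
      exact ⟨τ, fun _ => hτ⟩
    · exact ⟨1, fun h' => absurd h' h⟩
  choose τ hτ using hex
  have hgr : ∀ ω ∈ O0, ∀ W, gr (τ ω) (univ.image (T ω)) ⊆ W ↔ ∀ l, (T ω l, H ω l) ∈ W := by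
    intro ω hω W
    constructor
    · intro h l
      apply h
      rw [← hτ ω hω l]
      exact mem_image.2 ⟨T ω l, mem_image_of_mem _ (mem_univ _), rfl⟩
    · intro h e he
      obtain ⟨v, hv, rfl⟩ := mem_image.1 he
      obtain ⟨l, -, rfl⟩ := mem_image.1 hv
      rw [hτ ω hω l]
      exact h l
  have := hmain V Ω O0 τ (fun ω => univ.image (T ω)) c p m hne ?_ hc hp hp1 hm h1 h2 h3
  · refine le_trans (le_of_eq ?_) this
    apply bv_congr
    intro W _
    apply ind_congr
    apply not_congr
    constructor
    · rintro ⟨ω, hω, h⟩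
      exact ⟨ω, hω, (hgr ω hω W).2 h⟩
    · rintro ⟨ω, hω, h⟩
      exact ⟨ω, hω, (hgr ω hω W).1 h⟩
  · intro ω hω J1 hJ1
    set L := univ.filter (fun l => T ω l ∈ J1) with hL
    have hLT : L.image (T ω) = J1 := by
      ext v
      simp only [hL, mem_image, mem_filter, mem_univ, true_and]
      constructor
      · rintro ⟨l, h, rfl⟩; exact h
      · intro hv
        obtain ⟨l, -, rfl⟩ := mem_image.1 (hJ1 hv)
        exact ⟨l, hv, rfl⟩
    have hcard : L.card = J1.card := by
      rw [← hLT, card_image_of_injective _ (hT ω hω)]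
    have hLH : L.image (H ω) = J1.image (τ ω) := by
      rw [← hLT, image_image]
      apply image_congr
      intro l _
      simp [hτ ω hω l]
    have hends : (L.image (T ω) ∪ L.image (H ω)).card - L.card = (ends (τ ω) J1).card := by
      rw [hLT, hLH, hcard]
      have e1 : (J1 ∪ J1.image (τ ω)) = J1 ∪ (ends (τ ω) J1).image (τ ω) := by
        ext v
        simp only [ends, mem_union, mem_image, mem_filter]
        constructor
        · rintro (h | ⟨a, ha, rfl⟩)
          · exact Or.inl h
          · by_cases h : τ ω a ∈ J1
            · exact Or.inl h
            · exact Or.inr ⟨a, ⟨ha, h⟩, rfl⟩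
        · rintro (h | ⟨a, ha, rfl⟩)
          · exact Or.inl h
          · exact Or.inr ⟨a, ha.1, rfl⟩
      rw [e1, card_union_of_disjoint, card_image_of_injective _ (τ ω).injective]
      · omega
      · rw [Finset.disjoint_left]
        intro v hv hv'
        obtain ⟨a, ha, rfl⟩ := mem_image.1 hv'
        exact (mem_filter.1 ha).2 hv
    have := hcount ω hω L
    rw [hends, hcard] at this
    refine le_trans ?_ this
    norm_cast
    apply card_le_card
    intro ω' hω'
    rw [mem_filter] at hω' ⊢
    refine ⟨hω'.1, ?_⟩
    intro l hl
    have hl' : T ω l ∈ J1 := (mem_filter.1 hl).2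
    have := (gr_subset_gr.1 hω'.2) (T ω l) hl'
    obtain ⟨l', -, hl''⟩ := mem_image.1 this.1
    refine ⟨l', hl'', ?_⟩
    rw [← hτ ω hω l, ← hτ ω' hω'.1 l', hl'']
    exact this.2

/-! ### Counting lemmas -/

/-- permutations forced on `D` -/
lemma perm_count {N : ℕ} (PP : Finset (Equiv.Perm (Fin N))) (D : Finset (Fin N))
    (h : ∀ a ∈ D, (∃ j : Fin N, ∀ π ∈ PP, ((π a : Fin N) : ℕ) = (π j : ℕ) + 1) ∨
      (∀ π ∈ PP, ∀ π' ∈ PP, π a = π' a)) :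
    PP.card ≤ (N - D.card).factorial := by
  classical
  have hcardC : Fintype.card {a // a ∉ D} = N - D.card := by
    rw [Fintype.card_subtype_compl, Fintype.card_fin, Fintype.card_coe]
  let rk : Equiv.Perm (Fin N) → {a // a ∉ D} → ℕ := fun π a =>
    (univ.filter (fun b : {a // a ∉ D} => π b.1 < π a.1)).card
  have hrk_lt : ∀ π a, rk π a < N - D.card := by
    intro π a
    rw [← hcardC, ← card_univ]
    apply card_lt_card
    rw [Finset.ssubset_iff_of_subset (subset_univ _)]
    exact ⟨a, mem_univ _, by simp⟩
  have hrk_mono : ∀ π (a b : {a // a ∉ D}), π a.1 < π b.1 → rk π a < rk π b := by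
    intro π a b hab
    apply card_lt_card
    rw [Finset.ssubset_iff_of_subset]
    · exact ⟨a, by simp [hab], by simp⟩
    · intro x hx
      simp only [mem_filter, mem_univ, true_and] at hx ⊢
      exact hx.trans hab
  have hrk_inj : ∀ π, Function.Injective (rk π) := by
    intro π a b hab
    rcases lt_trichotomy (π a.1) (π b.1) with h1 | h1 | h1
    · have := hrk_mono π a b h1; omega
    · exact Subtype.ext (π.injective h1)
    · have := hrk_mono π b a h1; omega
  let em : Equiv.Perm (Fin N) → ({a // a ∉ D} ↪ Fin (N - D.card)) := fun π =>
    ⟨fun a => ⟨rk π a, hrk_lt π a⟩, fun a b hab => hrk_inj π (by simpa using hab)⟩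
  have hinj : Set.InjOn em PP := by
    intro π hπ π' hπ' heq
    have hrk : ∀ a, rk π a = rk π' a := by
      intro a
      have := congrArg (fun f => (f a).val) heq
      exact this
    have key : ∀ p : ℕ, ∀ hp : p < N, π.symm ⟨p, hp⟩ = π'.symm ⟨p, hp⟩ := by
      intro p
      induction p using Nat.strong_induction_on with
      | _ p ih =>
        intro hp
        have hforce : ∀ π1 ∈ PP, ∀ π2 ∈ PP, (∀ q, q < p → ∀ hq : q < N,
            π1.symm ⟨q, hq⟩ = π2.symm ⟨q, hq⟩) → π1.symm ⟨p, hp⟩ ∈ D →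
            π1.symm ⟨p, hp⟩ = π2.symm ⟨p, hp⟩ := by
          intro π1 h1 π2 h2 hag hD
          rcases h _ hD with ⟨j, hj⟩ | hfix
          · have e1 := hj π1 h1
            have e2 := hj π2 h2
            simp only [Equiv.apply_symm_apply] at e1
            have hlt : (π1 j : ℕ) < p := by omega
            have := hag (π1 j) hlt (π1 j).2
            have h3 : π2 j = π1 j := by
              have h4 : π1.symm (π1 j) = π2.symm (π1 j) := this
              rw [Equiv.symm_apply_apply] at h4
              rw [h4, Equiv.apply_symm_apply, ← h4]
            rw [Equiv.eq_symm_apply]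
            apply Fin.ext
            rw [e2, h3, ← e1]
          · have := hfix π1 h1 π2 h2
            rw [Equiv.eq_symm_apply, ← this, Equiv.apply_symm_apply]
        by_cases hD : π.symm ⟨p, hp⟩ ∈ D
        · exact hforce π hπ π' hπ' (fun q hq hq' => ih q hq hq') hD
        · by_cases hD' : π'.symm ⟨p, hp⟩ ∈ D
          · exact (hforce π' hπ' π hπ (fun q hq hq' => (ih q hq hq').symm) hD').symm
          · set a : {a // a ∉ D} := ⟨π.symm ⟨p, hp⟩, hD⟩ with ha
            set a' : {a // a ∉ D} := ⟨π'.symm ⟨p, hp⟩, hD'⟩ with ha'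
            have : rk π a = rk π' a' := by
              show (univ.filter _).card = (univ.filter _).card
              congr 1
              ext b
              simp only [mem_filter, mem_univ, true_and, ha, ha', Equiv.apply_symm_apply]
              constructor
              · intro hb
                have := ih (π b.1) hb (π b.1).2
                have h4 : π.symm (π b.1) = π'.symm (π b.1) := this
                rw [Equiv.symm_apply_apply] at h4
                rw [h4, Equiv.apply_symm_apply]
                exact hb
              · intro hb
                have := ih (π' b.1) hb (π' b.1).2
                have h4 : π.symm (π' b.1) = π'.symm (π' b.1) := this
                rw [Equiv.symm_apply_apply] at h4
                rw [← h4, Equiv.apply_symm_apply]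
                exact hb
            rw [← hrk a'] at this
            have := hrk_inj π this
            exact congrArg Subtype.val this
    have : π.symm = π'.symm := by
      ext x
      rw [key x.1 x.2]
    have := congrArg Equiv.symm this
    simpa using this
  calc PP.card = (PP.image em).card := (card_image_of_injOn hinj).symm
    _ ≤ Fintype.card ({a // a ∉ D} ↪ Fin (N - D.card)) := card_le_univ _
    _ = (N - D.card).factorial := by
        rw [Fintype.card_embedding_eq, hcardC, Fintype.card_fin, Nat.descFactorial_self]

lemma fun_count {ι : Type*} [Fintype ι] [DecidableEq ι] {R : ℕ} (Ξ : Finset (ι → Fin R)) (K : Finset ι)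
    (h : ∀ f ∈ Ξ, ∀ g ∈ Ξ, (∀ i, i ∉ K → f i = g i) → f = g) :
    Ξ.card ≤ R ^ (Fintype.card ι - K.card) := by
  classical
  have hinj : Set.InjOn (fun (f : ι → Fin R) (i : {i // i ∉ K}) => f i.1) Ξ := by
    intro f hf g hg hfg
    apply h f hf g hg
    intro i hi
    exact congrFun hfg ⟨i, hi⟩
  calc Ξ.card = (Ξ.image _).card := (card_image_of_injOn hinj).symm
    _ ≤ Fintype.card ({i // i ∉ K} → Fin R) := card_le_univ _
    _ = _ := by
      rw [Fintype.card_fun, Fintype.card_fin, Fintype.card_subtype_compl, Fintype.card_coe]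

lemma factorial_ratio {N d : ℕ} (hd : d ≤ N) :
    ((N - d).factorial : ℝ) * (N:ℝ) ^ d ≤ 4 ^ d * N.factorial := by
  have hstep : ∀ e, e + 1 ≤ N → ((N - e).factorial : ℝ) = (N - e : ℕ) * (N - (e+1)).factorial := by
    intro e he
    have : N - e = (N - (e+1)) + 1 := by omega
    rw [this, Nat.factorial_succ]; push_cast; ring
  by_cases hcase : 4 * d ≤ 3 * N
  · -- increasing part
    have : ∀ e, e ≤ d → ((N - e).factorial : ℝ) * (N:ℝ) ^ e ≤ 4 ^ e * N.factorial := by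
      intro e
      induction e with
      | zero => intro _; simp
      | succ e ih =>
        intro he
        have i1 := ih (by omega)
        rw [hstep e (by omega)] at i1
        have hN : (N:ℝ) ≤ 4 * (N - e : ℕ) := by exact_mod_cast (by omega : N ≤ 4 * (N - e))
        have h0 : (0:ℝ) ≤ ((N - (e+1)).factorial : ℝ) * (N:ℝ)^e := by positivity
        calc _ = (((N - (e+1)).factorial : ℝ) * (N:ℝ)^e) * N := by ring
          _ ≤ (((N - (e+1)).factorial : ℝ) * (N:ℝ)^e) * (4 * (N - e : ℕ)) :=
              mul_le_mul_of_nonneg_left hN h0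
          _ = 4 * (((N - e : ℕ) : ℝ) * (N - (e+1)).factorial * N^e) := by ring
          _ ≤ 4 * (4 ^ e * N.factorial) := by linarith
          _ = _ := by ring
    exact this d le_rfl
  · have hend : ((N:ℝ)) ^ N ≤ 4 ^ N * N.factorial := by
      have := Real.pow_div_factorial_le_exp (N:ℝ) (by positivity) N
      have h2 : Real.exp (N:ℝ) ≤ 4 ^ N := by
        rw [← mul_one (N:ℝ), Real.exp_nat_mul]
        apply pow_le_pow_left₀ (by positivity)
        have := Real.exp_one_lt_d9
        linarith
      rw [div_le_iff₀ (by positivity)] at this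
      exact this.trans (by gcongr)
    -- downwards induction from N
    have : ∀ f, f ≤ N - d → (f.factorial : ℝ) * (N:ℝ) ^ (N - f) ≤ 4 ^ (N - f) * N.factorial := by
      intro f
      induction f with
      | zero => intro _; simpa using hend
      | succ f ih =>
        intro hf
        have i1 := ih (by omega)
        have e1 : N - f = (N - (f+1)) + 1 := by omega
        rw [e1, pow_succ, pow_succ] at i1
        have hN : 4 * ((f:ℝ) + 1) ≤ N := by exact_mod_cast (by omega : 4 * (f + 1) ≤ N)
        have h0 : (0:ℝ) ≤ (f.factorial : ℝ) * (N:ℝ)^(N - (f+1)) := by positivity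
        rw [Nat.factorial_succ]
        push_cast
        have := mul_le_mul_of_nonneg_left hN h0
        nlinarith
    have := this (N - d) le_rfl
    rwa [Nat.sub_sub_self hd] at this

lemma card_le_of_close {K : Finset ℕ} {Q : ℕ} (h : ∀ a ∈ K, ∀ b ∈ K, b ≤ a + Q) :
    K.card ≤ Q + 1 := by
  rcases K.eq_empty_or_nonempty with rfl | hne
  · simp
  · have : K ⊆ Finset.Icc (K.min' hne) (K.min' hne + Q) := by
      intro b hb
      rw [Finset.mem_Icc]
      exact ⟨K.min'_le b hb, h _ (K.min'_mem hne) b hb⟩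
    have := card_le_card this
    rw [Nat.card_Icc] at this
    omega

end CombProof


namespace CombProof
open Finset
set_option linter.unusedSectionVars false

/-- vertex (cycle, root) at spine position `i` -/
def spv {s : ℕ} (ω : Equiv.Perm (Fin s) × (Fin s → Fin s)) (i : Fin s) : Fin s × Fin s :=
  (ω.1.symm i, ω.2 (ω.1.symm i))

lemma spv_injective {s : ℕ} (ω : Equiv.Perm (Fin s) × (Fin s → Fin s)) :
    Function.Injective (spv ω) := by
  intro i j h
  exact ω.1.symm.injective (congrArg Prod.fst h)

lemma spine_count {s : ℕ} (hs : 1 ≤ s) (ω : Equiv.Perm (Fin s) × (Fin s → Fin s))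
    (L : Finset (Fin (s-1))) (t hh : Fin (s-1) → Fin s) (ht : ∀ l, (t l : ℕ) = l)
    (hhh : ∀ l, (hh l : ℕ) = l + 1) :
    (((univ : Finset (Equiv.Perm (Fin s) × (Fin s → Fin s))).filter (fun ω' => ∀ l ∈ L, ∃ l',
      spv ω' (t l') = spv ω (t l) ∧ spv ω' (hh l') = spv ω (hh l))).card : ℝ) ≤
      (univ : Finset (Equiv.Perm (Fin s) × (Fin s → Fin s))).card *
        ((4 / (s:ℝ)^2) ^ L.card * (1 / (s:ℝ)) ^ ((L.image (fun l => spv ω (t l)) ∪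
          L.image (fun l => spv ω (hh l))).card - L.card)) := by
  classical
  set K := L.image (fun l => ω.1.symm (t l)) ∪ L.image (fun l => ω.1.symm (hh l)) with hK
  have htinj : Function.Injective t := by
    intro a b h
    have := ht a; have := ht b
    apply Fin.ext; omega
  have hhinj : Function.Injective hh := by
    intro a b h
    have := hhh a; have := hhh b
    apply Fin.ext; omega
  have hKc : (L.image (fun l => spv ω (t l)) ∪ L.image (fun l => spv ω (hh l))).card = K.card := by
    have : L.image (fun l => spv ω (t l)) ∪ L.image (fun l => spv ω (hh l)) =
        K.image (fun k => (k, ω.2 k)) := by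
      rw [hK, image_union, image_image, image_image]
      rfl
    rw [this, card_image_of_injective]
    intro a b h
    exact congrArg Prod.fst h
  rw [hKc]
  set D := L.image (fun l => ω.1.symm (hh l)) with hD
  have hDc : D.card = L.card := card_image_of_injective _ (ω.1.symm.injective.comp hhinj)
  have hDN : D.card ≤ s := by
    have := card_le_univ D
    simpa using this
  have hDK : D.card ≤ K.card := card_le_card subset_union_right
  have hKN : K.card ≤ s := by
    have := card_le_univ K
    simpa using this
  set PP := (univ : Finset (Equiv.Perm (Fin s))).filter (fun π => ∀ l ∈ L,
    ((π (ω.1.symm (hh l)) : Fin s) : ℕ) = (π (ω.1.symm (t l)) : ℕ) + 1) with hPP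
  set XX := (univ : Finset (Fin s → Fin s)).filter (fun r => ∀ k ∈ K, r k = ω.2 k) with hXX
  have hsub : (univ : Finset (Equiv.Perm (Fin s) × (Fin s → Fin s))).filter (fun ω' => ∀ l ∈ L, ∃ l',
      spv ω' (t l') = spv ω (t l) ∧ spv ω' (hh l') = spv ω (hh l)) ⊆ PP ×ˢ XX := by
    intro ω' h
    simp only [mem_filter, mem_univ, true_and] at h
    simp only [hPP, hXX, mem_product, mem_filter, mem_univ, true_and]
    constructor
    · intro l hl
      obtain ⟨l', h1, h2⟩ := h l hl
      have e1 := congrArg Prod.fst h1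
      have e2 := congrArg Prod.fst h2
      simp only [spv] at e1 e2
      rw [← e1, ← e2, Equiv.apply_symm_apply, Equiv.apply_symm_apply, ht, hhh]
    · intro k hk
      rw [hK, hD, mem_union, mem_image, mem_image] at hk
      rcases hk with ⟨l, hl, rfl⟩ | ⟨l, hl, rfl⟩
      · obtain ⟨l', h1, h2⟩ := h l hl
        have e1 := congrArg Prod.fst h1
        have e2 := congrArg Prod.snd h1
        simp only [spv] at e1 e2
        rw [← e2, ← e1]
      · obtain ⟨l', h2, h1⟩ := h l hl
        have e1 := congrArg Prod.fst h1
        have e2 := congrArg Prod.snd h1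
        simp only [spv] at e1 e2
        rw [← e2, ← e1]
  have c1 : PP.card ≤ (s - L.card).factorial := by
    rw [← hDc]
    apply perm_count
    intro a ha
    obtain ⟨l, hl, rfl⟩ := mem_image.1 ha
    refine Or.inl ⟨ω.1.symm (t l), fun π hπ => ?_⟩
    exact (mem_filter.1 hπ).2 l hl
  have c2 : XX.card ≤ s ^ (s - K.card) := by
    have := fun_count XX K (by
      intro f hf g hg hfg
      ext i
      by_cases hi : i ∈ K
      · rw [(mem_filter.1 hf).2 i hi, (mem_filter.1 hg).2 i hi]
      · rw [hfg i hi])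
    simpa using this
  have hcard := (card_le_card hsub).trans ((card_product PP XX).le.trans (Nat.mul_le_mul c1 c2))
  have htot : (univ : Finset (Equiv.Perm (Fin s) × (Fin s → Fin s))).card = s.factorial * s ^ s := by
    rw [card_univ, Fintype.card_prod, Fintype.card_perm, Fintype.card_fun, Fintype.card_fin]
  rw [htot]
  have hs0 : (0:ℝ) < s := by exact_mod_cast hs
  have hr := factorial_ratio (N := s) (d := L.card) (by omega)
  calc _ ≤ (((s - L.card).factorial * s ^ (s - K.card) : ℕ) : ℝ) := by exact_mod_cast hcard
    _ = (((s - L.card).factorial : ℝ) * (s:ℝ)^L.card) * ((s:ℝ) ^ (s - K.card) / (s:ℝ)^L.card) := by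
        push_cast; field_simp
    _ ≤ (4 ^ L.card * s.factorial) * ((s:ℝ) ^ (s - K.card) / (s:ℝ)^L.card) := by
        apply mul_le_mul_of_nonneg_right hr (by positivity)
    _ = _ := by
        have e1 : (s:ℝ)^s = (s:ℝ)^(s - K.card) * ((s:ℝ)^(K.card - L.card) * (s:ℝ)^(L.card)) := by
          rw [← pow_add, ← pow_add]; congr 1; omega
        push_cast
        rw [e1, div_pow, div_pow, one_pow, ← pow_mul, mul_comm 2, pow_mul]
        field_simp

theorem spine_main {η : ℝ} (hη : 0 < η) : ∃ ρ : ℝ, 0 < ρ ∧ ∀ (s : ℕ) (p : ℝ), 1 ≤ s → 0 < p → p ≤ 1 →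
    32 / ((s:ℝ)^2 * p) ≤ ρ →
    bv univ (fun _ => 1 - (1 - p) ^ 3) (fun W : Finset ((Fin s × Fin s) × (Fin s × Fin s)) =>
      ind (¬ ∃ ω : Equiv.Perm (Fin s) × (Fin s → Fin s), ∀ i j : Fin s, (i:ℕ) + 1 = j →
        (spv ω i, spv ω j) ∈ W)) ≤ η := by
  classical
  obtain ⟨ρ, hρ, h⟩ := links_main 2 hη
  refine ⟨ρ, hρ, ?_⟩
  intro s p hs hp hp1 hle
  have hs0 : (0:ℝ) < s := by exact_mod_cast hs
  let t : Fin (s-1) → Fin s := fun l => ⟨l, by omega⟩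
  let hh : Fin (s-1) → Fin s := fun l => ⟨l + 1, by omega⟩
  have htinj : Function.Injective t := by
    intro a b h
    have : (t a : ℕ) = t b := congrArg Fin.val h
    exact Fin.ext this
  have hhinj : Function.Injective hh := by
    intro a b h
    have : (hh a : ℕ) = hh b := congrArg Fin.val h
    have : (a:ℕ) + 1 = b + 1 := this
    apply Fin.ext; omega
  have h8 : 2 * (4 / (s:ℝ)^2) / p = 8 / ((s:ℝ)^2 * p) := by field_simp; norm_num
  have := h (Fin s × Fin s) (Equiv.Perm (Fin s) × (Fin s → Fin s)) (Fin (s-1)) univ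
    (fun ω l => spv ω (t l)) (fun ω l => spv ω (hh l)) (4 / (s:ℝ)^2) p s
    ⟨(1, id), mem_univ _⟩ (fun ω _ => (spv_injective ω).comp htinj)
    (fun ω _ => (spv_injective ω).comp hhinj)
    (fun ω _ L => by
      have := spine_count hs ω L t hh (fun _ => rfl) (fun _ => rfl)
      convert this)
    (by positivity) hp hp1 hs
    (by
      refine le_trans ?_ hle
      rw [h8]
      gcongr
      norm_num)
    (by
      refine le_trans (le_of_eq ?_) hle
      rw [h8]
      simp only [Fintype.card_prod, Fintype.card_fin]
      push_cast
      field_simp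
      norm_num)
    (by simp [pow_two])
  refine le_trans ?_ this
  have q0 : 0 ≤ (1 - p)^3 := by apply pow_nonneg; linarith
  have q1 : (1 - p)^3 ≤ 1 := pow_le_one₀ (by linarith) (by linarith)
  apply bv_mono (fun _ => by show 0 ≤ 1 - (1 - p)^3; linarith) (fun _ => by
    show 1 - (1 - p)^3 ≤ 1; linarith)
  intro W _
  apply ind_mono
  rintro h1 ⟨ω, -, hω⟩
  apply h1
  refine ⟨ω, fun i j hij => ?_⟩
  have := hω ⟨i, by omega⟩
  have e1 : t ⟨i, by omega⟩ = i := rfl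
  have e2 : hh ⟨i, by omega⟩ = j := by apply Fin.ext; exact hij
  rwa [e1, e2] at this

end CombProof


namespace CombProof
open Finset
set_option linter.unusedSectionVars false

/-- numeric side conditions of the teeth construction -/
structure Par (s m A h : ℕ) : Prop where
  hm : 1 ≤ m
  hA : m ≤ A
  hh : 1 ≤ h
  hs : 3 * A + 6 * h * m < s

/-- random data -/
abbrev Om (s m A h : ℕ) : Type :=
  Equiv.Perm (Fin (2*s*h)) × (Fin (2*s*h+1) → Fin m) × (Fin s → Fin A)

section defs
variable {s m A h : ℕ}

def rr (ω : Om s m A h) (j : ℕ) : ℤ := if hj : j < 2*s*h+1 then ((ω.2.1 ⟨j, hj⟩ : ℕ) : ℤ) else 0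
def xi (ω : Om s m A h) (k : ℕ) : ℤ := if hk : k < s then ((ω.2.2 ⟨k, hk⟩ : ℕ) : ℤ) else 0
def pin (ω : Om s m A h) (p : ℕ) : ℕ := if hp : p < 2*s*h then (ω.1.symm ⟨p, hp⟩ : ℕ) else p
def yb (ω : Om s m A h) (j : ℕ) : ℤ := 1 + s * A + 2 * m * j + rr ω j
def xb (ω : Om s m A h) (k : ℕ) : ℤ := if k < s then 1 + k * A + xi ω k else yb ω 0
def yl (ω : Om s m A h) (j : ℕ) : ℤ := yb ω (j+1) - yb ω j
def RS (ω : Om s m A h) (k : ℕ) : ℤ := ∑ p ∈ range (2*h*k), yl ω (pin ω p)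
def zb (ω : Om s m A h) (k : ℕ) : ℤ := yb ω (2*s*h) + k * s - (xb ω k - xb ω 0) - RS ω k
/-- boundaries -/
def bd (ω : Om s m A h) (i : ℕ) : ℤ :=
  if i < s then xb ω i else if i ≤ s + 2*s*h then yb ω (i - s) else zb ω (i - s - 2*s*h)

lemma rr_nonneg (ω : Om s m A h) (j : ℕ) : 0 ≤ rr ω j := by
  unfold rr; split_ifs <;> positivity

lemma rr_lt (hP : Par s m A h) (ω : Om s m A h) (j : ℕ) : rr ω j < m := by
  unfold rr; split_ifs with hj
  · exact_mod_cast (ω.2.1 ⟨j, hj⟩).2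
  · have := hP.hm; exact_mod_cast this

lemma xi_nonneg (ω : Om s m A h) (j : ℕ) : 0 ≤ xi ω j := by
  unfold xi; split_ifs <;> positivity

lemma xi_lt (hP : Par s m A h) (ω : Om s m A h) (j : ℕ) : xi ω j < A := by
  unfold xi; split_ifs with hj
  · exact_mod_cast (ω.2.2 ⟨j, hj⟩).2
  · have := hP.hm; have := hP.hA; exact_mod_cast (by omega)

lemma bd_x (ω : Om s m A h) {i : ℕ} (hi : i ≤ s) : bd ω i = xb ω i := by
  unfold bd
  by_cases h1 : i < s
  · rw [if_pos h1]
  · have : i = s := by omega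
    subst this
    rw [if_neg h1, if_pos (by omega), xb, if_neg h1]; simp

lemma bd_y (ω : Om s m A h) {j : ℕ} (hj : j ≤ 2*s*h) : bd ω (s + j) = yb ω j := by
  unfold bd
  rw [if_neg (by omega), if_pos (by omega)]; simp

lemma RS_zero (ω : Om s m A h) : RS ω 0 = 0 := by simp [RS]

lemma bd_z (ω : Om s m A h) (k : ℕ) : bd ω (s + 2*s*h + k) = zb ω k := by
  unfold bd
  rw [if_neg (by omega)]
  by_cases hk : k = 0
  · subst hk
    rw [if_pos (by omega)]
    simp [zb, RS_zero]
  · rw [if_neg (by omega)]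
    congr 1; omega

lemma yl_eq (ω : Om s m A h) (j : ℕ) : yl ω j = 2 * m + rr ω (j+1) - rr ω j := by
  unfold yl yb; push_cast; ring

lemma yl_pos (hP : Par s m A h) (ω : Om s m A h) (j : ℕ) : 0 < yl ω j := by
  rw [yl_eq]
  have := rr_nonneg ω (j+1); have := rr_lt hP ω j; have := hP.hm
  linarith

lemma yl_le (hP : Par s m A h) (ω : Om s m A h) (j : ℕ) : yl ω j ≤ 3 * m := by
  rw [yl_eq]
  have := rr_nonneg ω j; have := rr_lt hP ω (j+1)
  linarith

lemma xb_step (hP : Par s m A h) (ω : Om s m A h) {k : ℕ} (hk : k < s) :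
    0 < xb ω (k+1) - xb ω k ∧ xb ω (k+1) - xb ω k ≤ 2 * A := by
  have h1 := xi_nonneg ω k; have h2 := xi_lt hP ω k
  have hA : (m:ℤ) ≤ A := by exact_mod_cast hP.hA
  unfold xb
  rw [if_pos hk]
  split_ifs with h
  · have h3 := xi_nonneg ω (k+1); have h4 := xi_lt hP ω (k+1)
    push_cast
    constructor <;> linarith
  · have h3 := rr_nonneg ω 0; have h4 := rr_lt hP ω 0
    have e : s = k + 1 := by omega
    have e' : (s:ℤ) = k + 1 := by exact_mod_cast e
    unfold yb
    rw [e']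
    push_cast
    constructor <;> linarith

lemma RS_step (ω : Om s m A h) (k : ℕ) :
    RS ω (k+1) - RS ω k = ∑ p ∈ range (2*h), yl ω (pin ω (2*h*k+p)) := by
  unfold RS
  rw [show 2*h*(k+1) = 2*h*k + 2*h by ring, sum_range_add]; ring

lemma zb_step_eq (ω : Om s m A h) (k : ℕ) :
    zb ω (k+1) - zb ω k = s - (xb ω (k+1) - xb ω k) - (RS ω (k+1) - RS ω k) := by
  unfold zb; push_cast; ring

lemma zb_step (hP : Par s m A h) (ω : Om s m A h) {k : ℕ} (hk : k < s) :
    (A:ℤ) < zb ω (k+1) - zb ω k := by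
  rw [zb_step_eq, RS_step]
  have h1 := (xb_step hP ω hk).2
  have h2 : ∑ p ∈ range (2*h), yl ω (pin ω (2*h*k+p)) ≤ 2 * h * (3 * m) := by
    calc _ ≤ ∑ p ∈ range (2*h), (3 * m : ℤ) := sum_le_sum fun p _ => yl_le hP ω _
      _ = _ := by rw [sum_const, card_range]; simp
  have h3 : (3 * A + 6 * h * m : ℤ) < s := by exact_mod_cast hP.hs
  nlinarith

lemma pin_lt (ω : Om s m A h) {p : ℕ} (hp : p < 2*s*h) : pin ω p < 2*s*h := by
  unfold pin; rw [dif_pos hp]; exact (ω.1.symm ⟨p, hp⟩).2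

lemma pin_inj (ω : Om s m A h) {p q : ℕ} (hp : p < 2*s*h) (hq : q < 2*s*h)
    (h' : pin ω p = pin ω q) : p = q := by
  unfold pin at h'; rw [dif_pos hp, dif_pos hq] at h'
  have := ω.1.symm.injective (Fin.ext h')
  exact congrArg Fin.val this

lemma pin_surj (ω : Om s m A h) {j : ℕ} (hj : j < 2*s*h) : ∃ p, p < 2*s*h ∧ pin ω p = j := by
  refine ⟨ω.1 ⟨j, hj⟩, (ω.1 ⟨j, hj⟩).2, ?_⟩
  unfold pin; rw [dif_pos (ω.1 ⟨j, hj⟩).2]; simp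

lemma sum_pin (ω : Om s m A h) (F : ℕ → ℤ) :
    ∑ p ∈ range (2*s*h), F (pin ω p) = ∑ j ∈ range (2*s*h), F j := by
  rw [← Fin.sum_univ_eq_sum_range (fun p => F (pin ω p)), ← Fin.sum_univ_eq_sum_range F]
  rw [← Equiv.sum_comp ω.1.symm (fun j : Fin (2*s*h) => F j)]
  apply sum_congr rfl
  intro p _
  congr 1
  unfold pin; rw [dif_pos p.2]

lemma RS_last (ω : Om s m A h) : RS ω s = yb ω (2*s*h) - yb ω 0 := by
  unfold RS
  rw [show 2*h*s = 2*s*h by ring, sum_pin ω (yl ω)]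
  unfold yl
  rw [sum_range_sub (yb ω)]

lemma zb_last (ω : Om s m A h) : zb ω s = s * s + xb ω 0 := by
  unfold zb
  have : xb ω s = yb ω 0 := by unfold xb; simp
  rw [RS_last, this]; ring

lemma bd_last (ω : Om s m A h) : bd ω (s + 2*s*h + s) = s * s + bd ω 0 := by
  rw [bd_z, zb_last, bd_x ω (Nat.zero_le _)]

lemma bd_step (hP : Par s m A h) (ω : Om s m A h) {i : ℕ} (hi : i < s + 2*s*h + s) :
    bd ω i < bd ω (i+1) := by
  by_cases h1 : i < s
  · rw [bd_x ω h1.le, bd_x ω h1]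
    have := (xb_step hP ω h1).1; linarith
  · by_cases h2 : i < s + 2*s*h
    · obtain ⟨j, rfl⟩ : ∃ j, i = s + j := ⟨i - s, by omega⟩
      rw [add_assoc, bd_y ω (by omega), bd_y ω (by omega)]
      have := yl_pos hP ω j
      unfold yl at this; linarith
    · obtain ⟨k, rfl⟩ : ∃ k, i = s + 2*s*h + k := ⟨i - s - 2*s*h, by omega⟩
      rw [add_assoc _ k 1, bd_z, bd_z]
      have := zb_step hP ω (k := k) (by omega)
      have : (0:ℤ) ≤ A := by positivity
      linarith

lemma bd_lt (hP : Par s m A h) (ω : Om s m A h) {i j : ℕ} (hij : i < j) (hj : j ≤ s + 2*s*h + s) :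
    bd ω i < bd ω j := by
  obtain ⟨d, rfl⟩ : ∃ d, j = i + 1 + d := ⟨j - i - 1, by omega⟩
  clear hij
  induction d with
  | zero => exact bd_step hP ω (by omega)
  | succ d ih =>
    exact (ih (by omega)).trans (bd_step hP ω (by omega))

lemma bd_le (hP : Par s m A h) (ω : Om s m A h) {i j : ℕ} (hij : i ≤ j) (hj : j ≤ s + 2*s*h + s) :
    bd ω i ≤ bd ω j := by
  rcases hij.eq_or_lt with rfl | h1
  · exact le_rfl
  · exact (bd_lt hP ω h1 hj).le

lemma s_pos (hP : Par s m A h) : 0 < s := by have := hP.hs; omega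

lemma bd_pos (hP : Par s m A h) (ω : Om s m A h) {i : ℕ} (hi : i ≤ s + 2*s*h + s) : 1 ≤ bd ω i := by
  have := bd_le hP ω (Nat.zero_le i) hi
  rw [bd_x ω (Nat.zero_le _)] at this
  have h2 : 1 ≤ xb ω 0 := by
    unfold xb; rw [if_pos (s_pos hP)]
    have := xi_nonneg ω 0
    push_cast; linarith
  linarith

lemma bd_lt_n (hP : Par s m A h) (ω : Om s m A h) {i : ℕ} (hi : i < s + 2*s*h + s) :
    bd ω i < s * s := by
  have h0 := s_pos hP
  have h1 := bd_le hP ω (i := i) (j := s + 2*s*h + (s-1)) (by omega) (by omega)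
  rw [bd_z] at h1
  have h2 := zb_step hP ω (k := s - 1) (by omega)
  rw [Nat.sub_add_cancel h0, zb_last] at h2
  have h3 : xb ω 0 ≤ A := by
    unfold xb; rw [if_pos h0]
    have := xi_lt hP ω 0
    push_cast; linarith
  linarith

lemma bd_inj (hP : Par s m A h) (ω : Om s m A h) {i j : ℕ} (hi : i < s + 2*s*h + s)
    (hj : j < s + 2*s*h + s) (h' : bd ω i = bd ω j) : i = j := by
  rcases lt_trichotomy i j with h1 | h1 | h1
  · have := bd_lt hP ω h1 hj.le; omega
  · exact h1
  · have := bd_lt hP ω h1 hi.le; omega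

/-! pieces and links -/
def fl (β : ℕ) : ℕ := if β % 2 = 0 then β + 1 else β - 1
def sp (s h : ℕ) (β : ℕ) : ℕ := if β % 2 = 0 then β / 2 else s + 2*s*h + β / 2
def hd (ω : Om s m A h) (β i : ℕ) : ℕ := if i < h then s + pin ω (β*h+i) else sp s h (fl β)
def tl (ω : Om s m A h) (β i : ℕ) : ℕ := if i = 0 then sp s h β else s + pin ω (β*h+(i-1))
/-- end boundary index of a piece -/
def nxb (s h : ℕ) (i : ℕ) : ℕ := if i + 1 < s + 2*s*h + s then i + 1 else 0

lemma pos_lt {β i : ℕ} (hβ : β < 2*s) (hi : i < h) : β*h+i < 2*s*h := by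
  calc β*h+i < β*h+h := by omega
    _ = (β+1)*h := by ring
    _ ≤ 2*s*h := Nat.mul_le_mul_right _ hβ

lemma pos_inj {β i β' i' : ℕ} (hi : i < h) (hi' : i' < h) (e : β*h+i = β'*h+i') :
    β = β' ∧ i = i' := by
  have h1 : (β*h+i) / h = β := by
    rw [mul_comm, Nat.mul_add_div (by omega), Nat.div_eq_of_lt hi, add_zero]
  have h2 : (β'*h+i') / h = β' := by
    rw [mul_comm, Nat.mul_add_div (by omega), Nat.div_eq_of_lt hi', add_zero]
  have : β = β' := by rw [← h1, e, h2]
  subst this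
  exact ⟨rfl, by omega⟩

lemma fl_lt {β : ℕ} (hβ : β < 2*s) : fl β < 2*s := by unfold fl; split_ifs <;> omega
lemma fl_inj {β β' : ℕ} (e : fl β = fl β') : β = β' := by
  unfold fl at e; split_ifs at e <;> omega
lemma fl_fl (β : ℕ) : fl (fl β) = β := by
  unfold fl; split_ifs <;> omega

lemma sp_lt {β : ℕ} (hβ : β < 2*s) : sp s h β < s + 2*s*h + s := by unfold sp; split_ifs <;> omega
lemma sp_inj {β β' : ℕ} (hβ : β < 2*s) (hβ' : β' < 2*s) (e : sp s h β = sp s h β') : β = β' := by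
  unfold sp at e; split_ifs at e <;> omega
lemma sp_ne {β j : ℕ} (hβ : β < 2*s) (hj : j < 2*s*h) : sp s h β ≠ s + j := by
  unfold sp; split_ifs <;> omega

lemma hd_lt (ω : Om s m A h) {β i : ℕ} (hβ : β < 2*s) : hd ω β i < s + 2*s*h + s := by
  unfold hd; split_ifs with hi
  · have := pin_lt ω (pos_lt hβ hi); omega
  · exact sp_lt (fl_lt hβ)

lemma tl_lt (ω : Om s m A h) {β i : ℕ} (hβ : β < 2*s) (hi : i ≤ h) : tl ω β i < s + 2*s*h + s := by
  unfold tl; split_ifs with h0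
  · exact sp_lt hβ
  · have := pin_lt ω (pos_lt hβ (show i - 1 < h by omega)); omega

lemma hd_inj (ω : Om s m A h) {β i β' i' : ℕ} (hβ : β < 2*s) (hi : i ≤ h)
    (hβ' : β' < 2*s) (hi' : i' ≤ h) (e : hd ω β i = hd ω β' i') : β = β' ∧ i = i' := by
  unfold hd at e
  split_ifs at e with h1 h2 h2
  · exact pos_inj h1 h2 (pin_inj ω (pos_lt hβ h1) (pos_lt hβ' h2) (by omega))
  · exact absurd e.symm (sp_ne (fl_lt hβ') (pin_lt ω (pos_lt hβ h1)))
  · exact absurd e (sp_ne (fl_lt hβ) (pin_lt ω (pos_lt hβ' h2)))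
  · exact ⟨fl_inj (sp_inj (fl_lt hβ) (fl_lt hβ') e), by omega⟩

lemma tl_inj (ω : Om s m A h) {β i β' i' : ℕ} (hβ : β < 2*s) (hi : i ≤ h)
    (hβ' : β' < 2*s) (hi' : i' ≤ h) (e : tl ω β i = tl ω β' i') : β = β' ∧ i = i' := by
  unfold tl at e
  split_ifs at e with h1 h2 h2
  · exact ⟨sp_inj hβ hβ' e, by omega⟩
  · exact absurd e (sp_ne hβ (pin_lt ω (pos_lt hβ' (show i' - 1 < h by omega))))
  · exact absurd e.symm (sp_ne hβ' (pin_lt ω (pos_lt hβ (show i - 1 < h by omega))))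
  · have := pos_inj (show i - 1 < h by omega) (show i' - 1 < h by omega)
      (pin_inj ω (pos_lt hβ (by omega)) (pos_lt hβ' (by omega)) (by omega))
    exact ⟨this.1, by omega⟩

lemma nxb_lt (hP : Par s m A h) (i : ℕ) : nxb s h i < s + 2*s*h + s := by
  have := s_pos hP
  unfold nxb; split_ifs <;> omega

lemma nxb_inj {i j : ℕ} (hi : i < s + 2*s*h + s) (hj : j < s + 2*s*h + s)
    (e : nxb s h i = nxb s h j) : i = j := by
  unfold nxb at e; split_ifs at e <;> omega

lemma bd_nxb (ω : Om s m A h) {i : ℕ} (hi : i < s + 2*s*h + s) :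
    ((bd ω (nxb s h i) : ℤ) : ZMod (s*s)) = ((bd ω (i+1) : ℤ) : ZMod (s*s)) := by
  unfold nxb; split_ifs with h1
  · rfl
  · have : i + 1 = s + 2*s*h + s := by omega
    rw [this, bd_last]
    push_cast
    have : ((s:ZMod (s*s)) * (s:ZMod (s*s))) = 0 := by
      rw [← Nat.cast_mul, ZMod.natCast_self]
    rw [this, zero_add]

/-- tails and heads of links, as labels -/
def TT (ω : Om s m A h) (l : Fin (2*s) × Fin (h+1)) : ZMod (s*s) :=
  ((bd ω (nxb s h (tl ω l.1 l.2)) : ℤ) : ZMod (s*s))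
def HH (ω : Om s m A h) (l : Fin (2*s) × Fin (h+1)) : ZMod (s*s) :=
  ((bd ω (hd ω l.1 l.2) : ℤ) : ZMod (s*s))

lemma zcast_inj {a b : ℤ} (ha : 0 ≤ a) (ha' : a < s*s) (hb : 0 ≤ b) (hb' : b < s*s)
    (e : (a : ZMod (s*s)) = (b : ZMod (s*s))) : a = b := by
  rw [ZMod.intCast_eq_intCast_iff] at e
  unfold Int.ModEq at e
  push_cast at e
  rwa [Int.emod_eq_of_lt ha ha', Int.emod_eq_of_lt hb hb'] at e

lemma bd_cast_inj (hP : Par s m A h) (ω ω' : Om s m A h) {i j : ℕ} (hi : i < s + 2*s*h + s)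
    (hj : j < s + 2*s*h + s)
    (e : ((bd ω i : ℤ) : ZMod (s*s)) = ((bd ω' j : ℤ) : ZMod (s*s))) : bd ω i = bd ω' j := by
  apply zcast_inj _ (bd_lt_n hP ω hi) _ (bd_lt_n hP ω' hj) e
  · have := bd_pos hP ω hi.le; omega
  · have := bd_pos hP ω' hj.le; omega

lemma HH_injective (hP : Par s m A h) (ω : Om s m A h) : Function.Injective (HH ω) := by
  intro l l' e
  have h1 := bd_inj hP ω (hd_lt ω l.1.2) (hd_lt ω l'.1.2)
    (bd_cast_inj hP ω ω (hd_lt ω l.1.2) (hd_lt ω l'.1.2) e)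
  have h2 := hd_inj ω l.1.2 (Nat.lt_succ_iff.1 l.2.2) l'.1.2 (Nat.lt_succ_iff.1 l'.2.2) h1
  exact Prod.ext (Fin.ext h2.1) (Fin.ext h2.2)

lemma TT_injective (hP : Par s m A h) (ω : Om s m A h) : Function.Injective (TT ω) := by
  intro l l' e
  have h1 := bd_inj hP ω (nxb_lt hP _) (nxb_lt hP _)
    (bd_cast_inj hP ω ω (nxb_lt hP _) (nxb_lt hP _) e)
  have h0 := nxb_inj (tl_lt ω l.1.2 (Nat.lt_succ_iff.1 l.2.2))
    (tl_lt ω l'.1.2 (Nat.lt_succ_iff.1 l'.2.2)) h1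
  have h2 := tl_inj ω l.1.2 (Nat.lt_succ_iff.1 l.2.2) l'.1.2 (Nat.lt_succ_iff.1 l'.2.2) h0
  exact Prod.ext (Fin.ext h2.1) (Fin.ext h2.2)

end defs
end CombProof


namespace CombProof
open Finset
set_option linter.unusedSectionVars false

section cyc
variable {s m A h : ℕ}

/-- piece length -/
def pl (ω : Om s m A h) (i : ℕ) : ℕ := (bd ω (i+1) - bd ω i).toNat

lemma pl_cast (hP : Par s m A h) (ω : Om s m A h) {i : ℕ} (hi : i < s + 2*s*h + s) :
    (pl ω i : ℤ) = bd ω (i+1) - bd ω i := by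
  unfold pl
  have := bd_step hP ω hi
  omega

lemma pl_pos (hP : Par s m A h) (ω : Om s m A h) {i : ℕ} (hi : i < s + 2*s*h + s) :
    0 < pl ω i := by
  have := bd_step hP ω hi
  have := pl_cast hP ω hi
  omega

open Classical in
/-- successor function of the cycle factor -/
noncomputable def sf (ω : Om s m A h) (v : ZMod (s*s)) : ZMod (s*s) :=
  if hx : ∃ l, v + 1 = TT ω l then HH ω hx.choose else v + 1

lemma sf_of (hP : Par s m A h) (ω : Om s m A h) {v : ZMod (s*s)} (l) (e : v + 1 = TT ω l) :
    sf ω v = HH ω l := by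
  have hx : ∃ l, v + 1 = TT ω l := ⟨l, e⟩
  unfold sf
  rw [dif_pos hx]
  congr 1
  apply TT_injective hP ω
  rw [← hx.choose_spec, e]

lemma sf_not (ω : Om s m A h) {v : ZMod (s*s)} (e : ∀ l, v + 1 ≠ TT ω l) :
    sf ω v = v + 1 := by
  unfold sf
  rw [dif_neg (by rintro ⟨l, hl⟩; exact e l hl)]

lemma ss_cast : ((s:ZMod (s*s)) * (s:ZMod (s*s))) = 0 := by
  rw [← Nat.cast_mul, ZMod.natCast_self]

lemma interior (hP : Par s m A h) (ω : Om s m A h) {i a j : ℕ} (hi : i < s + 2*s*h + s)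
    (ha : 0 < a) (ha' : a < pl ω i) (hj : j < s + 2*s*h + s) :
    ((bd ω i : ℤ) : ZMod (s*s)) + (a : ZMod (s*s)) ≠ ((bd ω j : ℤ) : ZMod (s*s)) := by
  intro e
  have hl := pl_cast hP ω hi
  have h1 := bd_le hP ω (i := i+1) (j := s + 2*s*h + s) hi le_rfl
  rw [bd_last] at h1
  have hb0 := bd_pos hP ω (i := i) hi.le
  have hbj := bd_pos hP ω (i := j) hj.le
  have hjn := bd_lt_n hP ω hj
  by_cases hc : bd ω i + a < s * s
  · have e2 : bd ω i + a = bd ω j := by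
      apply zcast_inj (by omega) hc (by omega) hjn
      push_cast; exact e
    rcases lt_trichotomy i j with h2 | h2 | h2
    · have := bd_le hP ω (i := i+1) (j := j) h2 hj.le; omega
    · subst h2; omega
    · have := bd_lt hP ω h2 hi.le; omega
  · have hb := bd_le hP ω (Nat.zero_le j) hj.le
    have h0n := bd_lt_n hP ω (i := 0) (by omega)
    have e2 : bd ω i + a - s * s = bd ω j := by
      apply zcast_inj (by omega) (by omega) (by omega) hjn
      push_cast; rw [ss_cast, sub_zero]; exact e
    omega

lemma iter_int (hP : Par s m A h) (ω : Om s m A h) {i a : ℕ} (hi : i < s + 2*s*h + s)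
    (ha : a < pl ω i) :
    (sf ω)^[a] ((bd ω i : ℤ) : ZMod (s*s)) = ((bd ω i : ℤ) : ZMod (s*s)) + (a : ZMod (s*s)) := by
  induction a with
  | zero => simp
  | succ a ih =>
    rw [Function.iterate_succ_apply', ih (by omega), sf_not]
    · push_cast; ring
    · intro l
      have := interior hP ω hi (Nat.succ_pos a) ha (nxb_lt hP (tl ω l.1 l.2))
      rw [add_assoc]
      push_cast at this
      exact this

lemma iter_end (hP : Par s m A h) (ω : Om s m A h) (l : Fin (2*s) × Fin (h+1)) :
    (sf ω)^[pl ω (tl ω l.1 l.2)] ((bd ω (tl ω l.1 l.2) : ℤ) : ZMod (s*s)) = HH ω l := by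
  have hi := tl_lt ω l.1.2 (Nat.lt_succ_iff.1 l.2.2)
  have h0 := pl_pos hP ω hi
  obtain ⟨a, ha⟩ : ∃ a, pl ω (tl ω l.1 l.2) = a + 1 := ⟨_, (Nat.succ_pred_eq_of_pos h0).symm⟩
  rw [ha, Function.iterate_succ_apply', iter_int hP ω hi (by omega)]
  apply sf_of hP
  unfold TT
  rw [bd_nxb ω hi]
  have h2 := pl_cast hP ω hi
  rw [ha] at h2
  have : bd ω (tl ω l.1 l.2 + 1) = bd ω (tl ω l.1 l.2) + a + 1 := by push_cast at h2; linarith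
  rw [this]; push_cast; ring

/-- partial length in block -/
def bl (ω : Om s m A h) (β j : ℕ) : ℕ := ∑ q ∈ range j, pl ω (tl ω β q)

lemma hd_tl (ω : Om s m A h) {β i : ℕ} (hi : i < h) : hd ω β i = tl ω β (i+1) := by
  unfold hd tl; rw [if_pos hi, if_neg (by omega)]; simp

lemma tl_zero (ω : Om s m A h) (β : ℕ) : tl ω β 0 = sp s h β := by simp [tl]

lemma iter_bl (hP : Par s m A h) (ω : Om s m A h) {β j : ℕ} (hβ : β < 2*s) (hj : j ≤ h) :
    (sf ω)^[bl ω β j] ((bd ω (sp s h β) : ℤ) : ZMod (s*s)) = ((bd ω (tl ω β j) : ℤ) : ZMod (s*s)) := by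
  induction j with
  | zero => simp [bl, tl_zero]
  | succ j ih =>
    have e := iter_end hP ω (⟨β, hβ⟩, ⟨j, by omega⟩)
    have : bl ω β (j+1) = pl ω (tl ω β j) + bl ω β j := by
      unfold bl; rw [sum_range_succ, add_comm]
    rw [this, Function.iterate_add_apply, ih (by omega)]
    simp only at e
    rw [e]; unfold HH; simp only
    rw [hd_tl ω (by omega)]

lemma iter_block (hP : Par s m A h) (ω : Om s m A h) {β : ℕ} (hβ : β < 2*s) :
    (sf ω)^[bl ω β (h+1)] ((bd ω (sp s h β) : ℤ) : ZMod (s*s))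
      = ((bd ω (sp s h (fl β)) : ℤ) : ZMod (s*s)) := by
  have e := iter_end hP ω (⟨β, hβ⟩, ⟨h, by omega⟩)
  have : bl ω β (h+1) = pl ω (tl ω β h) + bl ω β h := by
    unfold bl; rw [sum_range_succ, add_comm]
  rw [this, Function.iterate_add_apply, iter_bl hP ω hβ le_rfl]
  simp only at e
  rw [e]; unfold HH; simp only
  unfold hd; simp

lemma bl_cast (hP : Par s m A h) (ω : Om s m A h) {β : ℕ} (hβ : β < 2*s) :
    (bl ω β (h+1) : ℤ) = (bd ω (sp s h β + 1) - bd ω (sp s h β)) +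
      ∑ q ∈ range h, yl ω (pin ω (β*h+q)) := by
  unfold bl
  rw [sum_range_succ', tl_zero, add_comm]
  push_cast
  rw [pl_cast hP ω (sp_lt hβ)]
  congr 1
  apply sum_congr rfl
  intro q hq
  rw [mem_range] at hq
  rw [pl_cast hP ω (tl_lt ω hβ (by omega))]
  have hp := pin_lt ω (pos_lt hβ hq)
  have : tl ω β (q+1) = s + pin ω (β*h+q) := by unfold tl; simp
  rw [this, add_assoc, bd_y ω hp, bd_y ω hp.le]; rfl

lemma block_total (hP : Par s m A h) (ω : Om s m A h) {k : ℕ} (hk : k < s) :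
    bl ω (2*k) (h+1) + bl ω (2*k+1) (h+1) = s := by
  have h1 := bl_cast hP ω (β := 2*k) (by omega)
  have h2 := bl_cast hP ω (β := 2*k+1) (by omega)
  have e1 : sp s h (2*k) = k := by unfold sp; rw [if_pos (by omega)]; omega
  have e2 : sp s h (2*k+1) = s + 2*s*h + k := by
    unfold sp; rw [if_neg (by omega)]; omega
  rw [e1, bd_x ω hk, bd_x ω hk.le] at h1
  rw [e2, add_assoc _ k 1, bd_z, bd_z, zb_step_eq, RS_step, two_mul h, sum_range_add] at h2
  have s1 : ∑ x ∈ range h, yl ω (pin ω ((h+h) * k + x)) = ∑ q ∈ range h, yl ω (pin ω (2*k*h+q)) := by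
    apply sum_congr rfl; intro q _; congr 2; ring
  have s2 : ∑ x ∈ range h, yl ω (pin ω ((h+h) * k + (h + x))) = ∑ q ∈ range h, yl ω (pin ω ((2*k+1)*h+q)) := by
    apply sum_congr rfl; intro q _; congr 2; ring
  rw [s1, s2] at h2
  zify
  linarith

lemma iter_cycle (hP : Par s m A h) (ω : Om s m A h) {k : ℕ} (hk : k < s) :
    (sf ω)^[s] ((bd ω k : ℤ) : ZMod (s*s)) = ((bd ω k : ℤ) : ZMod (s*s)) := by
  have e1 : sp s h (2*k) = k := by unfold sp; rw [if_pos (by omega)]; omega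
  have e3 : fl (2*k) = 2*k+1 := by unfold fl; rw [if_pos (by omega)]
  have e4 : fl (2*k+1) = 2*k := by unfold fl; rw [if_neg (by omega)]; omega
  have h1 := iter_block hP ω (β := 2*k) (by omega)
  have h2 := iter_block hP ω (β := 2*k+1) (by omega)
  rw [e3, e1] at h1
  rw [e4, e1] at h2
  calc _ = (sf ω)^[bl ω (2*k+1) (h+1) + bl ω (2*k) (h+1)] ((bd ω k : ℤ) : ZMod (s*s)) := by
        rw [add_comm, block_total hP ω hk]
    _ = _ := by rw [Function.iterate_add_apply, h1, h2]

lemma cover (hP : Par s m A h) (ω : Om s m A h) (v : ZMod (s*s)) :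
    ∃ i < s + 2*s*h + s, ∃ a < pl ω i, v = ((bd ω i : ℤ) : ZMod (s*s)) + (a : ZMod (s*s)) := by
  have hs := s_pos hP
  have : NeZero (s*s) := ⟨by positivity⟩
  have hv : ((v.val : ℤ) : ZMod (s*s)) = v := by simp
  have hvl : (v.val : ℤ) < s * s := by exact_mod_cast v.val_lt
  obtain ⟨u, hu0, hu1, hu⟩ : ∃ u : ℤ, bd ω 0 ≤ u ∧ u < s * s + bd ω 0 ∧ (u : ZMod (s*s)) = v := by
    have h0 := bd_pos hP ω (i := 0) (by omega)
    have h1 := bd_lt_n hP ω (i := 0) (by omega)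
    by_cases hc : bd ω 0 ≤ v.val
    · exact ⟨v.val, hc, by omega, hv⟩
    · exact ⟨v.val + s*s, by omega, by omega, by push_cast; rw [ss_cast, add_zero]; simp⟩
  have hex : ∃ i, i < s + 2*s*h + s ∧ bd ω i ≤ u ∧ u < bd ω (i+1) := by
    have hx : ∃ i, u < bd ω i := ⟨s + 2*s*h + s, by rw [bd_last]; exact hu1⟩
    have h1 := Nat.find_spec hx
    have h2 : Nat.find hx ≤ s + 2*s*h + s := Nat.find_min' hx (by rw [bd_last]; exact hu1)
    have h3 : Nat.find hx ≠ 0 := by intro h0; rw [h0] at h1; omega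
    refine ⟨Nat.find hx - 1, by omega, ?_, ?_⟩
    · have := Nat.find_min hx (m := Nat.find hx - 1) (by omega)
      omega
    · rw [Nat.sub_add_cancel (by omega)]; exact h1
  obtain ⟨i, hi, h1, h2⟩ := hex
  refine ⟨i, hi, (u - bd ω i).toNat, ?_, ?_⟩
  · have := pl_cast hP ω hi; omega
  · have : u = bd ω i + ((u - bd ω i).toNat : ℤ) := by omega
    rw [← hu]
    conv_lhs => rw [this]
    push_cast; rfl

lemma tl_surj (hP : Par s m A h) (ω : Om s m A h) {i : ℕ} (hi : i < s + 2*s*h + s) :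
    ∃ β < 2*s, ∃ j ≤ h, tl ω β j = i := by
  have hh := hP.hh
  by_cases h1 : i < s
  · refine ⟨2*i, by omega, 0, by omega, ?_⟩
    rw [tl_zero]; unfold sp; rw [if_pos (by omega)]; omega
  · by_cases h2 : i < s + 2*s*h
    · obtain ⟨p, hp, hpe⟩ := pin_surj ω (j := i - s) (by omega)
      refine ⟨p / h, ?_, p % h + 1, ?_, ?_⟩
      · exact Nat.div_lt_of_lt_mul (by rw [mul_comm]; exact hp)
      · exact Nat.mod_lt _ hh
      · unfold tl; rw [if_neg (by omega)]
        simp only [Nat.add_sub_cancel]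
        rw [mul_comm, Nat.div_add_mod, hpe]; omega
    · refine ⟨2*(i - s - 2*s*h)+1, by omega, 0, by omega, ?_⟩
      rw [tl_zero]; unfold sp; rw [if_neg (by omega)]; omega

lemma bl_add_le (ω : Om s m A h) {β j a : ℕ} (hj : j ≤ h) (ha : a < pl ω (tl ω β j)) :
    bl ω β j + a < bl ω β (h+1) := by
  have : bl ω β (j+1) ≤ bl ω β (h+1) := by
    unfold bl
    exact sum_le_sum_of_subset (range_mono (by omega))
  have e : bl ω β (j+1) = bl ω β j + pl ω (tl ω β j) := by unfold bl; rw [sum_range_succ]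
  omega

lemma psi_surj (hP : Par s m A h) (ω : Om s m A h) (v : ZMod (s*s)) :
    ∃ k < s, ∃ a < s, (sf ω)^[a] ((bd ω k : ℤ) : ZMod (s*s)) = v := by
  obtain ⟨i, hi, a, ha, rfl⟩ := cover hP ω v
  obtain ⟨β, hβ, j, hj, rfl⟩ := tl_surj hP ω hi
  have hlt := bl_add_le ω hj ha
  have hit : (sf ω)^[a + bl ω β j] ((bd ω (sp s h β) : ℤ) : ZMod (s*s))
      = ((bd ω (tl ω β j) : ℤ) : ZMod (s*s)) + (a : ZMod (s*s)) := by
    rw [Function.iterate_add_apply, iter_bl hP ω hβ hj, iter_int hP ω hi ha]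
  rcases Nat.even_or_odd' β with ⟨k, rfl | rfl⟩
  · have e1 : sp s h (2*k) = k := by unfold sp; rw [if_pos (by omega)]; omega
    have ht := block_total hP ω (k := k) (by omega)
    rw [e1] at hit
    exact ⟨k, by omega, a + bl ω (2*k) j, by omega, hit⟩
  · have e1 : sp s h (2*k) = k := by unfold sp; rw [if_pos (by omega)]; omega
    have e3 : fl (2*k) = 2*k+1 := by unfold fl; rw [if_pos (by omega)]
    have ht := block_total hP ω (k := k) (by omega)
    have h1 := iter_block hP ω (β := 2*k) (by omega)
    rw [e3, e1] at h1
    refine ⟨k, by omega, a + bl ω (2*k+1) j + bl ω (2*k) (h+1), by omega, ?_⟩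
    rw [Function.iterate_add_apply, h1, hit]

/-- the cycle factor -/
theorem cycle_factor (hP : Par s m A h) (ω : Om s m A h) (r : ZMod (s*s) → ZMod (s*s) → Prop)
    (h1 : ∀ v, r v (v+1)) (h2 : ∀ l, r (TT ω l - 1) (HH ω l)) :
    ∃ ψ : Fin s × Fin s → ZMod (s*s), Function.Bijective ψ ∧
      (∀ k a b : Fin s, ((a:ℕ) + 1) % s = b → r (ψ (k,a)) (ψ (k,b))) := by
  have hs := s_pos hP
  have : NeZero (s*s) := ⟨by positivity⟩
  have hr : ∀ v, r v (sf ω v) := by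
    intro v
    by_cases hx : ∃ l, v + 1 = TT ω l
    · obtain ⟨l, hl⟩ := hx
      rw [sf_of hP ω l hl]
      have := h2 l
      rw [← hl] at this; simpa using this
    · push Not at hx
      rw [sf_not ω hx]; exact h1 v
  refine ⟨fun q => (sf ω)^[(q.2:ℕ)] ((bd ω (q.1:ℕ) : ℤ) : ZMod (s*s)), ?_, ?_⟩
  · rw [Fintype.bijective_iff_surjective_and_card]
    constructor
    · intro v
      obtain ⟨k, hk, a, ha, e⟩ := psi_surj hP ω v
      exact ⟨(⟨k, hk⟩, ⟨a, ha⟩), e⟩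
    · simp [ZMod.card]
  · intro k a b e
    simp only
    have key : (sf ω)^[(b:ℕ)] ((bd ω (k:ℕ) : ℤ) : ZMod (s*s))
        = sf ω ((sf ω)^[(a:ℕ)] ((bd ω (k:ℕ) : ℤ) : ZMod (s*s))) := by
      rw [← Function.iterate_succ_apply' (sf ω)]
      by_cases hc : (a:ℕ) + 1 < s
      · rw [Nat.mod_eq_of_lt hc] at e; rw [← e]
      · have ha := a.2
        have : (a:ℕ) + 1 = s := by omega
        rw [this, Nat.mod_self] at e
        rw [Nat.succ_eq_add_one, this, ← e, iter_cycle hP ω k.2]; rfl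
    rw [key]; exact hr _

end cyc
end CombProof


namespace CombProof
open Finset
set_option linter.unusedSectionVars false

section cheb
variable {s m A h : ℕ}

def rho {M m : ℕ} (r : Fin M → Fin m) (j : Fin M) : ℤ := 2 * ((r j : ℕ) : ℤ) - (m - 1)

lemma rho_sq {M m : ℕ} (r : Fin M → Fin m) (j : Fin M) : rho r j * rho r j ≤ (m:ℤ)^2 := by
  have h1 : ((r j : ℕ) : ℤ) < m := by exact_mod_cast (r j).2
  have h0 : (0:ℤ) ≤ ((r j : ℕ) : ℤ) := by positivity
  unfold rho
  nlinarith

lemma rho_cross {M m : ℕ} {i j : Fin M} (hij : i ≠ j) :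
    ∑ r : Fin M → Fin m, rho r i * rho r j = 0 := by
  let g : (Fin M → Fin m) → (Fin M → Fin m) := fun r => Function.update r i (Fin.rev (r i))
  have hinv : Function.Involutive g := by
    intro r; simp [g]
  have h1 := Equiv.sum_comp (Function.Involutive.toPerm g hinv) (fun r : Fin M → Fin m => rho r i * rho r j)
  have h2 : ∑ r : Fin M → Fin m, (rho ((Function.Involutive.toPerm g hinv) r) i * rho ((Function.Involutive.toPerm g hinv) r) j)
      = - ∑ r : Fin M → Fin m, rho r i * rho r j := by
    rw [← sum_neg_distrib]
    apply sum_congr rfl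
    intro r _
    have e1 : rho ((Function.Involutive.toPerm g hinv) r) i = - rho r i := by
      unfold rho
      have hl := (r i).2
      simp only [Function.Involutive.coe_toPerm, g, Function.update_self, Fin.val_rev]
      push_cast [Nat.cast_sub (show (r i : ℕ) + 1 ≤ m by omega)]
      ring
    have e2 : rho ((Function.Involutive.toPerm g hinv) r) j = rho r j := by
      unfold rho
      simp only [Function.Involutive.coe_toPerm, g, Function.update_of_ne hij.symm]
    rw [e1, e2]; ring
  omega

lemma rho_mom {M m : ℕ} (J : Finset (Fin M)) :
    ∑ r : Fin M → Fin m, (∑ j ∈ J, rho r j)^2 ≤ J.card * (m:ℤ)^2 * (m:ℤ)^M := by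
  have h1 : ∀ r : Fin M → Fin m, (∑ j ∈ J, rho r j)^2 = ∑ i ∈ J, ∑ j ∈ J, rho r i * rho r j := by
    intro r; rw [sq, sum_mul_sum]
  simp_rw [h1]
  rw [sum_comm]
  have h2 : ∀ i ∈ J, ∑ r : Fin M → Fin m, ∑ j ∈ J, rho r i * rho r j ≤ (m:ℤ)^2 * (m:ℤ)^M := by
    intro i hi
    rw [sum_comm, sum_eq_single_of_mem i hi]
    · calc _ ≤ ∑ r : Fin M → Fin m, (m:ℤ)^2 := sum_le_sum fun r _ => rho_sq r i
        _ = _ := by simp; ring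
    · intro j _ hj
      exact rho_cross hj.symm
  calc _ ≤ ∑ i ∈ J, (m:ℤ)^2 * (m:ℤ)^M := sum_le_sum h2
    _ = _ := by simp; ring

/-- deviation -/
def Dk (ω : Om s m A h) (k : ℕ) : ℤ := RS ω k - 4 * m * h * k

lemma Dk_eq (ω : Om s m A h) (k : ℕ) :
    Dk ω k = ∑ p ∈ range (2*h*k), (rr ω (pin ω p + 1) - rr ω (pin ω p)) := by
  unfold Dk RS
  simp_rw [yl_eq]
  have : ∀ p ∈ range (2*h*k), (2 * (m:ℤ) + rr ω (pin ω p + 1) - rr ω (pin ω p)) =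
    2 * m + (rr ω (pin ω p + 1) - rr ω (pin ω p)) := by intros; ring
  rw [sum_congr rfl this, sum_add_distrib]
  simp; ring

lemma Dk_two (ω : Om s m A h) {k : ℕ} (hk : k ≤ s) : ∃ J J' : Finset (Fin (2*s*h+1)),
    J.card ≤ 2*s*h ∧ J'.card ≤ 2*s*h ∧
    ∀ r : Fin (2*s*h+1) → Fin m, 2 * Dk (ω.1, r, ω.2.2) k = ∑ j ∈ J, rho r j - ∑ j ∈ J', rho r j := by
  have hle : 2*h*k ≤ 2*s*h := by nlinarith
  have hlt : ∀ p ∈ range (2*h*k), pin ω p < 2*s*h := fun p hp => pin_lt ω (by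
    rw [mem_range] at hp; omega)
  have hpi : ∀ p ∈ range (2*h*k), ∀ q ∈ range (2*h*k), pin ω p = pin ω q → p = q := by
    intro p hp q hq e
    rw [mem_range] at hp hq
    exact pin_inj ω (by omega) (by omega) e
  let f : ℕ → Fin (2*s*h+1) := fun p => Fin.ofNat _ (pin ω p + 1)
  let g : ℕ → Fin (2*s*h+1) := fun p => Fin.ofNat _ (pin ω p)
  have fv : ∀ p ∈ range (2*h*k), (f p : ℕ) = pin ω p + 1 := by
    intro p hp
    simp only [f, Fin.ofNat]
    exact Nat.mod_eq_of_lt (by have := hlt p hp; omega)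
  have gv : ∀ p ∈ range (2*h*k), (g p : ℕ) = pin ω p := by
    intro p hp
    simp only [g, Fin.ofNat]
    exact Nat.mod_eq_of_lt (by have := hlt p hp; omega)
  have fi : Set.InjOn f (range (2*h*k)) := by
    intro p hp q hq e
    have := congrArg Fin.val e
    rw [fv p hp, fv q hq] at this
    exact hpi p hp q hq (by omega)
  have gi : Set.InjOn g (range (2*h*k)) := by
    intro p hp q hq e
    have := congrArg Fin.val e
    rw [gv p hp, gv q hq] at this
    exact hpi p hp q hq (by omega)
  refine ⟨(range (2*h*k)).image f, (range (2*h*k)).image g, ?_, ?_, ?_⟩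
  · exact card_image_le.trans (by simpa using hle)
  · exact card_image_le.trans (by simpa using hle)
  · intro r
    rw [sum_image fi, sum_image gi, Dk_eq, ← sum_sub_distrib, mul_sum]
    apply sum_congr rfl
    intro p hp
    have hpe : pin (s := s) (m := m) (A := A) (h := h) (ω.1, r, ω.2.2) p = pin ω p := rfl
    rw [hpe]
    have h1 := hlt p hp
    have e1 : rr (s := s) (m := m) (A := A) (h := h) (ω.1, r, ω.2.2) (pin ω p + 1) = ((r (f p) : ℕ) : ℤ) := by
      unfold rr; rw [dif_pos (by omega)]
      simp only
      congr 3; exact Fin.ext (fv p hp).symm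
    have e2 : rr (s := s) (m := m) (A := A) (h := h) (ω.1, r, ω.2.2) (pin ω p) = ((r (g p) : ℕ) : ℤ) := by
      unfold rr; rw [dif_pos (by omega)]
      simp only
      congr 3; exact Fin.ext (gv p hp).symm
    rw [e1, e2]
    unfold rho; ring

lemma Dk_mom (π : Equiv.Perm (Fin (2*s*h))) (ξ : Fin s → Fin A) {k : ℕ} (hk : k ≤ s) :
    ∑ r : Fin (2*s*h+1) → Fin m, (Dk (s := s) (m := m) (A := A) (h := h) (π, r, ξ) k)^2
      ≤ (2*s*h : ℕ) * (m:ℤ)^2 * (m:ℤ)^(2*s*h+1) := by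
  by_cases hne : Nonempty (Fin (2*s*h+1) → Fin m)
  swap
  · rw [not_nonempty_iff] at hne
    simp only [univ_eq_empty, sum_empty]; positivity
  obtain ⟨r0⟩ := hne
  obtain ⟨J, J', hJ, hJ', hD⟩ := Dk_two (s := s) (m := m) (A := A) (h := h) (π, r0, ξ) hk
  have h1 : ∀ r : Fin (2*s*h+1) → Fin m, 4 * (Dk (s := s) (m := m) (A := A) (h := h) (π, r, ξ) k)^2
      ≤ 2 * (∑ j ∈ J, rho r j)^2 + 2 * (∑ j ∈ J', rho r j)^2 := by
    intro r
    have := hD r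
    simp only at this
    calc _ = (2 * Dk (s := s) (m := m) (A := A) (h := h) (π, r, ξ) k)^2 := by ring
      _ = (∑ j ∈ J, rho r j - ∑ j ∈ J', rho r j)^2 := by rw [this]
      _ ≤ _ := by nlinarith [sq_nonneg (∑ j ∈ J, rho r j + ∑ j ∈ J', rho r j)]
  have h2 := sum_le_sum (s := univ) fun r (_ : r ∈ (univ : Finset (Fin (2*s*h+1) → Fin m))) => h1 r
  rw [sum_add_distrib, ← mul_sum, ← mul_sum, ← mul_sum] at h2
  have m1 := rho_mom (m := m) J
  have m2 := rho_mom (m := m) J'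
  have hq : (0:ℤ) ≤ (m:ℤ)^2 * (m:ℤ)^(2*s*h+1) := by positivity
  have c1 : (J.card : ℤ) * (m:ℤ)^2 * (m:ℤ)^(2*s*h+1) ≤ (2*s*h : ℕ) * (m:ℤ)^2 * (m:ℤ)^(2*s*h+1) := by
    have hc : (J.card : ℤ) ≤ (2*s*h : ℕ) := by exact_mod_cast hJ
    nlinarith [mul_le_mul_of_nonneg_right hc hq]
  have c2 : (J'.card : ℤ) * (m:ℤ)^2 * (m:ℤ)^(2*s*h+1) ≤ (2*s*h : ℕ) * (m:ℤ)^2 * (m:ℤ)^(2*s*h+1) := by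
    have hc : (J'.card : ℤ) ≤ (2*s*h : ℕ) := by exact_mod_cast hJ'
    nlinarith [mul_le_mul_of_nonneg_right hc hq]
  linarith

open Classical in
/-- the good event -/
noncomputable def O0 (s m A h Γ : ℕ) : Finset (Om s m A h) :=
  univ.filter fun ω => ∀ k < s, |Dk ω k| ≤ Γ

lemma good_card {Γ : ℕ} (hΓ : 0 < Γ) (hb : 2 * s * (2*s*h) * m^2 ≤ Γ^2) :
    Fintype.card (Om s m A h) ≤ 2 * (O0 s m A h Γ).card := by
  classical
  have hbad : ∀ k < s, ((univ.filter fun ω : Om s m A h => (Γ:ℤ) < |Dk ω k|).card : ℤ) * (Γ:ℤ)^2 ≤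
      (2*s*h : ℕ) * (m:ℤ)^2 * Fintype.card (Om s m A h) := by
    intro k hk
    calc ((univ.filter fun ω : Om s m A h => (Γ:ℤ) < |Dk ω k|).card : ℤ) * (Γ:ℤ)^2
        = ∑ ω ∈ univ.filter (fun ω : Om s m A h => (Γ:ℤ) < |Dk ω k|), (Γ:ℤ)^2 := by
          rw [sum_const, nsmul_eq_mul]
      _ ≤ ∑ ω ∈ univ.filter (fun ω : Om s m A h => (Γ:ℤ) < |Dk ω k|), (Dk ω k)^2 := by
          apply sum_le_sum
          intro ω hω
          rw [mem_filter] at hω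
          rw [← sq_abs (Dk ω k)]
          exact pow_le_pow_left₀ (by positivity) hω.2.le 2
      _ ≤ ∑ ω : Om s m A h, (Dk ω k)^2 :=
          sum_le_sum_of_subset_of_nonneg (filter_subset _ _) fun _ _ _ => sq_nonneg _
      _ = ∑ π : Equiv.Perm (Fin (2*s*h)), ∑ ξ : Fin s → Fin A, ∑ r : Fin (2*s*h+1) → Fin m,
            (Dk (s := s) (m := m) (A := A) (h := h) (π, r, ξ) k)^2 := by
          rw [Fintype.sum_prod_type]
          apply sum_congr rfl; intro π _
          rw [Fintype.sum_prod_type, sum_comm]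
      _ ≤ ∑ π : Equiv.Perm (Fin (2*s*h)), ∑ ξ : Fin s → Fin A,
            ((2*s*h : ℕ) * (m:ℤ)^2 * (m:ℤ)^(2*s*h+1)) :=
          sum_le_sum fun π _ => sum_le_sum fun ξ _ => Dk_mom π ξ hk.le
      _ = _ := by
          simp only [sum_const, nsmul_eq_mul, card_univ, Fintype.card_prod, Fintype.card_fun, Fintype.card_fin]
          push_cast; ring
  have hcov : Fintype.card (Om s m A h) ≤ (O0 s m A h Γ).card +
      ∑ k ∈ range s, (univ.filter fun ω : Om s m A h => (Γ:ℤ) < |Dk ω k|).card := by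
    rw [← card_univ]
    calc _ ≤ (O0 s m A h Γ ∪ (range s).biUnion fun k => univ.filter fun ω : Om s m A h => (Γ:ℤ) < |Dk ω k|).card := by
          apply card_le_card
          intro ω _
          rw [mem_union, mem_biUnion]
          by_cases hg : ω ∈ O0 s m A h Γ
          · exact Or.inl hg
          · right
            unfold O0 at hg
            simp only [mem_filter, mem_univ, true_and] at hg
            push Not at hg
            obtain ⟨k, hk, hk'⟩ := hg
            exact ⟨k, mem_range.2 hk, by simpa using hk'⟩
      _ ≤ _ := (card_union_le _ _).trans (Nat.add_le_add_left card_biUnion_le _)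
  have hsum : (∑ k ∈ range s, ((univ.filter fun ω : Om s m A h => (Γ:ℤ) < |Dk ω k|).card : ℤ)) * (Γ:ℤ)^2 ≤
      s * ((2*s*h : ℕ) * (m:ℤ)^2 * Fintype.card (Om s m A h)) := by
    rw [sum_mul]
    calc _ ≤ ∑ k ∈ range s, ((2*s*h : ℕ) * (m:ℤ)^2 * Fintype.card (Om s m A h)) :=
          sum_le_sum fun k hk => hbad k (mem_range.1 hk)
      _ = _ := by simp
  have hb' : 2 * s * (2*s*h : ℕ) * (m:ℤ)^2 ≤ (Γ:ℤ)^2 := by exact_mod_cast hb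
  have hT : (0:ℤ) ≤ Fintype.card (Om s m A h) := by positivity
  have h3 : 2 * ((∑ k ∈ range s, ((univ.filter fun ω : Om s m A h => (Γ:ℤ) < |Dk ω k|).card : ℤ)) * (Γ:ℤ)^2)
      ≤ Fintype.card (Om s m A h) * (Γ:ℤ)^2 := by
    calc _ ≤ 2 * (s * ((2*s*h : ℕ) * (m:ℤ)^2 * Fintype.card (Om s m A h))) := by linarith
      _ = (2 * s * (2*s*h : ℕ) * (m:ℤ)^2) * Fintype.card (Om s m A h) := by ring
      _ ≤ (Γ:ℤ)^2 * Fintype.card (Om s m A h) := mul_le_mul_of_nonneg_right hb' hT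
      _ = _ := by ring
  have hG : (0:ℤ) < (Γ:ℤ)^2 := by positivity
  have h4 : 2 * (∑ k ∈ range s, ((univ.filter fun ω : Om s m A h => (Γ:ℤ) < |Dk ω k|).card : ℤ))
      ≤ Fintype.card (Om s m A h) := by
    rw [← mul_assoc] at h3
    exact le_of_mul_le_mul_right h3 hG
  zify at hcov ⊢
  linarith

end cheb
end CombProof


namespace CombProof
open Finset
set_option linter.unusedSectionVars false

section decode
variable {s m A h : ℕ}

lemma bd_range_x (hP : Par s m A h) (ω : Om s m A h) {i : ℕ} (hi : i < s) :
    1 + (i:ℤ) * A ≤ bd ω i ∧ bd ω i < 1 + ((i:ℤ)+1) * A := by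
  rw [bd_x ω hi.le]; unfold xb; rw [if_pos hi]
  have := xi_nonneg ω i; have := xi_lt hP ω i
  constructor <;> nlinarith

lemma bd_range_y (hP : Par s m A h) (ω : Om s m A h) {j : ℕ} (hj : j ≤ 2*s*h) :
    1 + (s:ℤ) * A + 2 * m * j ≤ bd ω (s+j) ∧ bd ω (s+j) < 1 + (s:ℤ) * A + 2 * m * j + m := by
  rw [bd_y ω hj]; unfold yb
  have := rr_nonneg ω j; have := rr_lt hP ω j
  constructor <;> linarith

lemma bd_range_z (hP : Par s m A h) (ω : Om s m A h) {k : ℕ} (hk : 1 ≤ k) (hk' : k < s) :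
    1 + (s:ℤ) * A + 2 * m * (2*s*h : ℕ) + m ≤ bd ω (s+2*s*h+k) := by
  have h1 := bd_le hP ω (i := s + 2*s*h + 1) (j := s + 2*s*h + k) (by omega) (by omega)
  have h2 := zb_step hP ω (k := 0) (by omega)
  rw [← bd_z, ← bd_z, zero_add] at h2
  have h3 := (bd_range_y hP ω (j := 2*s*h) le_rfl).1
  have h4 : (m:ℤ) ≤ A := by exact_mod_cast hP.hA
  rw [add_zero] at h2
  linarith

lemma decode_xy (hP : Par s m A h) (ω ω' : Om s m A h) {i i' : ℕ}
    (hi : i ≤ s + 2*s*h) (hi' : i' < s + 2*s*h + s) (e : bd ω' i' = bd ω i) : i' = i := by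
  have hm : (1:ℤ) ≤ m := by exact_mod_cast hP.hm
  have hA : (1:ℤ) ≤ A := by exact_mod_cast hP.hm.trans hP.hA
  have hmA : (m:ℤ) ≤ A := by exact_mod_cast hP.hA
  by_cases h1 : i < s
  · have b1 := bd_range_x hP ω h1
    have hsi : ((i:ℤ)+1) ≤ s := by exact_mod_cast h1
    have hs1 : ((i:ℤ)+1) * A ≤ s * A := mul_le_mul_of_nonneg_right hsi (by linarith)
    by_cases h2 : i' < s
    · have b2 := bd_range_x hP ω' h2
      rcases lt_trichotomy i' i with h3 | h3 | h3
      · have : ((i':ℤ)+1) ≤ i := by exact_mod_cast h3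
        nlinarith
      · exact h3
      · have : ((i:ℤ)+1) ≤ i' := by exact_mod_cast h3
        nlinarith
    · by_cases h3 : i' ≤ s + 2*s*h
      · obtain ⟨j, rfl⟩ : ∃ j, i' = s + j := ⟨i' - s, by omega⟩
        have b2 := bd_range_y hP ω' (j := j) (by omega)
        have : (0:ℤ) ≤ 2 * m * j := by positivity
        linarith
      · obtain ⟨j, rfl⟩ : ∃ j, i' = s + 2*s*h + j := ⟨i' - s - 2*s*h, by omega⟩
        have b2 := bd_range_z hP ω' (k := j) (by omega) (by omega)
        have : (0:ℤ) ≤ 2 * m * (2*s*h:ℕ) := by positivity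
        linarith
  · obtain ⟨j, rfl⟩ : ∃ j, i = s + j := ⟨i - s, by omega⟩
    have b1 := bd_range_y hP ω (j := j) (by omega)
    by_cases h2 : i' < s
    · have b2 := bd_range_x hP ω' h2
      have hsi : ((i':ℤ)+1) ≤ s := by exact_mod_cast h2
      have hs1 : ((i':ℤ)+1) * A ≤ s * A := mul_le_mul_of_nonneg_right hsi (by linarith)
      have : (0:ℤ) ≤ 2 * m * j := by positivity
      linarith
    · by_cases h3 : i' ≤ s + 2*s*h
      · obtain ⟨j', rfl⟩ : ∃ j, i' = s + j := ⟨i' - s, by omega⟩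
        have b2 := bd_range_y hP ω' (j := j') (by omega)
        rcases lt_trichotomy j' j with h3 | h3 | h3
        · have : ((j':ℤ)+1) ≤ j := by exact_mod_cast h3
          nlinarith
        · rw [h3]
        · have : ((j:ℤ)+1) ≤ j' := by exact_mod_cast h3
          nlinarith
      · obtain ⟨k, rfl⟩ : ∃ j, i' = s + 2*s*h + j := ⟨i' - s - 2*s*h, by omega⟩
        have b2 := bd_range_z hP ω' (k := k) (by omega) (by omega)
        have : (j:ℤ) ≤ (2*s*h:ℕ) := by exact_mod_cast (by omega : j ≤ 2*s*h)
        nlinarith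

lemma zb_eq (ω : Om s m A h) {k : ℕ} (hk : k < s) :
    zb ω k = 1 + s * A + 2 * m * (2*s*h : ℕ) + k * ((s:ℤ) - A - 4 * m * h)
      + (rr ω (2*s*h) - xi ω k + xi ω 0 - Dk ω k) := by
  unfold zb Dk yb xb
  rw [if_pos hk, if_pos (by omega)]
  push_cast; ring

lemma decode_z (hP : Par s m A h) {ω ω' : Om s m A h} {Γ Q : ℕ} (hω : ω ∈ O0 s m A h Γ)
    (hω' : ω' ∈ O0 s m A h Γ)
    (hQ : 2 * ((m:ℤ) + A + Γ) < (Q + 1) * ((s:ℤ) - A - 4 * m * h))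
    {k k' : ℕ} (hk : k < s) (hk' : k' < s) (e : zb ω' k' = zb ω k) : k ≤ k' + Q := by
  rw [zb_eq ω hk, zb_eq ω' hk'] at e
  have g1 := (mem_filter.1 hω).2 k hk
  have g2 := (mem_filter.1 hω').2 k' hk'
  rw [abs_le] at g1 g2
  have a1 := rr_nonneg ω (2*s*h); have a2 := rr_lt hP ω (2*s*h)
  have a3 := rr_nonneg ω' (2*s*h); have a4 := rr_lt hP ω' (2*s*h)
  have a5 := xi_nonneg ω k; have a6 := xi_lt hP ω k
  have a7 := xi_nonneg ω 0; have a8 := xi_lt hP ω 0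
  have a9 := xi_nonneg ω' k'; have a10 := xi_lt hP ω' k'
  have a11 := xi_nonneg ω' 0; have a12 := xi_lt hP ω' 0
  by_contra hc
  push Not at hc
  have hc' : (k':ℤ) + Q + 1 ≤ k := by exact_mod_cast hc
  have hw : (0:ℤ) < (s:ℤ) - A - 4 * m * h := by
    by_contra hn
    push Not at hn
    have : ((Q:ℤ)+1) * ((s:ℤ) - A - 4 * m * h) ≤ 0 :=
      mul_nonpos_of_nonneg_of_nonpos (by positivity) hn
    have : (0:ℤ) ≤ 2 * ((m:ℤ) + A + Γ) := by positivity
    linarith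
  have h1 : (Q + 1) * ((s:ℤ) - A - 4 * m * h) ≤ ((k:ℤ) - k') * ((s:ℤ) - A - 4 * m * h) :=
    mul_le_mul_of_nonneg_right (by linarith) hw.le
  have h2 : ((k:ℤ) - k') * ((s:ℤ) - A - 4 * m * h) =
    k * ((s:ℤ) - A - 4 * m * h) - k' * ((s:ℤ) - A - 4 * m * h) := by ring
  linarith

/-- boundary indices of the ends of links -/
def bt (ω : Om s m A h) (l : Fin (2*s) × Fin (h+1)) : ℕ := nxb s h (tl ω l.1 l.2)
def bh (ω : Om s m A h) (l : Fin (2*s) × Fin (h+1)) : ℕ := hd ω l.1 l.2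
def UU (ω : Om s m A h) (L : Finset (Fin (2*s) × Fin (h+1))) : Finset ℕ := L.image (bt ω) ∪ L.image (bh ω)

lemma bt_lt (hP : Par s m A h) (ω : Om s m A h) (l) : bt ω l < s + 2*s*h + s := nxb_lt hP _
lemma bh_lt (ω : Om s m A h) (l) : bh ω l < s + 2*s*h + s := hd_lt ω l.1.2

lemma UU_lt (hP : Par s m A h) (ω : Om s m A h) (L) {i : ℕ} (hi : i ∈ UU ω L) : i < s + 2*s*h + s := by
  unfold UU at hi
  rw [mem_union, mem_image, mem_image] at hi
  rcases hi with ⟨l, _, rfl⟩ | ⟨l, _, rfl⟩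
  · exact bt_lt hP ω l
  · exact bh_lt ω l

lemma bt_mem {ω : Om s m A h} {L} {l} (hl : l ∈ L) : bt ω l ∈ UU ω L :=
  mem_union_left _ (mem_image_of_mem _ hl)
lemma bh_mem {ω : Om s m A h} {L} {l} (hl : l ∈ L) : bh ω l ∈ UU ω L :=
  mem_union_right _ (mem_image_of_mem _ hl)

lemma UU_card (hP : Par s m A h) (ω : Om s m A h) (L) :
    (L.image (TT ω) ∪ L.image (HH ω)).card = (UU ω L).card := by
  have e1 : L.image (TT ω) = (L.image (bt ω)).image (fun i => ((bd ω i : ℤ) : ZMod (s*s))) := by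
    rw [image_image]; rfl
  have e2 : L.image (HH ω) = (L.image (bh ω)).image (fun i => ((bd ω i : ℤ) : ZMod (s*s))) := by
    rw [image_image]; rfl
  rw [e1, e2, ← image_union]
  apply card_image_of_injOn
  intro i hi j hj e
  have hi' := UU_lt hP ω L hi
  have hj' := UU_lt hP ω L hj
  exact bd_inj hP ω hi' hj' (bd_cast_inj hP ω ω hi' hj' e)

/-- consistency with an index map -/
def cons (ω : Om s m A h) (L : Finset (Fin (2*s) × Fin (h+1))) (K : ℕ → ℕ) (ω' : Om s m A h) : Prop :=
  (∀ l ∈ L, ∃ l', bt ω' l' = K (bt ω l) ∧ bh ω' l' = K (bh ω l)) ∧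
  ∀ i ∈ UU ω L, K i < s + 2*s*h + s ∧ bd ω' (K i) = bd ω i

lemma cons_exists (hP : Par s m A h) {ω ω' : Om s m A h} {L} {Γ Q : ℕ} (hω : ω ∈ O0 s m A h Γ)
    (hω' : ω' ∈ O0 s m A h Γ)
    (hQ : 2 * ((m:ℤ) + A + Γ) < (Q + 1) * ((s:ℤ) - A - 4 * m * h))
    (hL : ∀ l ∈ L, ∃ l', TT ω' l' = TT ω l ∧ HH ω' l' = HH ω l) :
    ∃ F : {i // i ∈ (UU ω L).filter (fun i => s + 2*s*h < i)} → Fin (2*Q+1),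
      cons ω L (fun i => if hi : i ∈ (UU ω L).filter (fun i => s + 2*s*h < i) then i + F ⟨i, hi⟩ - Q else i) ω' := by
  classical
  have hL' : ∀ l ∈ L, ∃ l', bd ω' (bt ω' l') = bd ω (bt ω l) ∧ bd ω' (bh ω' l') = bd ω (bh ω l) := by
    intro l hl
    obtain ⟨l', h1, h2⟩ := hL l hl
    exact ⟨l', bd_cast_inj hP ω' ω (bt_lt hP ω' l') (bt_lt hP ω l) h1,
      bd_cast_inj hP ω' ω (bh_lt ω' l') (bh_lt ω l) h2⟩
  have hx : ∀ i ∈ UU ω L, ∃ i' < s + 2*s*h + s, bd ω' i' = bd ω i := by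
    intro i hi
    unfold UU at hi
    rw [mem_union, mem_image, mem_image] at hi
    rcases hi with ⟨l, hl, rfl⟩ | ⟨l, hl, rfl⟩
    · obtain ⟨l', h1, h2⟩ := hL' l hl
      exact ⟨_, bt_lt hP ω' l', h1⟩
    · obtain ⟨l', h1, h2⟩ := hL' l hl
      exact ⟨_, bh_lt ω' l', h2⟩
  choose! k hk hkb using hx
  have hclose : ∀ i ∈ UU ω L, s + 2*s*h < i → i ≤ k i + Q ∧ k i ≤ i + Q := by
    intro i hi hi2
    have hi3 := UU_lt hP ω L hi
    have hki : s + 2*s*h < k i := by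
      by_contra hc
      push Not at hc
      have := decode_xy hP ω' ω hc hi3 (hkb i hi).symm
      omega
    have hk3 := hk i hi
    obtain ⟨a, rfl⟩ : ∃ a, i = s + 2*s*h + a := ⟨i - (s + 2*s*h), by omega⟩
    obtain ⟨b, hb⟩ : ∃ b, k (s + 2*s*h + a) = s + 2*s*h + b := ⟨k (s + 2*s*h + a) - (s + 2*s*h), by omega⟩
    have hkb' := hkb _ hi
    rw [hb, bd_z, bd_z] at hkb'
    have d1 := decode_z hP hω hω' hQ (k := a) (k' := b) (by omega) (by omega) hkb'
    have d2 := decode_z hP hω' hω hQ (k := b) (k' := a) (by omega) (by omega) hkb'.symm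
    omega
  refine ⟨fun i => ⟨k i.1 + Q - i.1, ?_⟩, ?_⟩
  · have h1 := mem_filter.1 i.2
    have := hclose i.1 h1.1 h1.2
    omega
  have hKe : ∀ i ∈ UU ω L, (if hi : i ∈ (UU ω L).filter (fun i => s + 2*s*h < i) then
      i + (k i + Q - i) - Q else i) = k i := by
    intro i hi
    by_cases hc : s + 2*s*h < i
    · rw [dif_pos (mem_filter.2 ⟨hi, hc⟩)]
      have := hclose i hi hc
      omega
    · rw [dif_neg (by rw [mem_filter]; tauto)]
      exact (decode_xy hP ω ω' (by omega) (hk i hi) (hkb i hi)).symm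
  refine ⟨?_, ?_⟩
  · intro l hl
    obtain ⟨l', h1, h2⟩ := hL' l hl
    refine ⟨l', ?_, ?_⟩
    · simp only
      rw [hKe _ (bt_mem hl)]
      apply bd_inj hP ω' (bt_lt hP ω' l') (hk _ (bt_mem hl))
      rw [h1, hkb _ (bt_mem hl)]
    · simp only
      rw [hKe _ (bh_mem hl)]
      apply bd_inj hP ω' (bh_lt ω' l') (hk _ (bh_mem hl))
      rw [h2, hkb _ (bh_mem hl)]
  · intro i hi
    simp only
    rw [hKe i hi]
    exact ⟨hk i hi, hkb i hi⟩

end decode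
end CombProof


namespace CombProof
open Finset
set_option linter.unusedSectionVars false

section counts
variable {s m A h : ℕ}

lemma K_lo (hP : Par s m A h) {ω ω' : Om s m A h} {L} {K : ℕ → ℕ} (hc : cons ω L K ω') {i : ℕ}
    (hi : i ∈ UU ω L) (hi2 : i ≤ s + 2*s*h) : K i = i :=
  decode_xy hP ω ω' hi2 (hc.2 i hi).1 (hc.2 i hi).2

lemma K_hi (hP : Par s m A h) {ω ω' : Om s m A h} {L} {K : ℕ → ℕ} (hc : cons ω L K ω') {i : ℕ}
    (hi : i ∈ UU ω L) (hi2 : s + 2*s*h < i) : s + 2*s*h < K i := by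
  by_contra h1
  push Not at h1
  have := decode_xy hP ω' ω h1 (UU_lt hP ω L hi) (hc.2 i hi).2.symm
  omega

lemma K_inj (hP : Par s m A h) {ω ω' : Om s m A h} {L} {K : ℕ → ℕ} (hc : cons ω L K ω') {i j : ℕ}
    (hi : i ∈ UU ω L) (hj : j ∈ UU ω L) (e : K i = K j) : i = j := by
  apply bd_inj hP ω (UU_lt hP ω L hi) (UU_lt hP ω L hj)
  rw [← (hc.2 i hi).2, ← (hc.2 j hj).2, e]

lemma perm_of_pin (ω : Om s m A h) {p : ℕ} (hp : p < 2*s*h) {a : Fin (2*s*h)} (e : pin ω p = a) :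
    (ω.1 a : ℕ) = p := by
  unfold pin at e; rw [dif_pos hp] at e
  have : ω.1.symm ⟨p, hp⟩ = a := Fin.ext e
  rw [← this]; simp

/-- piece at a position -/
def pc (ω : Om s m A h) (q : Fin (2*s) × Fin h) : Fin (2*s*h) :=
  ω.1.symm ⟨q.1 * h + q.2, pos_lt q.1.2 q.2.2⟩

lemma pc_val (ω : Om s m A h) (q : Fin (2*s) × Fin h) : (pc ω q : ℕ) = pin ω (q.1 * h + q.2) := by
  unfold pc pin; rw [dif_pos (pos_lt q.1.2 q.2.2)]

lemma pc_injective (ω : Om s m A h) : Function.Injective (pc ω) := by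
  intro q q' e
  have := ω.1.symm.injective e
  have := pos_inj q.2.2 q'.2.2 (congrArg Fin.val this)
  exact Prod.ext (Fin.ext this.1) (Fin.ext this.2)

/-- regular-regular links -/
lemma link_rr (hP : Par s m A h) {ω ω' : Om s m A h} {L} {K : ℕ → ℕ} (hc : cons ω L K ω')
    {β : Fin (2*s)} {i : ℕ} (hi : i + 1 < h) (hl : (β, (⟨i+1, by omega⟩ : Fin (h+1))) ∈ L) :
    (ω'.1 (pc ω (β, ⟨i+1, hi⟩)) : ℕ) = ω'.1 (pc ω (β, ⟨i, by omega⟩)) + 1 := by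
  obtain ⟨l', h1, h2⟩ := hc.1 _ hl
  have p1 := pin_lt ω (pos_lt β.2 hi)
  have p0 := pin_lt ω (pos_lt β.2 (show i < h by omega))
  have e2 : bh ω (β, (⟨i+1, by omega⟩ : Fin (h+1))) = s + pin ω (β*h+(i+1)) := by
    unfold bh hd; simp only; rw [if_pos hi]
  have et : tl ω β (i+1) = s + pin ω (β*h+i) := by
    unfold tl; rw [if_neg (by omega)]; simp
  have e1 : bt ω (β, (⟨i+1, by omega⟩ : Fin (h+1))) = s + pin ω (β*h+i) + 1 := by
    unfold bt; simp only; rw [et]; unfold nxb; rw [if_pos (by have := s_pos hP; omega)]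
  rw [K_lo hP hc (bt_mem hl) (by rw [e1]; omega), e1] at h1
  rw [K_lo hP hc (bh_mem hl) (by rw [e2]; omega), e2] at h2
  have t1 : tl ω' l'.1 l'.2 = s + pin ω (β*h+i) := by
    apply nxb_inj (tl_lt ω' l'.1.2 (Nat.lt_succ_iff.1 l'.2.2)) (by omega) (h := h) (s := s)
    have : nxb s h (s + pin ω (β*h+i)) = s + pin ω (β*h+i) + 1 := by
      unfold nxb; rw [if_pos (by have := s_pos hP; omega)]
    rw [this]; exact h1
  have hi'h : (l'.2:ℕ) < h := by
    by_contra hn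
    unfold bh hd at h2
    rw [if_neg hn] at h2
    exact sp_ne (fl_lt l'.1.2) p1 h2
  have hi'0 : (l'.2:ℕ) ≠ 0 := by
    intro hn
    unfold tl at t1
    rw [if_pos hn] at t1
    exact sp_ne l'.1.2 p0 t1
  unfold bh hd at h2; rw [if_pos hi'h] at h2
  unfold tl at t1; rw [if_neg hi'0] at t1
  have a1 := perm_of_pin ω' (pos_lt l'.1.2 hi'h) (a := pc ω (β, ⟨i+1, hi⟩)) (by
    rw [pc_val]; simp only; omega)
  have a0 := perm_of_pin ω' (pos_lt l'.1.2 (show (l'.2:ℕ) - 1 < h by omega))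
    (a := pc ω (β, ⟨i, by omega⟩)) (by rw [pc_val]; simp only; omega)
  rw [a1, a0]; omega

/-- special-regular links -/
lemma link_sr (hP : Par s m A h) {ω ω' ω'' : Om s m A h} {L} {K : ℕ → ℕ} (hc : cons ω L K ω')
    (hc' : cons ω L K ω'') {β : Fin (2*s)} (h0 : 0 < h) (hl : (β, (⟨0, by omega⟩ : Fin (h+1))) ∈ L) :
    ω'.1 (pc ω (β, ⟨0, h0⟩)) = ω''.1 (pc ω (β, ⟨0, h0⟩)) := by
  have hs := s_pos hP
  have p0 := pin_lt ω (pos_lt β.2 h0)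
  have key : ∀ ω' : Om s m A h, cons ω L K ω' → ∃ β' < 2*s,
      nxb s h (sp s h β') = K (bt ω (β, (⟨0, by omega⟩ : Fin (h+1)))) ∧
      (ω'.1 (pc ω (β, ⟨0, h0⟩)) : ℕ) = β'*h := by
    intro ω' hc
    obtain ⟨l', h1, h2⟩ := hc.1 _ hl
    have e2 : bh ω (β, (⟨0, by omega⟩ : Fin (h+1))) = s + pin ω (β*h+0) := by
      unfold bh hd; simp only; rw [if_pos h0]
    have e1 : bt ω (β, (⟨0, by omega⟩ : Fin (h+1))) = nxb s h (sp s h β) := by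
      unfold bt; simp only; rw [tl_zero]
    have hnr : ∀ j < 2*s*h, tl ω' l'.1 l'.2 ≠ s + j := by
      intro j hj e
      unfold bt at h1
      rw [e] at h1
      have e3 : nxb s h (s + j) = s + j + 1 := by unfold nxb; rw [if_pos (by omega)]
      rw [e3] at h1
      have hmem := bt_mem (ω := ω) hl
      have hβ := β.2
      by_cases hcase : bt ω (β, (⟨0, by omega⟩ : Fin (h+1))) ≤ s + 2*s*h
      · rw [show nxb s h (tl ω (β, (⟨0, by omega⟩ : Fin (h+1))).1 (β, (⟨0, by omega⟩ : Fin (h+1))).2) = bt ω (β, (⟨0, by omega⟩ : Fin (h+1))) from rfl, K_lo hP hc hmem hcase] at h1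
        rw [e1] at h1 hcase
        unfold nxb sp at h1 hcase
        split_ifs at h1 hcase <;> omega
      · have := K_hi hP hc hmem (by omega)
        rw [show nxb s h (tl ω (β, (⟨0, by omega⟩ : Fin (h+1))).1 (β, (⟨0, by omega⟩ : Fin (h+1))).2) = bt ω (β, (⟨0, by omega⟩ : Fin (h+1))) from rfl] at h1
        omega
    have hi'0 : (l'.2:ℕ) = 0 := by
      by_contra hn
      have hlt := pin_lt ω' (pos_lt l'.1.2 (show (l'.2:ℕ) - 1 < h by have := l'.2.2; omega))
      refine hnr _ hlt ?_
      unfold tl; rw [if_neg hn]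
    refine ⟨l'.1, l'.1.2, ?_, ?_⟩
    · rw [← h1]; unfold bt tl; rw [if_pos hi'0]
    · rw [K_lo hP hc (bh_mem hl) (by rw [e2]; omega), e2] at h2
      unfold bh hd at h2; rw [hi'0, if_pos h0] at h2
      have := perm_of_pin ω' (pos_lt l'.1.2 h0) (a := pc ω (β, ⟨0, h0⟩)) (by
        rw [pc_val]; simp only; omega)
      rw [this]; omega
  obtain ⟨b1, hb1, e1, f1⟩ := key ω' hc
  obtain ⟨b2, hb2, e2, f2⟩ := key ω'' hc'
  have : b1 = b2 := sp_inj hb1 hb2 (nxb_inj (sp_lt hb1) (sp_lt hb2) (e1.trans e2.symm))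
  apply Fin.ext
  rw [f1, f2, this]

/-- regular-special links -/
lemma link_rs (hP : Par s m A h) {ω ω' ω'' : Om s m A h} {L} {K : ℕ → ℕ} (hc : cons ω L K ω')
    (hc' : cons ω L K ω'') {β : Fin (2*s)} (h0 : 0 < h) (hl : (β, (⟨h, by omega⟩ : Fin (h+1))) ∈ L) :
    ω'.1 (pc ω (β, ⟨h-1, by omega⟩)) = ω''.1 (pc ω (β, ⟨h-1, by omega⟩)) := by
  have hs := s_pos hP
  have p0 := pin_lt ω (pos_lt β.2 (show h - 1 < h by omega))
  have key : ∀ ω' : Om s m A h, cons ω L K ω' → ∃ β' < 2*s,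
      sp s h (fl β') = K (bh ω (β, (⟨h, by omega⟩ : Fin (h+1)))) ∧
      (ω'.1 (pc ω (β, ⟨h-1, by omega⟩)) : ℕ) = β'*h + (h-1) := by
    intro ω' hc
    obtain ⟨l', h1, h2⟩ := hc.1 _ hl
    have e2 : bh ω (β, (⟨h, by omega⟩ : Fin (h+1))) = sp s h (fl β) := by
      unfold bh hd; simp
    have et : tl ω β h = s + pin ω (β*h+(h-1)) := by
      unfold tl; rw [if_neg (by omega)]
    have e1 : bt ω (β, (⟨h, by omega⟩ : Fin (h+1))) = s + pin ω (β*h+(h-1)) + 1 := by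
      unfold bt; simp only; rw [et]; unfold nxb; rw [if_pos (by omega)]
    have hmem := bh_mem (ω := ω) hl
    have hfl := fl_lt β.2
    have hnr : ∀ j < 2*s*h, bh ω' l' ≠ s + j := by
      intro j hj e
      rw [e] at h2
      by_cases hcase : bh ω (β, (⟨h, by omega⟩ : Fin (h+1))) ≤ s + 2*s*h
      · rw [K_lo hP hc hmem hcase, e2] at h2
        exact sp_ne hfl hj h2.symm
      · have := K_hi hP hc hmem (by omega)
        omega
    have hi'h : (l'.2:ℕ) = h := by
      by_contra hn
      have hlt' : (l'.2:ℕ) < h := by have := l'.2.2; omega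
      refine hnr _ (pin_lt ω' (pos_lt l'.1.2 hlt')) ?_
      unfold bh hd; rw [if_pos hlt']
    refine ⟨l'.1, l'.1.2, ?_, ?_⟩
    · rw [← h2]; unfold bh hd; rw [if_neg (by omega)]
    · rw [K_lo hP hc (bt_mem hl) (by rw [e1]; omega), e1] at h1
      have t1 : tl ω' l'.1 l'.2 = s + pin ω (β*h+(h-1)) := by
        apply nxb_inj (tl_lt ω' l'.1.2 (Nat.lt_succ_iff.1 l'.2.2)) (by omega) (h := h) (s := s)
        have : nxb s h (s + pin ω (β*h+(h-1))) = s + pin ω (β*h+(h-1)) + 1 := by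
          unfold nxb; rw [if_pos (by omega)]
        rw [this]; exact h1
      unfold tl at t1; rw [if_neg (by omega), hi'h] at t1
      exact perm_of_pin ω' (pos_lt l'.1.2 (show h - 1 < h by omega)) (a := pc ω (β, ⟨h-1, by omega⟩)) (by
        rw [pc_val]; simp only; omega)
  obtain ⟨b1, hb1, e1, f1⟩ := key ω' hc
  obtain ⟨b2, hb2, e2, f2⟩ := key ω'' hc'
  have : b1 = b2 := fl_inj (sp_inj (fl_lt hb1) (fl_lt hb2) (e1.trans e2.symm))
  apply Fin.ext
  rw [f1, f2, this]

/-- end-anchored positions are determined -/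
lemma anchored (hP : Par s m A h) {ω ω' ω'' : Om s m A h} {L} {K : ℕ → ℕ} (hc : cons ω L K ω')
    (hc' : cons ω L K ω'') {β : Fin (2*s)} (d : ℕ) : ∀ (i : ℕ) (hi : i < h), i + d + 1 = h →
    (∀ i' : Fin (h+1), i < (i':ℕ) → (β, i') ∈ L) →
    ω'.1 (pc ω (β, ⟨i, hi⟩)) = ω''.1 (pc ω (β, ⟨i, hi⟩)) := by
  induction d with
  | zero =>
    intro i hi e hL
    have : i = h - 1 := by omega
    subst this
    exact link_rs hP hc hc' (by omega) (hL ⟨h, by omega⟩ (by simp only; omega))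
  | succ d ih =>
    intro i hi e hL
    have h1 := ih (i+1) (by omega) (by omega) (fun i' hi' => hL i' (by omega))
    have hl := hL ⟨i+1, by omega⟩ (by simp)
    have h2 := link_rr hP hc (by omega) hl
    have h3 := link_rr hP hc' (by omega) hl
    apply Fin.ext
    have := congrArg Fin.val h1
    omega

open Classical in
/-- determined positions -/
noncomputable def Dp (L : Finset (Fin (2*s) × Fin (h+1))) : Finset (Fin (2*s) × Fin h) :=
  univ.filter fun q => (q.1, q.2.castSucc) ∈ L ∨ ∀ i' : Fin (h+1), (q.2:ℕ) < i' → (q.1, i') ∈ L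

open Classical in
noncomputable def full (L : Finset (Fin (2*s) × Fin (h+1))) : Finset (Fin (2*s)) :=
  univ.filter fun β => ∀ i, (β, i) ∈ L

lemma full_card (L : Finset (Fin (2*s) × Fin (h+1))) : (full L).card * (h+1) ≤ L.card := by
  have : ((full L) ×ˢ (univ : Finset (Fin (h+1)))).card ≤ L.card := by
    apply card_le_card
    rintro ⟨β, i⟩ hq
    rw [mem_product] at hq
    exact (mem_filter.1 hq.1).2 i
  rwa [card_product, card_univ, Fintype.card_fin] at this

lemma Dp_card (L : Finset (Fin (2*s) × Fin (h+1))) : L.card ≤ (Dp L).card + (full L).card := by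
  classical
  rcases Nat.eq_zero_or_pos h with rfl | h0
  · have := full_card L
    have h2 : L.card ≤ (full L).card := by
      apply card_le_card_of_injOn (fun q => q.1)
      · intro q hq
        unfold full
        simp only [coe_filter, Set.mem_ofPred_eq, mem_univ, true_and]
        intro i
        have : (q.1, i) = q := Prod.ext rfl (Subsingleton.elim (α := Fin 1) _ _)
        rw [this]; exact hq
      · intro q _ q' _ e
        exact Prod.ext e (Subsingleton.elim (α := Fin 1) _ _)
    omega
  let E := (full L).image (fun β => (β, (0 : Fin (h+1))))
  have hE : E.card ≤ (full L).card := card_image_le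
  have hsd : L.card ≤ (L \ E).card + E.card := by
    have := le_card_sdiff E L; omega
  have hinj : (L \ E).card ≤ (Dp L).card := by
    let g : Fin (2*s) × Fin (h+1) → Fin (2*s) × Fin h := fun q =>
      if hq : (q.2:ℕ) < h ∧ ∃ i' : Fin (h+1), (q.2:ℕ) < i' ∧ (q.1, i') ∉ L then (q.1, ⟨q.2, hq.1⟩)
      else (q.1, ⟨q.2 - 1, by have := q.2.2; omega⟩)
    have hg1 : ∀ q, ((q.2:ℕ) < h ∧ ∃ i' : Fin (h+1), (q.2:ℕ) < i' ∧ (q.1, i') ∉ L) →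
      (g q).1 = q.1 ∧ ((g q).2:ℕ) = q.2 := by
      intro q hq; simp only [g]; rw [dif_pos hq]; simp
    have hg2 : ∀ q, ¬((q.2:ℕ) < h ∧ ∃ i' : Fin (h+1), (q.2:ℕ) < i' ∧ (q.1, i') ∉ L) →
      (g q).1 = q.1 ∧ ((g q).2:ℕ) = q.2 - 1 := by
      intro q hq; simp only [g]; rw [dif_neg hq]; simp
    have hlater : ∀ q ∈ L, ¬((q.2:ℕ) < h ∧ ∃ i' : Fin (h+1), (q.2:ℕ) < i' ∧ (q.1, i') ∉ L) →
        ∀ i' : Fin (h+1), (q.2:ℕ) ≤ i' → (q.1, i') ∈ L := by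
      intro q hq hn i' hi'
      rcases hi'.eq_or_lt with e | e
      · have : i' = q.2 := Fin.ext e.symm
        rw [this]; exact hq
      · by_contra hc
        exact hn ⟨by have := i'.2; omega, i', e, hc⟩
    have hne : ∀ q ∈ L \ E, ¬((q.2:ℕ) < h ∧ ∃ i' : Fin (h+1), (q.2:ℕ) < i' ∧ (q.1, i') ∉ L) →
        (q.2:ℕ) ≠ 0 := by
      intro q hq hn h00
      rw [mem_sdiff] at hq
      apply hq.2
      have hl := hlater q hq.1 hn
      simp only [E, mem_image]
      refine ⟨q.1, ?_, Prod.ext rfl (Fin.ext h00.symm)⟩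
      unfold full
      rw [mem_filter]
      exact ⟨mem_univ _, fun i => hl i (by omega)⟩
    apply card_le_card_of_injOn g
    · intro q hq
      have hqL := (mem_sdiff.1 hq).1
      by_cases hc : (q.2:ℕ) < h ∧ ∃ i' : Fin (h+1), (q.2:ℕ) < i' ∧ (q.1, i') ∉ L
      · have := hg1 q hc
        rw [mem_coe]; unfold Dp; rw [mem_filter]
        refine ⟨mem_univ _, Or.inl ?_⟩
        have e : ((g q).1, (g q).2.castSucc) = q := Prod.ext this.1 (Fin.ext this.2)
        rw [e]; exact hqL
      · have := hg2 q hc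
        have h0 := hne q hq hc
        rw [mem_coe]; unfold Dp; rw [mem_filter]
        refine ⟨mem_univ _, Or.inr ?_⟩
        intro i' hi'
        rw [this.1]
        exact hlater q hqL hc i' (by omega)
    · intro q hq q' hq' e
      have hqL := (mem_sdiff.1 hq).1
      have hqL' := (mem_sdiff.1 hq').1
      have e1 : (g q).1 = (g q').1 := by rw [e]
      have e2 : ((g q).2:ℕ) = (g q').2 := by rw [e]
      by_cases hc : (q.2:ℕ) < h ∧ ∃ i' : Fin (h+1), (q.2:ℕ) < i' ∧ (q.1, i') ∉ L <;>
      by_cases hc' : (q'.2:ℕ) < h ∧ ∃ i' : Fin (h+1), (q'.2:ℕ) < i' ∧ (q'.1, i') ∉ L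
      · have a := hg1 q hc; have b := hg1 q' hc'
        exact Prod.ext (by rw [← a.1, ← b.1, e1]) (Fin.ext (by omega))
      · exfalso
        have a := hg1 q hc; have b := hg2 q' hc'
        have h0 := hne q' hq' hc'
        obtain ⟨_, i', hi', hi2⟩ := hc
        apply hi2
        have := hlater q' hqL' hc' i' (by omega)
        rwa [← b.1, ← e1, a.1] at this
      · exfalso
        have a := hg2 q hc; have b := hg1 q' hc'
        have h0 := hne q hq hc
        obtain ⟨_, i', hi', hi2⟩ := hc'
        apply hi2
        have := hlater q hqL hc i' (by omega)
        rwa [← a.1, e1, b.1] at this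
      · have a := hg2 q hc; have b := hg2 q' hc'
        have h0 := hne q hq hc
        have h0' := hne q' hq' hc'
        exact Prod.ext (by rw [← a.1, ← b.1, e1]) (Fin.ext (by omega))
  omega

lemma perm_bound (hP : Par s m A h) (ω : Om s m A h) (L) (K : ℕ → ℕ)
    (PP : Finset (Equiv.Perm (Fin (2*s*h)))) (hPP : ∀ π ∈ PP, ∃ ω' : Om s m A h, cons ω L K ω' ∧ ω'.1 = π) :
    PP.card ≤ (2*s*h - (Dp L).card).factorial := by
  classical
  have hc : (Dp L).card = ((Dp L).image (pc ω)).card := (card_image_of_injective _ (pc_injective ω)).symm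
  rw [hc]
  apply perm_count
  intro a ha
  rw [mem_image] at ha
  obtain ⟨⟨β, ⟨i, hi⟩⟩, hq, rfl⟩ := ha
  have hq2 := (mem_filter.1 hq).2
  by_cases hall : ∀ i' : Fin (h+1), i < (i':ℕ) → (β, i') ∈ L
  · right
    intro π hπ π' hπ'
    obtain ⟨w, hw, rfl⟩ := hPP π hπ
    obtain ⟨w', hw', rfl⟩ := hPP π' hπ'
    exact anchored hP hw hw' (h - i - 1) i hi (by omega) hall
  · have hl : (β, (⟨i, by omega⟩ : Fin (h+1))) ∈ L := by
      rcases hq2 with h1 | h1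
      · exact h1
      · exact absurd h1 hall
    rcases Nat.eq_zero_or_pos i with rfl | h0
    · right
      intro π hπ π' hπ'
      obtain ⟨w, hw, rfl⟩ := hPP π hπ
      obtain ⟨w', hw', rfl⟩ := hPP π' hπ'
      exact link_sr hP hw hw' hi hl
    · left
      obtain ⟨j, rfl⟩ : ∃ j, i = j + 1 := ⟨i - 1, by omega⟩
      refine ⟨pc ω (β, ⟨j, by omega⟩), ?_⟩
      intro π hπ
      obtain ⟨w, hw, rfl⟩ := hPP π hπ
      exact link_rr hP hw hi hl

end counts
end CombProof


namespace CombProof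
open Finset
set_option linter.unusedSectionVars false

section counts2
variable {s m A h : ℕ}

lemma r_det {ω ω' ω'' : Om s m A h} {L} {K : ℕ → ℕ} (hP : Par s m A h) (hc : cons ω L K ω')
    (hc' : cons ω L K ω'') {j : ℕ} (hj : j < 2*s*h+1) (hU : s + j ∈ UU ω L) :
    ω'.2.1 ⟨j, hj⟩ = ω''.2.1 ⟨j, hj⟩ := by
  have h1 := (hc.2 _ hU).2
  have h2 := (hc'.2 _ hU).2
  rw [K_lo hP hc hU (by omega), bd_y ω' (by omega)] at h1
  rw [K_lo hP hc' hU (by omega), bd_y ω'' (by omega)] at h2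
  have h3 : rr ω' j = rr ω'' j := by
    have := h1.trans h2.symm
    unfold yb at this; linarith
  unfold rr at h3
  rw [dif_pos hj, dif_pos hj] at h3
  exact Fin.ext (by exact_mod_cast h3)

lemma xi_det {ω ω' ω'' : Om s m A h} {L} {K : ℕ → ℕ} (hP : Par s m A h) (hc : cons ω L K ω')
    (hc' : cons ω L K ω'') {j : ℕ} (hj : j < s) (hU : j ∈ UU ω L) :
    ω'.2.2 ⟨j, hj⟩ = ω''.2.2 ⟨j, hj⟩ := by
  have h1 := (hc.2 _ hU).2
  have h2 := (hc'.2 _ hU).2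
  rw [K_lo hP hc hU (by omega), bd_x ω' (by omega)] at h1
  rw [K_lo hP hc' hU (by omega), bd_x ω'' (by omega)] at h2
  have h3 : xi ω' j = xi ω'' j := by
    have := h1.trans h2.symm
    unfold xb at this; rw [if_pos hj, if_pos hj] at this; linarith
  unfold xi at h3
  rw [dif_pos hj, dif_pos hj] at h3
  exact Fin.ext (by exact_mod_cast h3)

lemma xi_det_z {ω : Om s m A h} {L} {K : ℕ → ℕ} {π : Equiv.Perm (Fin (2*s*h))}
    {r : Fin (2*s*h+1) → Fin m} {ξ ξ' : Fin s → Fin A}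
    (hc : cons ω L K (π, r, ξ)) (hc' : cons ω L K (π, r, ξ')) {i k : ℕ} (hk : k < s) (hs : 0 < s)
    (hU : i ∈ UU ω L) (hK : K i = s + 2*s*h + k) (h0 : ξ ⟨0, hs⟩ = ξ' ⟨0, hs⟩) :
    ξ ⟨k, hk⟩ = ξ' ⟨k, hk⟩ := by
  have h1 := (hc.2 _ hU).2
  have h2 := (hc'.2 _ hU).2
  rw [hK, bd_z] at h1 h2
  have h3 := h1.trans h2.symm
  rw [zb_eq _ hk, zb_eq _ hk] at h3
  have eD : Dk (s := s) (m := m) (A := A) (h := h) (π, r, ξ) k = Dk (s := s) (m := m) (A := A) (h := h) (π, r, ξ') k := rfl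
  have er : rr (s := s) (m := m) (A := A) (h := h) (π, r, ξ) (2*s*h) = rr (s := s) (m := m) (A := A) (h := h) (π, r, ξ') (2*s*h) := rfl
  have ex : xi (s := s) (m := m) (A := A) (h := h) (π, r, ξ) 0 = xi (s := s) (m := m) (A := A) (h := h) (π, r, ξ') 0 := by
    unfold xi; rw [dif_pos hs, dif_pos hs]; simp only; rw [h0]
  rw [eD, er, ex] at h3
  have h4 : xi (s := s) (m := m) (A := A) (h := h) (π, r, ξ) k = xi (s := s) (m := m) (A := A) (h := h) (π, r, ξ') k := by linarith
  unfold xi at h4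
  rw [dif_pos hk, dif_pos hk] at h4
  exact Fin.ext (by exact_mod_cast h4)

lemma SK_card (hP : Par s m A h) (ω : Om s m A h) (L) (K : ℕ → ℕ) (S : Finset (Om s m A h))
    (hS : ∀ ω' ∈ S, cons ω L K ω') :
    S.card ≤ (2*s*h - (Dp L).card).factorial *
      m ^ (2*s*h+1 - ((UU ω L).filter fun i => s ≤ i ∧ i ≤ s+2*s*h).card) *
      A ^ (s - max ((UU ω L).filter fun i => i < s).card ((UU ω L).filter fun i => s+2*s*h < i).card) := by
  classical
  have hs := s_pos hP
  let PP := S.image (fun ω' => ω'.1)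
  let RR := S.image (fun ω' => ω'.2.1)
  have hPP : PP.card ≤ (2*s*h - (Dp L).card).factorial := by
    apply perm_bound hP ω L K
    intro π hπ
    obtain ⟨ω', h1, h2⟩ := mem_image.1 hπ
    exact ⟨ω', hS ω' h1, h2⟩
  have hRR : RR.card ≤ m ^ (2*s*h+1 - ((UU ω L).filter fun i => s ≤ i ∧ i ≤ s+2*s*h).card) := by
    let KY : Finset (Fin (2*s*h+1)) := univ.filter fun j => s + (j:ℕ) ∈ UU ω L
    have hle : ((UU ω L).filter fun i => s ≤ i ∧ i ≤ s+2*s*h).card ≤ KY.card := by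
      have : ((UU ω L).filter fun i => s ≤ i ∧ i ≤ s+2*s*h) ⊆ KY.image (fun j : Fin (2*s*h+1) => s + (j:ℕ)) := by
        intro i hi
        rw [mem_filter] at hi
        rw [mem_image]
        refine ⟨⟨i - s, by omega⟩, ?_, ?_⟩
        · simp only [KY, mem_filter, mem_univ, true_and]
          rw [show s + (i - s) = i by omega]; exact hi.1
        · simp only; omega
      exact (card_le_card this).trans card_image_le
    have h1 := fun_count RR KY (by
      intro f hf g hg hfg
      obtain ⟨w, hw, rfl⟩ := mem_image.1 hf
      obtain ⟨w', hw', rfl⟩ := mem_image.1 hg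
      funext j
      by_cases hj : j ∈ KY
      · exact r_det hP (hS w hw) (hS w' hw') j.2 (mem_filter.1 hj).2
      · exact hfg j hj)
    rw [Fintype.card_fin] at h1
    exact h1.trans (Nat.pow_le_pow_right hP.hm (by omega))
  have hA : 1 ≤ A := hP.hm.trans hP.hA
  have hfib : ∀ b ∈ PP ×ˢ RR, (S.filter fun ω' => (ω'.1, ω'.2.1) = b).card ≤
      A ^ (s - max ((UU ω L).filter fun i => i < s).card ((UU ω L).filter fun i => s+2*s*h < i).card) := by
    rintro ⟨π, r⟩ _
    let Ξ := (S.filter fun ω' => (ω'.1, ω'.2.1) = (π, r)).image (fun ω' => ω'.2.2)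
    have hΞ : ∀ ξ ∈ Ξ, cons ω L K (π, r, ξ) := by
      intro ξ hξ
      obtain ⟨w, hw, rfl⟩ := mem_image.1 hξ
      rw [mem_filter, Prod.mk.injEq] at hw
      have := hS w hw.1
      rw [← hw.2.1, ← hw.2.2]; exact this
    have hcard : (S.filter fun ω' => (ω'.1, ω'.2.1) = (π, r)).card = Ξ.card := by
      symm; apply card_image_of_injOn
      intro w hw w' hw' e
      rw [mem_coe, mem_filter, Prod.mk.injEq] at hw hw'
      exact Prod.ext (hw.2.1.trans hw'.2.1.symm) (Prod.ext (hw.2.2.trans hw'.2.2.symm) e)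
    rw [hcard]
    rcases Ξ.eq_empty_or_nonempty with hE | ⟨ξ0, hξ0⟩
    · rw [hE]; simp
    have c1 : Ξ.card ≤ A ^ (s - ((UU ω L).filter fun i => i < s).card) := by
      let KX : Finset (Fin s) := univ.filter fun j => (j:ℕ) ∈ UU ω L
      have hle : ((UU ω L).filter fun i => i < s).card ≤ KX.card := by
        have : ((UU ω L).filter fun i => i < s) ⊆ KX.image (fun j : Fin s => (j:ℕ)) := by
          intro i hi
          rw [mem_filter] at hi
          rw [mem_image]
          exact ⟨⟨i, hi.2⟩, by simp only [KX, mem_filter, mem_univ, true_and]; exact hi.1, rfl⟩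
        exact (card_le_card this).trans card_image_le
      have h1 := fun_count Ξ KX (by
        intro f hf g hg hfg
        funext j
        by_cases hj : j ∈ KX
        · exact xi_det hP (hΞ f hf) (hΞ g hg) j.2 (mem_filter.1 hj).2
        · exact hfg j hj)
      rw [Fintype.card_fin] at h1
      exact h1.trans (Nat.pow_le_pow_right hA (by omega))
    have c2 : Ξ.card ≤ A ^ (s - ((UU ω L).filter fun i => s+2*s*h < i).card) := by
      let KI : Finset (Fin s) := univ.filter fun j => ∃ i ∈ UU ω L, s+2*s*h < i ∧ K i = s+2*s*h+j
      have hc0 := hΞ ξ0 hξ0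
      have hle : ((UU ω L).filter fun i => s+2*s*h < i).card ≤ KI.card := by
        have hsub : ((UU ω L).filter fun i => s+2*s*h < i).image K ⊆ KI.image (fun j : Fin s => s+2*s*h+(j:ℕ)) := by
          intro i' hi'
          obtain ⟨i, hi, rfl⟩ := mem_image.1 hi'
          rw [mem_filter] at hi
          have a1 := K_hi hP hc0 hi.1 hi.2
          have a2 := (hc0.2 i hi.1).1
          rw [mem_image]
          refine ⟨⟨K i - (s+2*s*h), by omega⟩, ?_, by simp only; omega⟩
          simp only [KI, mem_filter, mem_univ, true_and]
          exact ⟨i, hi.1, hi.2, by omega⟩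
        have hinj : Set.InjOn K ((UU ω L).filter fun i => s+2*s*h < i) := by
          intro i hi j hj e
          rw [mem_coe, mem_filter] at hi hj
          exact K_inj hP hc0 hi.1 hj.1 e
        rw [← card_image_of_injOn hinj]
        exact (card_le_card hsub).trans card_image_le
      have h0 : (⟨0, hs⟩ : Fin s) ∉ KI := by
        intro hm
        obtain ⟨i, hi, hi2, hi3⟩ := (mem_filter.1 hm).2
        have := K_hi hP hc0 hi hi2
        simp only at hi3; omega
      have h1 := fun_count Ξ KI (by
        intro f hf g hg hfg
        funext j
        by_cases hj : j ∈ KI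
        · obtain ⟨i, hi, hi2, hi3⟩ := (mem_filter.1 hj).2
          exact xi_det_z (hΞ f hf) (hΞ g hg) j.2 hs hi hi3 (hfg _ h0)
        · exact hfg j hj)
      rw [Fintype.card_fin] at h1
      exact h1.trans (Nat.pow_le_pow_right hA (by omega))
    rcases le_total ((UU ω L).filter fun i => i < s).card ((UU ω L).filter fun i => s+2*s*h < i).card with hh | hh
    · rw [max_eq_right hh]; exact c2
    · rw [max_eq_left hh]; exact c1
  have hmaps : ∀ ω' ∈ S, (ω'.1, ω'.2.1) ∈ PP ×ˢ RR := by
    intro w hw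
    exact mem_product.2 ⟨mem_image_of_mem _ hw, mem_image_of_mem _ hw⟩
  have := card_le_mul_card_image_of_maps_to hmaps _ hfib
  rw [card_product] at this
  calc S.card ≤ _ := this
    _ ≤ _ := by
      rw [mul_comm]
      exact Nat.mul_le_mul_right _ (Nat.mul_le_mul hPP hRR)

lemma S_card (hP : Par s m A h) {Γ Q : ℕ} {ω : Om s m A h} (hω : ω ∈ O0 s m A h Γ)
    (hQ : 2 * ((m:ℤ) + A + Γ) < (Q + 1) * ((s:ℤ) - A - 4 * m * h)) (L)
    (S : Finset (Om s m A h)) (hS : ∀ ω' ∈ S, ω' ∈ O0 s m A h Γ ∧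
      ∀ l ∈ L, ∃ l', TT ω' l' = TT ω l ∧ HH ω' l' = HH ω l) :
    S.card ≤ (2*Q+1) ^ ((UU ω L).filter fun i => s+2*s*h < i).card * ((2*s*h - (Dp L).card).factorial *
      m ^ (2*s*h+1 - ((UU ω L).filter fun i => s ≤ i ∧ i ≤ s+2*s*h).card) *
      A ^ (s - max ((UU ω L).filter fun i => i < s).card ((UU ω L).filter fun i => s+2*s*h < i).card)) := by
  classical
  let Kf : ({i // i ∈ (UU ω L).filter (fun i => s + 2*s*h < i)} → Fin (2*Q+1)) → ℕ → ℕ := fun F i =>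
    if hi : i ∈ (UU ω L).filter (fun i => s + 2*s*h < i) then i + F ⟨i, hi⟩ - Q else i
  have hsub : S ⊆ (univ : Finset ({i // i ∈ (UU ω L).filter (fun i => s + 2*s*h < i)} → Fin (2*Q+1))).biUnion
      fun F => S.filter fun ω' => cons ω L (Kf F) ω' := by
    intro w hw
    obtain ⟨F, hF⟩ := cons_exists hP hω (hS w hw).1 hQ (hS w hw).2
    rw [mem_biUnion]
    exact ⟨F, mem_univ _, mem_filter.2 ⟨hw, hF⟩⟩
  refine (card_le_card hsub).trans (card_biUnion_le.trans ?_)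
  refine (sum_le_sum fun F _ => SK_card hP ω L (Kf F) _ fun ω' hω' => (mem_filter.1 hω').2).trans ?_
  rw [sum_const, card_univ, Fintype.card_fun, Fintype.card_fin, Fintype.card_coe, smul_eq_mul]

lemma U_split (U : Finset ℕ) (s N : ℕ) : U.card = (U.filter fun i => i < s).card +
    (U.filter fun i => s ≤ i ∧ i ≤ s+N).card + (U.filter fun i => s+N < i).card := by
  rw [← card_union_of_disjoint, ← card_union_of_disjoint]
  · congr 1; ext i; simp only [mem_union, mem_filter]
    constructor
    · intro hi; simp only [hi, true_and]; omega
    · rintro ((h|h)|h) <;> exact h.1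
  · rw [disjoint_left]; intro i; simp only [mem_union, mem_filter]; rintro (⟨_, h⟩|⟨_, h⟩) ⟨_, h'⟩ <;> omega
  · rw [disjoint_left]; intro i; simp only [mem_filter]; rintro ⟨_, h⟩ ⟨_, h'⟩; omega

end counts2
end CombProof


namespace CombProof
open Finset
set_option linter.unusedSectionVars false

section spread
variable {s m A h : ℕ}

lemma fact_bound {N d t b : ℕ} (hd : d ≤ N) (htd : t ≤ d + b) (hb : b * (h+1) ≤ t) (hN : N ≤ 2^h) :
    (N - d).factorial * N ^ t ≤ 8 ^ t * N.factorial := by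
  have hbt : b ≤ t := by nlinarith
  have h1 : (N - d).factorial ≤ (N - (t - b)).factorial := Nat.factorial_le (by omega)
  have h2 : (N - (t-b)).factorial * N ^ (t-b) ≤ 4 ^ (t-b) * N.factorial := by
    have := factorial_ratio (N := N) (d := t - b) (by omega)
    exact_mod_cast this
  have h3 : N ^ b ≤ 2 ^ t := by
    calc N ^ b ≤ (2^h)^b := Nat.pow_le_pow_left hN b
      _ = 2^(h*b) := (pow_mul _ _ _).symm
      _ ≤ 2^t := Nat.pow_le_pow_right (by norm_num) (by nlinarith)
  have h4 : 4 ^ (t-b) ≤ 4 ^ t := Nat.pow_le_pow_right (by norm_num) (by omega)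
  calc (N - d).factorial * N ^ t ≤ (N - (t-b)).factorial * N ^ t := Nat.mul_le_mul_right _ h1
    _ = ((N - (t-b)).factorial * N ^ (t-b)) * N ^ b := by
        rw [mul_assoc, ← pow_add, Nat.sub_add_cancel hbt]
    _ ≤ (4 ^ t * N.factorial) * 2 ^ t := Nat.mul_le_mul (h2.trans (Nat.mul_le_mul_right _ h4)) h3
    _ = 8 ^ t * N.factorial := by
        rw [show (8:ℕ) = 4 * 2 by norm_num, mul_pow]; ring

lemma spread_nat (hP : Par s m A h) {Γ Q : ℕ} {ω : Om s m A h} (hω : ω ∈ O0 s m A h Γ)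
    (hQ : 2 * ((m:ℤ) + A + Γ) < (Q + 1) * ((s:ℤ) - A - 4 * m * h))
    (hΓ : 0 < Γ) (hb : 2 * s * (2*s*h) * m^2 ≤ Γ^2) (hA : A = m^16) (hG : 2*Q+1 ≤ m^11)
    (hN : 2*s*h ≤ 2^h) (L : Finset (Fin (2*s) × Fin (h+1)))
    (S : Finset (Om s m A h)) (hS : ∀ ω' ∈ S, ω' ∈ O0 s m A h Γ ∧
      ∀ l ∈ L, ∃ l', TT ω' l' = TT ω l ∧ HH ω' l' = HH ω l) :
    S.card * (2*s*h) ^ L.card * m ^ (UU ω L).card ≤ 8 ^ L.card * (2 * (O0 s m A h Γ).card) := by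
  classical
  have hs := s_pos hP
  have hm := hP.hm
  have hc := S_card hP hω hQ L S hS
  set X := ((UU ω L).filter fun i => i < s).card with hX
  set Y := ((UU ω L).filter fun i => s ≤ i ∧ i ≤ s+2*s*h).card with hY
  set I := ((UU ω L).filter fun i => s+2*s*h < i).card with hI
  have hU : (UU ω L).card = X + Y + I := U_split _ _ _
  have hXs : X ≤ s := by
    have : ((UU ω L).filter fun i => i < s) ⊆ range s := by
      intro i hi; rw [mem_filter] at hi; exact mem_range.2 hi.2
    simpa using card_le_card this
  have hYs : Y ≤ 2*s*h+1 := by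
    have : ((UU ω L).filter fun i => s ≤ i ∧ i ≤ s+2*s*h) ⊆ Icc s (s+2*s*h) := by
      intro i hi; rw [mem_filter] at hi; exact mem_Icc.2 hi.2
    have := card_le_card this
    rw [Nat.card_Icc] at this; omega
  have hIs : I ≤ s := by
    have : ((UU ω L).filter fun i => s+2*s*h < i) ⊆ Ico (s+2*s*h) (s+2*s*h+s) := by
      intro i hi; rw [mem_filter] at hi; exact mem_Ico.2 ⟨hi.2.le, UU_lt hP ω L hi.1⟩
    have := card_le_card this
    rw [Nat.card_Ico] at this; omega
  set e := max X I with he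
  have hes : e ≤ s := max_le hXs hIs
  have hXe : X ≤ e := le_max_left _ _
  have hIe : I ≤ e := le_max_right _ _
  have hd : (Dp L).card ≤ 2*s*h := by
    have := card_le_univ (Dp L)
    rwa [Fintype.card_prod, Fintype.card_fin, Fintype.card_fin] at this
  have hf := fact_bound (N := 2*s*h) hd (Dp_card L) (full_card L) hN
  have hcard : Fintype.card (Om s m A h) = (2*s*h).factorial * (m ^ (2*s*h+1) * A ^ s) := by
    rw [Fintype.card_prod, Fintype.card_perm, Fintype.card_prod, Fintype.card_fun, Fintype.card_fun]
    simp
  have hgood := good_card (A := A) hΓ hb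
  rw [hcard] at hgood
  have hAe : m ^ (X + 12 * I) ≤ A ^ e := by
    rw [hA, ← pow_mul]; exact Nat.pow_le_pow_right hm (by omega)
  have hGI : (2*Q+1) ^ I ≤ m ^ (11 * I) := by
    rw [pow_mul]; exact Nat.pow_le_pow_left hG I
  have hAs : A ^ (s - e) * A ^ e = A ^ s := by rw [← pow_add, Nat.sub_add_cancel hes]
  have hmY : m ^ (2*s*h+1 - Y) * m ^ Y = m ^ (2*s*h+1) := by rw [← pow_add, Nat.sub_add_cancel hYs]
  calc S.card * (2*s*h) ^ L.card * m ^ (UU ω L).card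
      ≤ ((2*Q+1) ^ I * ((2*s*h - (Dp L).card).factorial * m ^ (2*s*h+1 - Y) * A ^ (s - e)))
          * (2*s*h) ^ L.card * m ^ (UU ω L).card :=
        Nat.mul_le_mul_right _ (Nat.mul_le_mul_right _ hc)
    _ ≤ (m ^ (11*I) * ((2*s*h - (Dp L).card).factorial * m ^ (2*s*h+1 - Y) * A ^ (s - e)))
          * (2*s*h) ^ L.card * m ^ (UU ω L).card :=
        Nat.mul_le_mul_right _ (Nat.mul_le_mul_right _ (Nat.mul_le_mul_right _ hGI))
    _ = ((2*s*h - (Dp L).card).factorial * (2*s*h) ^ L.card) * ((m ^ (2*s*h+1 - Y) * m ^ Y) *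
          (A ^ (s - e) * m ^ (X + 12 * I))) := by
        rw [hU, pow_add, pow_add, show X + 12 * I = X + I + 11 * I by ring, pow_add, pow_add]; ring
    _ ≤ (8 ^ L.card * (2*s*h).factorial) * ((m ^ (2*s*h+1 - Y) * m ^ Y) *
          (A ^ (s - e) * A ^ e)) :=
        Nat.mul_le_mul hf (Nat.mul_le_mul_left _ (Nat.mul_le_mul_left _ hAe))
    _ = 8 ^ L.card * ((2*s*h).factorial * (m ^ (2*s*h+1) * A ^ s)) := by rw [hAs, hmY]; ring
    _ ≤ _ := Nat.mul_le_mul_left _ hgood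

lemma spread_real (hP : Par s m A h) {Γ Q : ℕ} {ω : Om s m A h} (hω : ω ∈ O0 s m A h Γ)
    (hQ : 2 * ((m:ℤ) + A + Γ) < (Q + 1) * ((s:ℤ) - A - 4 * m * h))
    (hΓ : 0 < Γ) (hb : 2 * s * (2*s*h) * m^2 ≤ Γ^2) (hA : A = m^16) (hG : 2*Q+1 ≤ m^11)
    (hN : 2*s*h ≤ 2^h) (hsm : s ≤ 32 * (h * m)) (L : Finset (Fin (2*s) × Fin (h+1)))
    (S : Finset (Om s m A h)) (hS : ∀ ω' ∈ S, ω' ∈ O0 s m A h Γ ∧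
      ∀ l ∈ L, ∃ l', TT ω' l' = TT ω l ∧ HH ω' l' = HH ω l) :
    (S.card : ℝ) ≤ (O0 s m A h Γ).card * ((256 / (s:ℝ)^2) ^ L.card *
      (1 / (m:ℝ)) ^ ((L.image (TT ω) ∪ L.image (HH ω)).card - L.card)) := by
  classical
  have hs := s_pos hP
  have hm := hP.hm
  rcases L.eq_empty_or_nonempty with rfl | hne
  · simp only [card_empty, pow_zero, image_empty, union_idempotent, mul_one, Nat.sub_self]
    have : S ⊆ O0 s m A h Γ := fun w hw => (hS w hw).1
    exact_mod_cast card_le_card this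
  have h1 := spread_nat hP hω hQ hΓ hb hA hG hN L S hS
  rw [UU_card hP]
  have htU : L.card ≤ (UU ω L).card := by
    rw [← UU_card hP, ← card_image_of_injective L (TT_injective hP ω)]
    exact card_le_card subset_union_left
  set o := (UU ω L).card - L.card with ho
  have hU : (UU ω L).card = L.card + o := by omega
  rw [hU, pow_add] at h1
  set t := L.card with ht
  have ht1 : 1 ≤ t := hne.card_pos
  have h2 : S.card * (s*s) ^ t * m ^ o ≤ 256 ^ t * (O0 s m A h Γ).card := by
    have e1 : s * s ≤ 16 * ((2*s*h) * m) := by nlinarith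
    calc S.card * (s*s) ^ t * m ^ o ≤ S.card * (16 * ((2*s*h) * m)) ^ t * m ^ o :=
          Nat.mul_le_mul_right _ (Nat.mul_le_mul_left _ (Nat.pow_le_pow_left e1 t))
      _ = 16 ^ t * (S.card * (2*s*h)^t * (m^t * m^o)) := by rw [mul_pow, mul_pow]; ring
      _ ≤ 16 ^ t * (8 ^ t * (2 * (O0 s m A h Γ).card)) := Nat.mul_le_mul_left _ h1
      _ = (128 ^ t * 2) * (O0 s m A h Γ).card := by
          rw [show (128:ℕ) = 16 * 8 by norm_num, mul_pow]; ring
      _ ≤ (128 ^ t * 2 ^ t) * (O0 s m A h Γ).card := by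
          apply Nat.mul_le_mul_right; apply Nat.mul_le_mul_left
          calc 2 = 2^1 := rfl
            _ ≤ 2 ^ t := Nat.pow_le_pow_right (by norm_num) ht1
      _ = _ := by rw [← mul_pow]; norm_num
  have h3 : (S.card : ℝ) * ((s:ℝ)*s) ^ t * (m:ℝ) ^ o ≤ 256 ^ t * (O0 s m A h Γ).card := by exact_mod_cast h2
  have hsr : (0:ℝ) < s := by exact_mod_cast hs
  have hmr : (0:ℝ) < m := by exact_mod_cast hm
  rw [div_pow, div_pow, one_pow]
  have : ((O0 s m A h Γ).card : ℝ) * (256 ^ t / ((s:ℝ)^2) ^ t * (1 / (m:ℝ) ^ o)) =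
    (256 ^ t * (O0 s m A h Γ).card) / (((s:ℝ)*s) ^ t * (m:ℝ) ^ o) := by
    rw [sq, div_mul_div_comm, mul_one, mul_div_assoc', mul_comm ((256:ℝ)^t)]
  rw [this, le_div_iff₀ (by positivity)]
  linarith

lemma cube_le (h : ℕ) (hh : 20 ≤ h) : 64 * h^3 ≤ 2^h := by
  induction h, hh using Nat.le_induction with
  | base => norm_num
  | succ h hh ih =>
    rw [pow_succ 2 h]
    have : (h+1)^3 ≤ 2 * h^3 := by nlinarith [mul_le_mul hh hh (by omega) (by omega)]
    nlinarith

lemma root_exists (s : ℕ) : ∃ m, m^17 ≤ s ∧ s < (m+1)^17 := by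
  have hx : ∃ m, s < (m+1)^17 := ⟨s, by
      calc s < s + 1 := by omega
        _ = (s+1)^1 := (pow_one _).symm
        _ ≤ (s+1)^17 := Nat.pow_le_pow_right (by omega) (by norm_num)⟩
  classical
  refine ⟨Nat.find hx, ?_, Nat.find_spec hx⟩
  rcases Nat.eq_zero_or_pos (Nat.find hx) with h0 | h0
  · rw [h0]; simp
  · have := Nat.find_min hx (m := Nat.find hx - 1) (by omega)
    rw [Nat.sub_add_cancel h0] at this
    exact not_lt.1 this

set_option maxHeartbeats 2000000 in
lemma params_aux (s m : ℕ) (hm : 201 ≤ m) (hm1 : m^17 ≤ s) (hm2 : s < (m+1)^17) : ∃ A h Γ Q : ℕ, Par s m A h ∧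
    2 * ((m:ℤ) + A + Γ) < (Q + 1) * ((s:ℤ) - A - 4 * m * h) ∧ 0 < Γ ∧
    2 * s * (2*s*h) * m^2 ≤ Γ^2 ∧ A = m^16 ∧ 2*Q+1 ≤ m^11 ∧ 2*s*h ≤ 2^h ∧ s ≤ 32 * (h * m) ∧
    s * s ≤ m ^ 68 := by
  have hmpos : 0 < 16 * m := by omega
  set h := s / (16*m) with hh
  have hd1 : 16 * m * h ≤ s := Nat.mul_div_le s (16*m)
  have hd2 : s < 16 * m * (h+1) := by
    have := Nat.lt_mul_div_succ s hmpos
    exact this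
  have hA : m^16 * m ≤ s := by rw [← pow_succ]; exact hm1
  have hA1 : 201 * m^16 ≤ s := by nlinarith [Nat.mul_le_mul_left (m^16) hm]
  have hh1 : m ≤ h := by
    rw [hh, Nat.le_div_iff_mul_le hmpos]
    have e1 : m * (16*m) ≤ m^3 := by nlinarith [Nat.mul_le_mul_right (m*m) hm]
    have e2 : m^3 ≤ m^17 := Nat.pow_le_pow_right (by omega) (by norm_num)
    exact (e1.trans e2).trans hm1
  have hs32 : s ≤ 32 * (h * m) := by nlinarith
  have hmle : m ≤ m^16 := by
    calc m = m^1 := (pow_one m).symm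
      _ ≤ m^16 := Nat.pow_le_pow_right (by omega) (by norm_num)
  have hm10 : 1 ≤ m^10 := Nat.one_le_pow _ _ (by omega)
  have hspos : 1 ≤ s := le_trans (Nat.one_le_pow _ _ (by omega)) hm1
  have hlast : 3 * m^16 + 6 * h * m < s := by
    generalize m^16 = a at hA1 hmle
    have e : 16 * m * h = 16 * (h * m) := by ring
    have e' : 6 * h * m = 6 * (h * m) := by ring
    rw [e] at hd1
    rw [e']
    generalize h * m = b at hd1
    omega
  refine ⟨m^16, h, s * m^10, 8 * m^10, ⟨by omega, hmle, by omega, hlast⟩, ?_, by positivity,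
    ?_, rfl, ?_, ?_, hs32, ?_⟩
  · have b1 : (201:ℤ) * (m:ℤ)^16 ≤ s := by exact_mod_cast hA1
    have b2 : 16 * (m:ℤ) * h ≤ s := by exact_mod_cast hd1
    have b3 : (m:ℤ) ≤ (m:ℤ)^16 := by exact_mod_cast hmle
    have b4 : (1:ℤ) ≤ (m:ℤ)^10 := by exact_mod_cast hm10
    have b5 : (1:ℤ) ≤ s := by exact_mod_cast hspos
    have b6 : (0:ℤ) ≤ (m:ℤ)^16 := by positivity
    have hw : (s:ℤ) ≤ 2 * ((s:ℤ) - (m:ℤ)^16 - 4 * m * h) := by linarith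
    have hl : 2 * ((m:ℤ) + (m:ℤ)^16 + s * (m:ℤ)^10) ≤ 4 * (s * (m:ℤ)^10) := by nlinarith
    push_cast
    have hr : (8 * (m:ℤ)^10 + 1) * s ≤ (8 * (m:ℤ)^10 + 1) * (2 * ((s:ℤ) - (m:ℤ)^16 - 4 * m * h)) :=
      mul_le_mul_of_nonneg_left hw (by positivity)
    have he : (8 * (m:ℤ)^10 + 1) * s = 2 * (4 * (s * (m:ℤ)^10)) + s := by ring
    linarith
  · -- 4 h m² ≤ m^20
    have e1 : s ≤ 4 * m^19 := by
      have : (m+1)^17 ≤ (2*m)^17 := Nat.pow_le_pow_left (by omega) 17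
      rw [mul_pow] at this
      have e2 : 2^15 ≤ m^2 := by nlinarith
      have e3 : m^19 = m^2 * m^17 := by ring
      have e4 : 2^15 * m^17 ≤ m^2 * m^17 := Nat.mul_le_mul_right _ e2
      rw [e3]; omega
    have e5 : 4 * h * m^2 ≤ m^20 := by
      have : 4 * h * m^2 * 4 ≤ s * m := by nlinarith
      have e6 : s * m ≤ 4 * m^19 * m := Nat.mul_le_mul_right _ e1
      have e7 : m^20 = m^19 * m := by ring
      nlinarith
    calc 2 * s * (2*s*h) * m^2 = s^2 * (4 * h * m^2) := by ring
      _ ≤ s^2 * m^20 := Nat.mul_le_mul_left _ e5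
      _ = _ := by ring
  · have : m^11 = m^10 * m := by ring
    rw [this]; nlinarith [Nat.mul_le_mul_left (m^10) hm]
  · have := cube_le h (by omega)
    refine le_trans ?_ this
    have : s * h ≤ 32 * (h * m) * h := Nat.mul_le_mul_right _ hs32
    have e : h * m * h ≤ h^3 := by
      calc h * m * h ≤ h * h * h := Nat.mul_le_mul_right _ (Nat.mul_le_mul_left _ hh1)
        _ = h^3 := by ring
    nlinarith
  · have e1 : m + 1 ≤ m^2 := by nlinarith
    calc s * s ≤ (m+1)^17 * (m+1)^17 := Nat.mul_le_mul hm2.le hm2.le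
      _ = (m+1)^34 := by ring
      _ ≤ (m^2)^34 := Nat.pow_le_pow_left e1 34
      _ = m^68 := by rw [← pow_mul]

lemma params (s : ℕ) (hs0 : 201^17 ≤ s) : ∃ m A h Γ Q : ℕ, Par s m A h ∧
    2 * ((m:ℤ) + A + Γ) < (Q + 1) * ((s:ℤ) - A - 4 * m * h) ∧ 0 < Γ ∧
    2 * s * (2*s*h) * m^2 ≤ Γ^2 ∧ A = m^16 ∧ 2*Q+1 ≤ m^11 ∧ 2*s*h ≤ 2^h ∧ s ≤ 32 * (h * m) ∧
    s * s ≤ m ^ 68 := by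
  obtain ⟨m, hm1, hm2⟩ := root_exists s
  have hm : 201 ≤ m := by
    have := lt_of_pow_lt_pow_left₀ 17 (Nat.zero_le _) (lt_of_le_of_lt hs0 hm2)
    exact Nat.lt_succ_iff.1 this
  exact ⟨m, params_aux s m hm hm1 hm2⟩

/-- the cycle-factor event -/
def Tooth (s : ℕ) (W : Finset (ZMod (s*s) × ZMod (s*s))) : Prop :=
  ∃ ψ : Fin s × Fin s → ZMod (s*s), Function.Bijective ψ ∧
    ∀ k a b : Fin s, ((a:ℕ) + 1) % s = b → (ψ (k,b) = ψ (k,a) + 1 ∨ (ψ (k,a) + 1, ψ (k,b)) ∈ W)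

theorem teeth_main {η : ℝ} (hη : 0 < η) : ∃ ρ : ℝ, 0 < ρ ∧ ∃ s0 : ℕ, ∀ (s : ℕ) [NeZero (s*s)] (p : ℝ), s0 ≤ s →
    0 < p → p ≤ 1 → 131072 / ((s:ℝ)^2 * p) ≤ ρ →
    bv univ (fun _ => 1 - (1 - p) ^ 69)
      (fun W : Finset (ZMod (s*s) × ZMod (s*s)) => ind (¬ Tooth s W)) ≤ η := by
  classical
  obtain ⟨ρ, hρ, hmain⟩ := links_main 68 hη
  refine ⟨ρ, hρ, 201^17, ?_⟩
  intro s _ p hs0 hp hp1 hb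
  obtain ⟨m, A, h, Γ, Q, hP, hQ, hΓ, hbb, hA, hG, hN, hsm, hn⟩ := params s hs0
  have hspos := s_pos hP
  have hsr : (0:ℝ) < s := by exact_mod_cast hspos
  have hne : (O0 s m A h Γ).Nonempty := by
    rw [← card_pos]
    have := good_card (A := A) hΓ hbb
    have hA1 : 0 < A := lt_of_lt_of_le hP.hm hP.hA
    have : 0 < Fintype.card (Om s m A h) := by
      rw [Fintype.card_pos_iff]
      exact ⟨(1, fun _ => ⟨0, hP.hm⟩, fun _ => ⟨0, hA1⟩)⟩
    omega
  have key := hmain (ZMod (s*s)) (Om s m A h) (Fin (2*s) × Fin (h+1)) (O0 s m A h Γ) TT HH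
    (256 / (s:ℝ)^2) p m hne (fun ω _ => TT_injective hP ω) (fun ω _ => HH_injective hP ω)
    (by
      intro ω hω L
      have := spread_real hP hω hQ hΓ hbb hA hG hN hsm L
        ((O0 s m A h Γ).filter (fun ω' => ∀ l ∈ L, ∃ l', TT ω' l' = TT ω l ∧ HH ω' l' = HH ω l))
        (fun w hw => mem_filter.1 hw)
      convert this)
    (by positivity) hp hp1 hP.hm
    (by
      refine le_trans ?_ hb
      rw [div_le_div_iff₀ hp (by positivity)]
      have : 2 * (256 / (s:ℝ)^2) * ((s:ℝ)^2 * p) = 512 * p := by field_simp; norm_num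
      rw [this]; nlinarith)
    (by
      refine le_trans (le_of_eq ?_) hb
      rw [ZMod.card]; push_cast; field_simp; norm_num)
    (by rw [ZMod.card]; exact hn)
  refine le_trans ?_ key
  have hq0 : (0:ℝ) ≤ (1-p)^69 := by apply pow_nonneg; linarith
  have hq1 : (1-p)^69 ≤ 1 := pow_le_one₀ (by linarith) (by linarith)
  apply bv_mono
  · intro _; linarith
  · intro _; linarith
  · intro W _
    apply ind_mono
    intro hT hex
    apply hT
    obtain ⟨ω, _, hω⟩ := hex
    obtain ⟨ψ, hψ, h2⟩ := cycle_factor hP ω (fun u v => v = u + 1 ∨ (u + 1, v) ∈ W)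
      (fun v => Or.inl rfl) (fun l => Or.inr (by simpa using hω l))
    exact ⟨ψ, hψ, h2⟩

end spread
end CombProof


namespace CombProof
open Finset
set_option linter.unusedSectionVars false

section det
variable {V : Type} [DecidableEq V] [Fintype V]

lemma ham_equiv {n : ℕ} [NeZero n] (hn : Fintype.card V = n) {r : V → V → Prop} (h : Ham r) :
    ∃ e : ZMod n ≃ V, ∀ v, r (e v) (e (v+1)) := by
  classical
  obtain ⟨l, hnd, hall, hch, hcl⟩ := h
  have hlen : l.length = n := by
    rw [← List.toFinset_card_of_nodup hnd, ← hn, ← card_univ]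
    congr 1
    ext v; simp [hall v]
  have hv : ∀ v : ZMod n, v.val < l.length := fun v => by rw [hlen]; exact ZMod.val_lt v
  let f : ZMod n → V := fun v => l[v.val]'(hv v)
  have hf : Function.Injective f := by
    intro u v huv
    have := (List.Nodup.getElem_inj_iff hnd).1 huv
    exact ZMod.val_injective n this
  have hb : Function.Bijective f :=
    (Fintype.bijective_iff_injective_and_card f).2 ⟨hf, by rw [ZMod.card, hn]⟩
  refine ⟨Equiv.ofBijective f hb, fun v => ?_⟩
  show r (l[v.val]'(hv v)) (l[(v+1).val]'(hv (v+1)))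
  by_cases h1 : v.val + 1 < n
  · have hval : (v+1).val = v.val + 1 := by
      rw [ZMod.val_add, ZMod.val_one_eq_one_mod, Nat.add_mod_mod, Nat.mod_eq_of_lt h1]
    have := List.isChain_iff_getElem.1 hch v.val (by rw [hlen]; exact h1)
    simpa only [hval] using this
  · have hlt := ZMod.val_lt v
    have he : v.val + 1 = n := by omega
    have hval : (v+1).val = 0 := by
      rw [ZMod.val_add, ZMod.val_one_eq_one_mod, Nat.add_mod_mod, he, Nat.mod_self]
    have hpos : 0 < l.length := by rw [hlen]; omega
    have := hcl (l[v.val]'(hv v)) (by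
      have : v.val = l.length - 1 := by omega
      rw [List.getLast?_eq_getElem?]; simp only [this]
      rw [List.getElem?_eq_getElem (by omega)]; rfl) (l[0]'hpos) (by
      rw [List.head?_eq_getElem?, List.getElem?_eq_getElem hpos]; rfl)
    simpa only [hval] using this

lemma comb_of {s : ℕ} [NeZero s] {χ : Fin s × Fin s → V} (hχ : Function.Bijective χ) {r : V → V → Prop}
    (hr : ∀ u v, r u v → r v u)
    (h1 : ∀ k a b : Fin s, ((a:ℕ)+1) % s = b → r (χ (k,a)) (χ (k,b)))
    (ω : Equiv.Perm (Fin s) × (Fin s → Fin s))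
    (h2 : ∀ i j : Fin s, (i:ℕ)+1 = j → r (χ (spv ω i)) (χ (spv ω j))) :
    ∃ φ : Fin s × Fin s ≃ V, ∀ a b, (comb s).Adj a b → r (φ a) (φ b) := by
  let g : Fin s × Fin s → Fin s × Fin s := fun x => (ω.1.symm x.1, ω.2 (ω.1.symm x.1) + x.2)
  have hg : Function.Injective g := by
    rintro ⟨i, j⟩ ⟨i', j'⟩ h
    have e1 : i = i' := ω.1.symm.injective (congrArg Prod.fst h)
    subst e1
    have e2 := congrArg Prod.snd h
    have e3 : j = j' := add_left_cancel e2
    rw [e3]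
  have hgb : Function.Bijective g := Finite.injective_iff_bijective.1 hg
  refine ⟨Equiv.ofBijective (χ ∘ g) (hχ.comp hgb), ?_⟩
  have key : ∀ a b : Fin s × Fin s, (((a.2 : ℕ) = 0 ∧ (b.2 : ℕ) = 0 ∧ (a.1 : ℕ) + 1 = (b.1 : ℕ)) ∨
    (a.1 = b.1 ∧ (a.2 : ℕ) + 1 = (b.2 : ℕ))) → r (χ (g a)) (χ (g b)) := by
    rintro ⟨i, j⟩ ⟨i', j'⟩ (⟨ha, hb, hc⟩ | ⟨ha, hb⟩)
    · simp only at ha hb hc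
      have e1 : j = 0 := Fin.ext (by simpa using ha)
      have e2 : j' = 0 := Fin.ext (by simpa using hb)
      subst e1 e2
      have := h2 i i' hc
      simpa [g, spv] using this
    · simp only at ha hb
      subst ha
      apply h1
      rw [Fin.val_add, Fin.val_add, ← hb]
      rw [Nat.mod_add_mod, add_assoc]
  intro a b hab
  rw [comb, SimpleGraph.fromRel_adj] at hab
  rcases hab.2 with h | h
  · exact key a b h
  · exact hr _ _ (key b a h)

end det

section bvx

lemma bv_equiv {E E' : Type*} [DecidableEq E] [DecidableEq E'] [Fintype E] [Fintype E'] (g : E' ≃ E) (p : ℝ)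
    (f : Finset E → ℝ) :
    bv univ (fun _ => p) f = bv univ (fun _ : E' => p) (fun W => f (W.image g)) := by
  have := bv_image (E := E) (univ : Finset E') g p (fun _ => 0) f
  simp only [bv_zero, empty_union] at this
  rw [this]
  refine bv_congr_v (fun e _ => ?_) f
  have : (univ.filter (fun a => g a = e)) = {g.symm e} := by
    ext a; simp [Equiv.eq_symm_apply]
  rw [this]; simp

lemma bv_restrict {E : Type*} [DecidableEq E] [Fintype E] (K : Finset E) (v : E → ℝ) (f : Finset E → ℝ)
    (hf : ∀ a ∉ K, ∀ W, f (insert a W) = f W) : bv univ v f = bv K v f := by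
  have : ∀ T : Finset E, Disjoint T K → bv (T ∪ K) v f = bv K v f := by
    intro T
    induction T using Finset.induction_on with
    | empty => intro _; rw [empty_union]
    | insert a T ha ih =>
      intro hd
      rw [disjoint_insert_left] at hd
      rw [insert_union, bv_insert (by simp [ha, hd.1]), ih hd.2]
      simp only [hf a hd.1]
      rw [ih hd.2]; ring
  have h := this (univ \ K) disjoint_sdiff_self_left
  rwa [sdiff_union_of_subset (subset_univ K)] at h

variable {V : Type} [DecidableEq V] [Fintype V]

lemma tooth_prob {s : ℕ} [NeZero (s*s)] (e : ZMod (s*s) ≃ V) (q : ℝ) :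
    bv univ (fun _ => q) (fun W : Finset (V × V) =>
      ind (¬ Tooth s (univ.filter (fun x => (e (x.1 - 1), e x.2) ∈ W)))) =
    bv univ (fun _ => q) (fun W : Finset (ZMod (s*s) × ZMod (s*s)) => ind (¬ Tooth s W)) := by
  let g : ZMod (s*s) × ZMod (s*s) ≃ V × V := ((Equiv.subRight 1).trans e).prodCongr e
  rw [bv_equiv g]
  congr 1
  funext W
  have : (univ.filter (fun x : ZMod (s*s) × ZMod (s*s) => (e (x.1 - 1), e x.2) ∈ W.image g)) = W := by
    ext x
    have hx : (e (x.1 - 1), e x.2) = g x := rfl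
    rw [mem_filter, hx, mem_image]
    simp
  rw [this]

lemma spine_prob {s : ℕ} (χ : Fin s × Fin s ≃ V) (q : ℝ) :
    bv univ (fun _ => q) (fun W : Finset (V × V) =>
      ind (¬ ∃ ω : Equiv.Perm (Fin s) × (Fin s → Fin s), ∀ i j : Fin s, (i:ℕ)+1=j → (χ (spv ω i), χ (spv ω j)) ∈ W)) =
    bv univ (fun _ => q) (fun W : Finset ((Fin s × Fin s) × (Fin s × Fin s)) =>
      ind (¬ ∃ ω : Equiv.Perm (Fin s) × (Fin s → Fin s), ∀ i j : Fin s, (i:ℕ)+1=j → (spv ω i, spv ω j) ∈ W)) := by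
  rw [bv_equiv (χ.prodCongr χ)]
  congr 1
  funext W
  have : ∀ x y, (χ x, χ y) ∈ W.image (χ.prodCongr χ) ↔ (x, y) ∈ W := by
    intro x y
    have hx : (χ x, χ y) = (χ.prodCongr χ) (x, y) := rfl
    rw [hx, mem_image]
    simp
  simp only [this]

/-- the directed pairs contain a comb -/
def GoodD (s : ℕ) (D : Finset (V × V)) : Prop :=
  ∃ φ : Fin s × Fin s ≃ V, ∀ a b, (comb s).Adj a b → adj D (φ a) (φ b)

lemma GoodD.mono {s : ℕ} {D D' : Finset (V × V)} (h : D ⊆ D') (hD : GoodD s D) : GoodD s D' := by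
  obtain ⟨φ, hφ⟩ := hD
  exact ⟨φ, fun a b hab => adj_mono h (hφ a b hab)⟩

theorem assemble {s : ℕ} [NeZero s] [NeZero (s*s)] (hV : Fintype.card V = s * s) {q1 q2 q3 η : ℝ}
    (h10 : 0 ≤ q1) (h11 : q1 ≤ 1) (h20 : 0 ≤ q2) (h21 : q2 ≤ 1) (h30 : 0 ≤ q3) (h31 : q3 ≤ 1) (hη : 0 ≤ η)
    (H1 : bv univ (fun _ => q1) (fun W : Finset (V × V) => ind (¬ Ham (adj W))) ≤ η)
    (H2 : bv univ (fun _ => q2) (fun W : Finset (ZMod (s*s) × ZMod (s*s)) => ind (¬ Tooth s W)) ≤ η)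
    (H3 : bv univ (fun _ => q3) (fun W : Finset ((Fin s × Fin s) × (Fin s × Fin s)) =>
      ind (¬ ∃ ω : Equiv.Perm (Fin s) × (Fin s → Fin s), ∀ i j : Fin s, (i:ℕ)+1=j → (spv ω i, spv ω j) ∈ W)) ≤ η) :
    bv univ (fun _ => 1 - (1 - q3) * ((1 - q2) * (1 - q1))) (fun W : Finset (V × V) => ind (¬ GoodD s W)) ≤ 3 * η := by
  classical
  -- third layer
  have L3 : ∀ (D W2 : Finset (V × V)) (e : ZMod (s*s) ≃ V), (∀ v, adj D (e v) (e (v+1))) →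
      Tooth s (univ.filter (fun x => (e (x.1 - 1), e x.2) ∈ W2)) →
      bv univ (fun _ => q3) (fun W : Finset (V × V) => ind (¬ GoodD s (W ∪ (W2 ∪ D)))) ≤ η := by
    intro D W2 e he ⟨ψ, hψ, hT⟩
    refine le_trans ?_ H3
    have hχ : Function.Bijective (e ∘ ψ) := e.bijective.comp hψ
    rw [← spine_prob (Equiv.ofBijective _ hχ)]
    refine bv_mono (fun _ => h30) (fun _ => h31) (fun W _ => ind_mono ?_)
    rintro hG ⟨ω, hω⟩
    apply hG
    refine comb_of hχ (fun u v h => h.symm) ?_ ω ?_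
    · intro k a b hab
      rcases hT k a b hab with h | h
      · have := he (ψ (k,a))
        rw [← h] at this
        exact adj_mono (subset_union_right.trans subset_union_right) this
      · rw [mem_filter] at h
        have h := h.2
        simp only [add_sub_cancel_right] at h
        exact Or.inl (mem_union_right _ (mem_union_left _ h))
    · intro i j hij
      exact Or.inl (mem_union_left _ (hω i j hij))
  have L2 : ∀ D : Finset (V × V),
      bv univ (fun _ => q2) (fun W2 => bv univ (fun _ => q3)
        (fun W : Finset (V × V) => ind (¬ GoodD s (W ∪ (W2 ∪ D))))) ≤ ind (¬ Ham (adj D)) + 2 * η := by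
    intro D
    by_cases hH : Ham (adj D)
    · obtain ⟨e, he⟩ := ham_equiv hV hH
      rw [ind_false (not_not.2 hH)]
      have hle : bv univ (fun _ => q2) (fun W2 => bv univ (fun _ => q3)
        (fun W : Finset (V × V) => ind (¬ GoodD s (W ∪ (W2 ∪ D))))) ≤
        bv univ (fun _ => q2) (fun W2 : Finset (V × V) =>
          ind (¬ Tooth s (univ.filter (fun x => (e (x.1 - 1), e x.2) ∈ W2))) + η) := by
        refine bv_mono (fun _ => h20) (fun _ => h21) (fun W2 _ => ?_)
        by_cases hT : Tooth s (univ.filter (fun x => (e (x.1 - 1), e x.2) ∈ W2))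
        · rw [ind_false (not_not.2 hT), zero_add]
          exact L3 D W2 e he hT
        · rw [ind_true hT]
          have := bv_le_const (s := univ) (v := fun _ : V × V => q3) (fun _ => h30) (fun _ => h31)
            (f := fun W : Finset (V × V) => ind (¬ GoodD s (W ∪ (W2 ∪ D)))) (c := 1) (fun W => ind_le_one _)
          linarith
      rw [bv_add, bv_const, tooth_prob] at hle
      linarith
    · rw [ind_true hH]
      have := bv_le_const (s := univ) (v := fun _ : V × V => q2) (fun _ => h20) (fun _ => h21)
        (f := fun W2 => bv univ (fun _ => q3)
        (fun W : Finset (V × V) => ind (¬ GoodD s (W ∪ (W2 ∪ D))))) (c := 1) (fun W2 => by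
          exact bv_le_const (fun _ => h30) (fun _ => h31) (fun W => ind_le_one _))
      linarith
  have e1 : bv univ (fun _ => 1 - (1 - q3) * ((1 - q2) * (1 - q1))) (fun W : Finset (V × V) => ind (¬ GoodD s W)) =
      bv univ (fun _ => q1) (fun D => bv univ (fun _ => q2) (fun W2 => bv univ (fun _ => q3)
        (fun W : Finset (V × V) => ind (¬ GoodD s (W ∪ (W2 ∪ D)))))) := by
    rw [bv_union q1 q2 (fun X => bv univ (fun _ => q3) (fun W : Finset (V × V) => ind (¬ GoodD s (W ∪ X))))]
    rw [bv_union _ q3 (fun X : Finset (V × V) => ind (¬ GoodD s X))]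
    congr 1; funext _; ring
  rw [e1]
  calc _ ≤ bv univ (fun _ => q1) (fun D : Finset (V × V) => ind (¬ Ham (adj D)) + 2 * η) :=
        bv_mono (fun _ => h10) (fun _ => h11) (fun D _ => L2 D)
    _ ≤ 3 * η := by rw [bv_add, bv_const]; linarith

end bvx
end CombProof


namespace CombProof
open Finset Filter Topology
set_option linter.unusedSectionVars false

lemma gnp_eq (n : ℕ) (p : ℝ) (A : SimpleGraph (Fin n) → Prop) (K : Finset (Sym2 (Fin n)))
    (hK : ∀ e, e ∈ K ↔ ¬ e.IsDiag) :
    gnpProb n p A = bv K (fun _ => p) (fun W => ind (A (SimpleGraph.fromEdgeSet (W : Set (Sym2 (Fin n)))))) := by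
  classical
  have hKc : K.card = n.choose 2 := by
    have := SimpleGraph.card_edgeFinset_top_eq_card_choose_two (V := Fin n)
    rw [Fintype.card_fin] at this
    rw [← this]
    congr 1
    ext e
    rw [hK, SimpleGraph.mem_edgeFinset, SimpleGraph.edgeSet_top]
    simp
  let _ : Fintype (SimpleGraph (Fin n)) := Fintype.ofFinite _
  unfold gnpProb
  have h1 := _root_.tsum_subtype {G : SimpleGraph (Fin n) | A G}
    (fun H => p ^ H.edgeSet.ncard * (1 - p) ^ (n.choose 2 - H.edgeSet.ncard))
  refine h1.trans ?_
  rw [tsum_fintype]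
  unfold bv
  symm
  refine Finset.sum_bij' (fun W _ => SimpleGraph.fromEdgeSet (W : Set (Sym2 (Fin n))))
    (fun G _ => K.filter (fun e => e ∈ G.edgeSet)) (fun _ _ => mem_univ _) ?_ ?_ ?_ ?_
  · intro G _; exact mem_powerset.2 (filter_subset _ _)
  · intro W hW
    have hW := mem_powerset.1 hW
    ext e
    refine (@mem_filter _ _ (_) _ _).trans ?_
    rw [SimpleGraph.edgeSet_fromEdgeSet, hK]
    constructor
    · intro h; exact_mod_cast h.2.1
    · intro h; exact ⟨(hK e).1 (hW h), by exact_mod_cast h, (hK e).1 (hW h)⟩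
  · intro G _
    ext a b
    rw [SimpleGraph.fromEdgeSet_adj]
    simp only [coe_filter, hK, Set.mem_ofPred_eq, SimpleGraph.mem_edgeSet, Sym2.mk_isDiag_iff]
    constructor
    · intro h; exact h.1.2
    · intro h; exact ⟨⟨h.ne, h⟩, h.ne⟩
  · intro W hW
    have hW := mem_powerset.1 hW
    have he : (SimpleGraph.fromEdgeSet (W : Set (Sym2 (Fin n)))).edgeSet = (W : Set (Sym2 (Fin n))) := by
      rw [SimpleGraph.edgeSet_fromEdgeSet]
      ext e
      constructor
      · intro h; exact h.1
      · intro h; exact ⟨h, (hK e).1 (hW (by exact_mod_cast h))⟩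
    rw [Set.indicator_apply]
    simp only [prod_const, he, Set.ncard_coe_finset, card_sdiff_of_subset hW, hKc]
    by_cases hA : A (SimpleGraph.fromEdgeSet (W : Set (Sym2 (Fin n))))
    · rw [ind_true hA, mul_one]; exact (if_pos (show _ ∈ {G | A G} from hA)).symm
    · rw [ind_false hA, mul_zero]; exact (if_neg (show ¬ _ ∈ {G | A G} from hA)).symm

lemma gnp_ge {s : ℕ} {p q : ℝ} (hq0 : 0 ≤ q) (hq1 : q ≤ 1) (hp1 : p ≤ 1) (hqp : 2 * q ≤ p) :
    1 - bv univ (fun _ => q) (fun W : Finset (Fin (s*s) × Fin (s*s)) => ind (¬ GoodD s W)) ≤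
      gnpProb (s*s) p (ContainsSpanningComb s) ∧ gnpProb (s*s) p (ContainsSpanningComb s) ≤ 1 := by
  classical
  set K : Finset (Sym2 (Fin (s*s))) := univ.filter (fun e => ¬ e.IsDiag) with hKd
  have hK : ∀ e, e ∈ K ↔ ¬ e.IsDiag := fun e => by simp [hKd]
  rw [gnp_eq _ _ _ K hK]
  set f : Finset (Sym2 (Fin (s*s))) → ℝ := fun W =>
    ind (ContainsSpanningComb s (SimpleGraph.fromEdgeSet (W : Set (Sym2 (Fin (s*s)))))) with hf
  have hp0 : 0 ≤ p := by linarith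
  refine ⟨?_, bv_le_const (fun _ => hp0) (fun _ => hp1) (fun W => ind_le_one _)⟩
  have hmono : Monotone f := by
    intro W W' h
    apply ind_mono
    rintro ⟨φ, hφ⟩
    refine ⟨φ, fun a b hab => ?_⟩
    have := hφ a b hab
    rw [SimpleGraph.fromEdgeSet_adj] at this ⊢
    exact ⟨h this.1, this.2⟩
  have hu0 : 0 ≤ 1 - (1-q)^2 := by nlinarith
  have hu1 : 1 - (1-q)^2 ≤ p := by nlinarith
  have h1 : bv K (fun _ => 1 - (1-q)^2) f ≤ bv K (fun _ => p) f :=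
    bv_mono_v (fun _ => hu0) (fun _ => hp1) (fun _ => hu1) hmono
  refine le_trans ?_ h1
  have h2 := bv_image (E := Sym2 (Fin (s*s))) (univ : Finset (Fin (s*s) × Fin (s*s)))
    (fun x => s(x.1, x.2)) q (fun _ => 0) f
  simp only [bv_zero, empty_union] at h2
  rw [bv_restrict K] at h2
  · have h3 : bv K (fun _ => 1 - (1-q)^2) f = bv univ (fun _ => q)
        (fun D : Finset (Fin (s*s) × Fin (s*s)) => f (D.image (fun x => s(x.1, x.2)))) := by
      rw [h2]
      refine bv_congr_v (fun e he => ?_) f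
      have he := (hK e).1 he
      induction e using Sym2.ind with
      | _ a b =>
        rw [Sym2.mk_isDiag_iff] at he
        have : (univ.filter (fun x : Fin (s*s) × Fin (s*s) => s(x.1, x.2) = s(a,b))) = {(a,b),(b,a)} := by
          ext ⟨x, y⟩
          simp
        rw [this, card_pair (by intro h; exact he (congrArg Prod.fst h))]
        ring
    rw [h3]
    have h4 : (1:ℝ) - bv univ (fun _ => q) (fun W : Finset (Fin (s*s) × Fin (s*s)) => ind (¬ GoodD s W)) =
        bv univ (fun _ => q) (fun W : Finset (Fin (s*s) × Fin (s*s)) => 1 - ind (¬ GoodD s W)) := by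
      rw [bv_sub, bv_const]
    rw [h4]
    refine bv_mono (fun _ => hq0) (fun _ => hq1) (fun D _ => ?_)
    rw [ind_not, sub_sub_cancel]
    apply ind_mono
    rintro ⟨φ, hφ⟩
    refine ⟨φ, fun a b hab => ?_⟩
    rw [SimpleGraph.fromEdgeSet_adj]
    refine ⟨?_, fun h => hab.ne (φ.injective h)⟩
    rw [mem_coe, mem_image]
    rcases hφ a b hab with h | h
    · exact ⟨_, h, rfl⟩
    · exact ⟨_, h, Sym2.eq_swap⟩
  · intro a ha W
    have ha : a.IsDiag := by
      by_contra h; exact ha ((hK a).2 h)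
    have : SimpleGraph.fromEdgeSet ((insert a W : Finset (Sym2 (Fin (s*s)))) : Set (Sym2 (Fin (s*s)))) =
        SimpleGraph.fromEdgeSet (W : Set (Sym2 (Fin (s*s)))) := by
      ext x y
      rw [SimpleGraph.fromEdgeSet_adj, SimpleGraph.fromEdgeSet_adj]
      constructor
      · rintro ⟨h, hne⟩
        rw [mem_coe, mem_insert] at h
        rcases h with h | h
        · rw [← h, Sym2.mk_isDiag_iff] at ha; exact absurd ha hne
        · exact ⟨h, hne⟩
      · rintro ⟨h, hne⟩
        exact ⟨mem_insert_of_mem h, hne⟩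
    simp only [hf, this]

lemma one_sub_pow_le {p : ℝ} (h0 : 0 ≤ p) (h1 : p ≤ 1) (j : ℕ) : 1 - (1-p)^j ≤ j * p := by
  have := one_sub_pow_ge h0 h1 j
  linarith

lemma union_arith {q1 q2 q3 : ℝ} (h20 : 0 ≤ q2) (h21 : q2 ≤ 1) (h30 : 0 ≤ q3) (h31 : q3 ≤ 1)
    (h10 : 0 ≤ q1) (h11 : q1 ≤ 1) : 1 - (1 - q3) * ((1 - q2) * (1 - q1)) ≤ q1 + q2 + q3 := by
  have e1 : 1 - (q1 + q2) ≤ (1 - q2) * (1 - q1) := by nlinarith [mul_nonneg h20 h10]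
  have e2 : 0 ≤ (1 - q2) * (1 - q1) := mul_nonneg (by linarith) (by linarith)
  have e3 : (1 - q2) * (1 - q1) ≤ 1 := mul_le_one₀ (by linarith) (by linarith) (by linarith)
  nlinarith [mul_le_mul_of_nonneg_left e3 h30]

theorem main_ev {ε η : ℝ} (hε : 0 < ε) (hη : 0 < η) : ∀ᶠ s : ℕ in atTop,
    1 - 3 * η ≤ gnpProb (s*s) ((2 + ε) * Real.log (s * s) / (s * s)) (ContainsSpanningComb s) ∧
    gnpProb (s*s) ((2 + ε) * Real.log (s * s) / (s * s)) (ContainsSpanningComb s) ≤ 1 := by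
  obtain ⟨n0, hham⟩ := ham_whp hη
  obtain ⟨ρ1, hρ1, s0, hteeth⟩ := teeth_main hη
  obtain ⟨ρ2, hρ2, hspine⟩ := spine_main hη
  set c : ℝ := ε / 288 with hc
  have hcp : 0 < c := by positivity
  have hn : Tendsto (fun s : ℕ => ((s:ℝ) * s)) atTop atTop :=
    tendsto_natCast_atTop_atTop.atTop_mul_atTop₀ tendsto_natCast_atTop_atTop
  have hlog : Tendsto (fun s : ℕ => Real.log ((s:ℝ) * s)) atTop atTop := Real.tendsto_log_atTop.comp hn
  have hrat : Tendsto (fun s : ℕ => Real.log ((s:ℝ) * s) / ((s:ℝ) * s)) atTop (𝓝 0) :=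
    (Real.isLittleO_log_id_atTop.tendsto_div_nhds_zero).comp hn
  have hrat2 : Tendsto (fun s : ℕ => (2 + ε) * (Real.log ((s:ℝ) * s) / ((s:ℝ) * s))) atTop (𝓝 0) := by
    simpa using hrat.const_mul (2 + ε)
  filter_upwards [eventually_ge_atTop (n0 + s0 + 1), hlog.eventually_ge_atTop (4 * 3456 / ε),
    hlog.eventually_ge_atTop (131072 / (c * ρ1)), hlog.eventually_ge_atTop (32 / (c * ρ2)),
    hlog.eventually_ge_atTop 1, hrat2.eventually_le_const (show (0:ℝ) < 1 by norm_num)] with s hs hl1 hl2 hl3 hl4 hp1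
  have hspos : 0 < s := by omega
  have hsr : (0:ℝ) < s := by exact_mod_cast hspos
  have : NeZero s := ⟨by omega⟩
  have : NeZero (s*s) := ⟨(Nat.mul_pos hspos hspos).ne'⟩
  set L := Real.log ((s:ℝ) * s) with hL
  set N : ℝ := (s:ℝ) * s with hN
  have hNp : 0 < N := by positivity
  have hLp : 0 < L := by linarith
  set x := L / N with hx
  have hxp : 0 < x := by positivity
  have hpe : (2 + ε) * L / N = (2+ε) * x := by rw [hx]; ring
  rw [hpe]
  have hcard : Fintype.card (Fin (s*s)) = s * s := Fintype.card_fin _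
  -- layer probabilities
  set q1 := (L + 3456) / N with hq1
  have hq1b : q1 ≤ (1 + ε/4) * x := by
    rw [hq1, hx, mul_div_assoc', div_le_div_iff_of_pos_right hNp]
    have : 4 * 3456 ≤ L * ε := (div_le_iff₀ hε).1 hl1
    nlinarith
  have hq10 : 0 ≤ q1 := by positivity
  have hεx : 0 < ε * x := by positivity
  have hq11 : q1 ≤ 1 := by nlinarith
  have hpt0 : 0 < c * x := by positivity
  have hpt1 : c * x ≤ 1 := by rw [hc]; nlinarith
  have hcx : 288 * (c * x) = ε * x := by rw [hc]; ring
  have hsq : (s:ℝ)^2 * (c * x) = c * L := by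
    rw [hx, show (s:ℝ)^2 = N by rw [hN]; ring]; field_simp
  have H1 := hham (Fin (s*s)) (by rw [hcard]; nlinarith) q1 (by rw [hcard]; push_cast; exact le_rfl) hq11
  have H2 := hteeth s (c * x) (by omega) hpt0 hpt1 (by
    rw [hsq, div_le_iff₀ (by positivity)]
    have := (div_le_iff₀ (by positivity)).1 hl2
    linarith)
  have H3 := hspine s (c * x) (by omega) hpt0 hpt1 (by
    rw [hsq, div_le_iff₀ (by positivity)]
    have := (div_le_iff₀ (by positivity)).1 hl3
    linarith)
  have hb : ∀ j : ℕ, 0 ≤ (1 - c*x)^j ∧ (1 - c*x)^j ≤ 1 := fun j =>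
    ⟨pow_nonneg (by linarith) j, pow_le_one₀ (by linarith) (by linarith)⟩
  have hq2 := one_sub_pow_le hpt0.le hpt1 69
  have hq3 := one_sub_pow_le hpt0.le hpt1 3
  push_cast at hq2 hq3
  have h20 : 0 ≤ 1 - (1 - c*x)^69 := by linarith [(hb 69).2]
  have h21 : 1 - (1 - c*x)^69 ≤ 1 := by linarith [(hb 69).1]
  have h30 : 0 ≤ 1 - (1 - c*x)^3 := by linarith [(hb 3).2]
  have h31 : 1 - (1 - c*x)^3 ≤ 1 := by linarith [(hb 3).1]
  generalize 1 - (1 - c*x)^69 = q2 at *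
  generalize 1 - (1 - c*x)^3 = q3 at *
  have key := assemble (V := Fin (s*s)) hcard hq10 hq11 h20 h21 h30 h31 hη.le H1 H2 H3
  clear H1 H2 H3 hb
  set q := 1 - (1 - q3) * ((1 - q2) * (1 - q1)) with hq
  have ha : 0 ≤ (1 - q2) * (1 - q1) := mul_nonneg (by linarith) (by linarith)
  have ha1 : (1 - q2) * (1 - q1) ≤ 1 := mul_le_one₀ (by linarith) (by linarith) (by linarith)
  have hqle : q ≤ q1 + q2 + q3 := union_arith h20 h21 h30 h31 hq10 hq11
  have hqq0 : 0 ≤ q := by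
    have := mul_le_one₀ (show 1 - q3 ≤ 1 by linarith) ha ha1
    linarith
  have hqq1 : q ≤ 1 := by
    have := mul_nonneg (show 0 ≤ 1 - q3 by linarith) ha
    linarith
  have := gnp_ge (s := s) (p := (2+ε) * x) hqq0 hqq1 hp1 (by linarith)
  exact ⟨by linarith [this.1], this.2⟩

end CombProof

theorem stmt19 (ε : ℝ) (hε : 0 < ε) (s : ℕ → ℕ)
    (hs : Filter.Tendsto s Filter.atTop Filter.atTop) :
    Filter.Tendsto
      (fun i => gnpProb (s i * s i)
        ((2 + ε) * Real.log (s i * s i) / (s i * s i))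
        (ContainsSpanningComb (s i)))
      Filter.atTop (nhds 1) := by
  rw [Metric.tendsto_atTop']
  intro δ hδ
  have h := hs.eventually (CombProof.main_ev hε (show 0 < δ / 6 by positivity))
  obtain ⟨i0, hi⟩ := Filter.eventually_atTop.1 h
  refine ⟨i0, fun i hi' => ?_⟩
  have := hi i hi'.le
  rw [Real.dist_eq, abs_lt]
  constructor <;> linarith [this.1, this.2]
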